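/- arXiv:1109.0635 — 4 statements merged into one kernel-verified Lean document; each statement's English description precedes it below -/
import Mathlib

section
/- Let T be an ergodic measure preserving transformation of (X,𝓕,μ) and let (e_k)_{k≥0} be a sequence in L_d(μ) with e_0 ≡ 1 and, for every k ≥ 1, |e_k|_d = 1 and ∫_X e_k dμ = 0. Suppose f ∈ L_d(μ^d) admits a representation f(x_1,…,x_d) = Σ_{𝐤} λ_𝐤(f) e_{k_1}(x_1)⋯e_{k_d}(x_d) over multi-indices 𝐤 = (k_1,…,k_d), with Σ_{𝐤} |λ_𝐤(f)| < ∞. Then f ∈ L_{d,π}(μ^d) and, as n → ∞, (1/n^d) Σ_{0 ≤ k_1,…,k_d ≤ n−1} D_d V^{(k_1,…,k_d)} f converges μ-almost surely and in L_1(μ) to ∫_{X^d} f dμ^d. -/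
open MeasureTheory Filter Topology ENNReal ProbabilityTheory

noncomputable section

namespace VonMises

variable {X : Type} [MeasurableSpace X]

/-- The `d`-fold product measure `μ^d` on the power space `X^d`. -/
abbrev pm (μ : Measure X) (d : ℕ) : Measure (Fin d → X) := Measure.pi fun _ => μ

/-- `(E, tp)` is (a realization of) the projective tensor product
`L_{p 0}(μ) ⊗̂_π ⋯ ⊗̂_π L_{p (d-1)}(μ)`: `tp` is a continuous multilinear map
satisfying the cross-norm identity, whose range spans a dense subspace, and which has
the (isometric) universal lifting property of the projective tensor norm. -/
structure IsPTP (μ : Measure X) {d : ℕ} (p : Fin d → ℝ≥0∞) [∀ i, Fact (1 ≤ p i)]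
    (E : Type) [NormedAddCommGroup E] [NormedSpace ℝ E] [CompleteSpace E]
    (tp : ContinuousMultilinearMap ℝ (fun i : Fin d => Lp ℝ (p i) μ) E) : Prop where
  crossNorm : ∀ f : ∀ i : Fin d, Lp ℝ (p i) μ, ‖tp f‖ = ∏ i, ‖f i‖
  denseSpan : Dense (Submodule.span ℝ (Set.range fun f : ∀ i : Fin d, Lp ℝ (p i) μ => tp f) : Set E)
  lift : ∀ (F : Type) [NormedAddCommGroup F] [NormedSpace ℝ F] [CompleteSpace F]
      (g : ContinuousMultilinearMap ℝ (fun i : Fin d => Lp ℝ (p i) μ) F),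
      ∃ L : E →L[ℝ] F, (∀ f, L (tp f) = g f) ∧ ‖L‖ = ‖g‖

/-- `J` realizes the canonical map from the projective tensor product into `L_q(μ^d)`,
determined by its values on elementary tensors. -/
def IsEmbed (μ : Measure X) {d : ℕ} (p : Fin d → ℝ≥0∞) [∀ i, Fact (1 ≤ p i)]
    (q : ℝ≥0∞) [Fact (1 ≤ q)]
    {E : Type} [NormedAddCommGroup E] [NormedSpace ℝ E] [CompleteSpace E]
    (tp : ContinuousMultilinearMap ℝ (fun i : Fin d => Lp ℝ (p i) μ) E)
    (J : E →L[ℝ] Lp ℝ q (pm μ d)) : Prop :=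
  ∀ f, (J (tp f) : (Fin d → X) → ℝ) =ᵐ[pm μ d] fun x => ∏ i, (f i : X → ℝ) (x i)

/-- `D` realizes the diagonal restriction operator: the norm-one linear map sending an
elementary tensor `f_1 ⊗ ⋯ ⊗ f_d` to the pointwise product `x ↦ f_1(x)⋯f_d(x)`. -/
def IsDiag (μ : Measure X) {d : ℕ} (p : Fin d → ℝ≥0∞) [∀ i, Fact (1 ≤ p i)]
    (r : ℝ≥0∞) [Fact (1 ≤ r)]
    {E : Type} [NormedAddCommGroup E] [NormedSpace ℝ E] [CompleteSpace E]
    (tp : ContinuousMultilinearMap ℝ (fun i : Fin d => Lp ℝ (p i) μ) E)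
    (D : E →L[ℝ] Lp ℝ r μ) : Prop :=
  ‖D‖ = 1 ∧ ∀ f, (D (tp f) : X → ℝ) =ᵐ[μ] fun x => ∏ i, (f i : X → ℝ) x

/-- `W` realizes the tensor Koopman operator `V^k = V_1^{k_1} ⊗_π ⋯ ⊗_π V_d^{k_d}`,
where `V_i g = g ∘ T_i`. -/
def IsTKoop (μ : Measure X) {d : ℕ} (p : Fin d → ℝ≥0∞) [∀ i, Fact (1 ≤ p i)]
    {E : Type} [NormedAddCommGroup E] [NormedSpace ℝ E] [CompleteSpace E]
    (tp : ContinuousMultilinearMap ℝ (fun i : Fin d => Lp ℝ (p i) μ) E)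
    (T : Fin d → X → X) (k : Fin d → ℕ) (W : E →L[ℝ] E) : Prop :=
  ∀ f g : ∀ i : Fin d, Lp ℝ (p i) μ,
    (∀ i, (g i : X → ℝ) =ᵐ[μ] fun x => (f i : X → ℝ) ((T i)^[k i] x)) → W (tp f) = tp g

/-- `g = V^{*k} f`: the adjoint (transfer) operator applied to `f`, characterized by
`∫_s g dμ = ∫_{T^{-k} s} f dμ` for all measurable `s`. -/
def IsTransfer (μ : Measure X) (T : X → X) (k : ℕ) {p : ℝ≥0∞} [Fact (1 ≤ p)]
    (f g : Lp ℝ p μ) : Prop :=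
  ∀ s : Set X, MeasurableSet s → ∫ x in s, g x ∂μ = ∫ x in T^[k] ⁻¹' s, f x ∂μ

/-- `W` realizes the tensor transfer operator `V^{*k} = V_1^{*k_1} ⊗_π ⋯ ⊗_π V_d^{*k_d}`. -/
def IsTTrans (μ : Measure X) {d : ℕ} (p : Fin d → ℝ≥0∞) [∀ i, Fact (1 ≤ p i)]
    {E : Type} [NormedAddCommGroup E] [NormedSpace ℝ E] [CompleteSpace E]
    (tp : ContinuousMultilinearMap ℝ (fun i : Fin d => Lp ℝ (p i) μ) E)
    (T : Fin d → X → X) (k : Fin d → ℕ) (W : E →L[ℝ] E) : Prop :=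
  ∀ f g : ∀ i : Fin d, Lp ℝ (p i) μ,
    (∀ i, IsTransfer μ (T i) (k i) (f i) (g i)) → W (tp f) = tp g

/-- The σ-algebra of `T`-invariant measurable sets. -/
def invariants (T : X → X) : MeasurableSpace X where
  MeasurableSet' s := MeasurableSet s ∧ T ⁻¹' s = s
  measurableSet_empty := ⟨MeasurableSet.empty, rfl⟩
  measurableSet_compl s hs := ⟨hs.1.compl, by rw [Set.preimage_compl, hs.2]⟩
  measurableSet_iUnion s hs :=
    ⟨MeasurableSet.iUnion fun i => (hs i).1, by
      simp only [Set.preimage_iUnion]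
      exact Set.iUnion_congr fun i => (hs i).2⟩

/-- `W` realizes `E_{inv,1} ⊗_π ⋯ ⊗_π E_{inv,d}`, the projective tensor product of the
conditional expectations with respect to the invariant σ-fields. -/
def IsTCondexpInv (μ : Measure X) {d : ℕ} (p : Fin d → ℝ≥0∞) [∀ i, Fact (1 ≤ p i)]
    {E : Type} [NormedAddCommGroup E] [NormedSpace ℝ E] [CompleteSpace E]
    (tp : ContinuousMultilinearMap ℝ (fun i : Fin d => Lp ℝ (p i) μ) E)
    (T : Fin d → X → X) (W : E →L[ℝ] E) : Prop :=
  ∀ f g : ∀ i : Fin d, Lp ℝ (p i) μ,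
    (∀ i, (g i : X → ℝ) =ᵐ[μ] μ[(f i : X → ℝ) | invariants (T i)]) → W (tp f) = tp g

/-- Exactness of a measure preserving transformation: the tail σ-field
`⋂_n T^{-n}𝓕` is trivial mod `μ`. -/
def Exact (μ : Measure X) (T : X → X) : Prop :=
  ∀ s : Set X, (∀ n : ℕ, ∃ t : Set X, MeasurableSet t ∧ s = T^[n] ⁻¹' t) →
    μ s = 0 ∨ μ s = 1

/-- A kernel of `m` variables is canonical (totally degenerate) if integrating out any
one variable gives `0` almost everywhere. -/
def Canonical (μ : Measure X) (m : ℕ) (h : (Fin m → X) → ℝ) : Prop :=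
  ∀ l : Fin m, ∀ᵐ x ∂ pm μ m, ∫ y, h (Function.update x l y) ∂μ = 0

/-- A kernel of `d` variables is symmetric if it is a.e. invariant under permutations of
its variables. -/
def Symm (μ : Measure X) (d : ℕ) (h : (Fin d → X) → ℝ) : Prop :=
  ∀ σ : Equiv.Perm (Fin d), ∀ᵐ x ∂ pm μ d, h (x ∘ σ) = h x

end VonMises

set_option linter.unusedSectionVars false
namespace VMAux
open VonMises

lemma Lp_integrable {Y : Type} [MeasurableSpace Y] {ν : Measure Y} [IsProbabilityMeasure ν]
    {p : ℝ≥0∞} [hp : Fact (1 ≤ p)] (g : Lp ℝ p ν) : Integrable (g : Y → ℝ) ν :=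
  (Lp.memLp g).integrable hp.out

/-- integration over a set as a continuous linear functional on `L_p` -/
lemma exists_intCLM {Y : Type} [MeasurableSpace Y] (ν : Measure Y) [IsProbabilityMeasure ν]
    (p : ℝ≥0∞) [hp : Fact (1 ≤ p)] (B : Set Y) :
    ∃ L : Lp ℝ p ν →L[ℝ] ℝ, ∀ g, L g = ∫ x in B, g x ∂ν := by
  let L0 : Lp ℝ p ν →ₗ[ℝ] ℝ :=
    { toFun := fun g => ∫ x in B, g x ∂ν
      map_add' := by
        intro g h
        rw [← integral_add (Lp_integrable g).integrableOn (Lp_integrable h).integrableOn]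
        exact integral_congr_ae (ae_restrict_of_ae (Lp.coeFn_add g h))
      map_smul' := by
        intro c g
        rw [RingHom.id_apply, smul_eq_mul, ← integral_const_mul]
        exact integral_congr_ae (ae_restrict_of_ae (Lp.coeFn_smul c g)) }
  refine ⟨L0.mkContinuous 1 ?_, fun g => rfl⟩
  intro g
  rw [one_mul]
  have h1 : ‖∫ x in B, g x ∂ν‖ ≤ ∫ x, ‖g x‖ ∂ν := by
    refine (norm_integral_le_integral_norm _).trans ?_
    exact setIntegral_le_integral (Lp_integrable g).norm (Eventually.of_forall fun x => norm_nonneg _)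
  refine h1.trans ?_
  rw [integral_norm_eq_lintegral_enorm (Lp.aestronglyMeasurable g), ← eLpNorm_one_eq_lintegral_enorm,
    Lp.norm_def]
  exact ENNReal.toReal_mono (Lp.eLpNorm_ne_top g)
    (eLpNorm_le_eLpNorm_of_exponent_le hp.out (Lp.aestronglyMeasurable g))

lemma exists_proj {X : Type} [mX : MeasurableSpace X] (μ : Measure X) [IsProbabilityMeasure μ]
    (p : ℝ≥0∞) [hp : Fact (1 ≤ p)] {ι : Type} [Fintype ι] (q : X → ι)
    (hq : Measurable[mX, ⊤] q) :
    ∃ (P : Lp ℝ p μ →L[ℝ] Lp ℝ p μ) (c : ι → ℝ) (u : ι → Lp ℝ p μ),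
      (∀ f, ‖P f‖ ≤ ‖f‖) ∧ (∀ f, P f =ᵐ[μ] μ[(f : X → ℝ) | MeasurableSpace.comap q ⊤]) ∧
      (∀ f, P f = ∑ a, (c a * ∫ x in q ⁻¹' {a}, f x ∂μ) • u a) := by
  classical
  have hm : MeasurableSpace.comap q ⊤ ≤ mX := hq.comap_le
  have hA : ∀ a, MeasurableSet (q ⁻¹' {a}) := fun a => hq trivial
  choose L hL using fun a : ι => exists_intCLM μ p (q ⁻¹' {a})
  set c : ι → ℝ := fun a => (μ.real (q ⁻¹' {a}))⁻¹ with hc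
  set u : ι → Lp ℝ p μ := fun a => indicatorConstLp p (hA a) (measure_ne_top μ _) (1:ℝ) with hu
  set P : Lp ℝ p μ →L[ℝ] Lp ℝ p μ := ∑ a, (c a • L a).smulRight (u a) with hP
  have hPf : ∀ f, P f = ∑ a, (c a * ∫ x in q ⁻¹' {a}, f x ∂μ) • u a := by
    intro f
    simp [hP, hL]
  have hval : ∀ f, P f =ᵐ[μ] fun x => c (q x) * ∫ y in q ⁻¹' {q x}, f y ∂μ := by
    intro f
    rw [hPf]
    have h1 : ∀ a, (u a : X → ℝ) =ᵐ[μ] (q ⁻¹' {a}).indicator fun _ => (1:ℝ) :=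
      fun a => indicatorConstLp_coeFn
    have h2 : ∀ a, (((c a * ∫ x in q ⁻¹' {a}, f x ∂μ) • u a : Lp ℝ p μ) : X → ℝ) =ᵐ[μ]
        (c a * ∫ x in q ⁻¹' {a}, f x ∂μ) • (u a : X → ℝ) := fun a => Lp.coeFn_smul _ _
    filter_upwards [ae_all_iff.2 h1, ae_all_iff.2 h2,
      Lp.coeFn_fun_finsetSum Finset.univ (fun a => (c a * ∫ x in q ⁻¹' {a}, f x ∂μ) • u a)]
      with x h1 h2 h3
    rw [h3, Finset.sum_eq_single (q x)]
    · rw [h2, Pi.smul_apply, h1]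
      simp
    · intro b _ hb
      rw [h2, Pi.smul_apply, h1]
      simp [hb.symm]
    · simp
  have hcond : ∀ f, P f =ᵐ[μ] μ[(f : X → ℝ) | MeasurableSpace.comap q ⊤] := by
    intro f
    refine ae_eq_condExp_of_forall_setIntegral_eq hm (Lp_integrable f)
      (fun s _ _ => (Lp_integrable (P f)).integrableOn) ?_ ?_
    · rintro s ⟨t, -, rfl⟩ -
      have hdec : q ⁻¹' t = ⋃ a ∈ (Finset.univ.filter (· ∈ t)), q ⁻¹' {a} := by
        ext x; simp
      have hdisj : (↑(Finset.univ.filter (· ∈ t)) : Set ι).PairwiseDisjoint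
          (fun a => q ⁻¹' {a}) := by
        intro a _ b _ hab
        refine Set.disjoint_left.2 ?_
        intro x hx hy
        exact hab (hx.symm.trans hy)
      rw [hdec, integral_biUnion_finset _ (fun a _ => hA a) hdisj
        (fun a _ => (Lp_integrable (P f)).integrableOn),
        integral_biUnion_finset _ (fun a _ => hA a) hdisj
        (fun a _ => (Lp_integrable f).integrableOn)]
      refine Finset.sum_congr rfl fun a _ => ?_
      have h1 : ∫ x in q ⁻¹' {a}, (P f : X → ℝ) x ∂μ
          = ∫ x in q ⁻¹' {a}, (c a * ∫ y in q ⁻¹' {a}, f y ∂μ) ∂μ := by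
        refine setIntegral_congr_ae (hA a) ?_
        filter_upwards [hval f] with x hx hxa
        rw [hx]
        have : q x = a := hxa
        rw [this]
      rw [h1, setIntegral_const, smul_eq_mul]
      by_cases h0 : μ.real (q ⁻¹' {a}) = 0
      · have h0' : μ (q ⁻¹' {a}) = 0 := by
          rwa [measureReal_eq_zero_iff] at h0
        rw [h0, setIntegral_measure_zero _ h0']
        simp
      · simp only [hc]
        rw [← mul_assoc, mul_inv_cancel₀ h0, one_mul]
    · have hsm : StronglyMeasurable[MeasurableSpace.comap q ⊤]
          (fun x => c (q x) * ∫ y in q ⁻¹' {q x}, f y ∂μ) := by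
        have : Measurable[MeasurableSpace.comap q ⊤]
            ((fun a => c a * ∫ y in q ⁻¹' {a}, f y ∂μ) ∘ q) := by
          intro s _
          exact ⟨(fun a => c a * ∫ y in q ⁻¹' {a}, f y ∂μ) ⁻¹' s, trivial, rfl⟩
        exact this.stronglyMeasurable
      exact ⟨_, hsm, hval f⟩
  refine ⟨P, c, u, ?_, hcond, hPf⟩
  intro f
  rw [Lp.norm_def, Lp.norm_def]
  refine ENNReal.toReal_mono (Lp.eLpNorm_ne_top f) ?_
  rw [eLpNorm_congr_ae (hcond f)]
  exact eLpNorm_condExp_le_eLpNorm _ hp.out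

section inj
variable {X : Type} [mX : MeasurableSpace X] (μ : Measure X) [IsProbabilityMeasure μ]
    {d : ℕ} (p : ℝ≥0∞) [hp : Fact (1 ≤ p)]
    (E : Type) [NormedAddCommGroup E] [NormedSpace ℝ E] [CompleteSpace E]
    (tp : ContinuousMultilinearMap ℝ (fun _ : Fin d => Lp ℝ p μ) E)
    (J : E →L[ℝ] Lp ℝ p (pm μ d))

/-- `Q` realizes the tensor power of averaging over the finite partition given by `q` -/
def IsQ {ι : Type} (q : X → ι) (Q : E →L[ℝ] E) : Prop :=
  (∀ φ, ‖Q φ‖ ≤ ‖φ‖) ∧ (∀ φ, J φ = 0 → Q φ = 0) ∧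
  ∀ f : Fin d → Lp ℝ p μ, (∀ i, ∃ r : ι → ℝ, (f i : X → ℝ) =ᵐ[μ] r ∘ q) → Q (tp f) = tp f

lemma exists_Q
    (hE : IsPTP μ (fun _ : Fin d => p) E tp)
    (hJ : IsEmbed μ (fun _ : Fin d => p) p tp J)
    {ι : Type} [Fintype ι] (q : X → ι) (hq : Measurable[mX, ⊤] q) :
    ∃ Q : E →L[ℝ] E, IsQ μ p E tp J q Q := by
  classical
  have hm : MeasurableSpace.comap q ⊤ ≤ mX := hq.comap_le
  obtain ⟨P, c, u, hPn, hPc, hPf⟩ := exists_proj μ p q hq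
  obtain ⟨Q, hQ, hQn⟩ := hE.lift E (tp.compContinuousLinearMap fun _ => P)
  choose L hL using fun B : Set (Fin d → X) => exists_intCLM (pm μ d) p B
  have hrep : Q = ∑ a : Fin d → ι, ((∏ i, c (a i)) •
      (L (Set.univ.pi fun i => q ⁻¹' {a i})).comp J).smulRight (tp fun i => u (a i)) := by
    refine ContinuousLinearMap.ext_on hE.denseSpan ?_
    rintro _ ⟨f, rfl⟩
    simp only
    rw [hQ]
    simp only [ContinuousMultilinearMap.compContinuousLinearMap_apply,
      _root_.sum_apply, ContinuousLinearMap.smulRight_apply,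
      _root_.smul_apply, ContinuousLinearMap.comp_apply, hL]
    have h1 : (fun i => P (f i)) = fun i => ∑ a, (c a * ∫ x in q ⁻¹' {a}, f i x ∂μ) • u a :=
      funext fun i => hPf _
    rw [h1, ContinuousMultilinearMap.map_sum]
    refine Finset.sum_congr rfl fun a _ => ?_
    rw [ContinuousMultilinearMap.map_smul_univ, Finset.prod_mul_distrib, smul_eq_mul]
    congr 2
    rw [integral_congr_ae (ae_restrict_of_ae (hJ f)), Measure.restrict_pi_pi]
    exact (integral_fintype_prod_eq_prod (fun i x => (f i : X → ℝ) x)).symm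
  refine ⟨Q, ?_, ?_, ?_⟩
  · intro φ
    have h1 : ‖Q‖ ≤ 1 := by
      rw [hQn]
      refine ContinuousMultilinearMap.opNorm_le_bound zero_le_one ?_
      intro f
      rw [one_mul, ContinuousMultilinearMap.compContinuousLinearMap_apply, hE.crossNorm]
      exact Finset.prod_le_prod (fun _ _ => norm_nonneg _) (fun i _ => hPn _)
    simpa using Q.le_of_opNorm_le h1 φ
  · intro φ hφ
    rw [hrep]
    simp [hφ]
  · intro f hf
    rw [hQ, ContinuousMultilinearMap.compContinuousLinearMap_apply]
    congr 1
    funext i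
    obtain ⟨r, hr⟩ := hf i
    refine Lp.ext ?_
    refine (hPc (f i)).trans (.trans (condExp_congr_ae hr) ?_)
    have hmeas : Measurable[MeasurableSpace.comap q ⊤] (r ∘ q) := by
      intro s _
      exact ⟨r ⁻¹' s, trivial, rfl⟩
    rw [condExp_of_stronglyMeasurable hm hmeas.stronglyMeasurable
      ((integrable_congr hr).1 (Lp_integrable (f i)))]
    exact hr.symm

lemma J_injective
    (hE : IsPTP μ (fun _ : Fin d => p) E tp)
    (hJ : IsEmbed μ (fun _ : Fin d => p) p tp J)
    (hpt : p ≠ ∞) (φ : E) (hφ : J φ = 0) : φ = 0 := by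
  classical
  -- elements fixed by all fine enough averaging operators
  let S : Submodule ℝ E :=
    { carrier := {ψ | ∃ (ι : Type) (_ : Fintype ι) (q : X → ι), Measurable[mX, ⊤] q ∧
        ∀ (κ : Type) (q' : X → κ) (r : κ → ι) (Q : E →L[ℝ] E), q = r ∘ q' →
          IsQ μ p E tp J q' Q → Q ψ = ψ}
      zero_mem' := ⟨Unit, inferInstance, fun _ => (), measurable_const,
        fun κ q' r Q _ _ => map_zero Q⟩
      add_mem' := by
        rintro a b ⟨ι, _, q, hq, h⟩ ⟨ι', _, q', hq', h'⟩
        refine ⟨ι × ι', inferInstance, fun x => (q x, q' x), ?_, ?_⟩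
        · intro s _
          have : (fun x => (q x, q' x)) ⁻¹' s = ⋃ z ∈ s, (q ⁻¹' {z.1} ∩ q' ⁻¹' {z.2}) := by
            ext x
            simp only [Set.mem_preimage, Set.mem_iUnion, Set.mem_inter_iff, Set.mem_singleton_iff]
            constructor
            · intro hx
              exact ⟨_, hx, rfl, rfl⟩
            · rintro ⟨z, hz, h1, h2⟩
              rw [h1, h2]
              exact hz
          rw [this]
          exact MeasurableSet.biUnion s.to_countable fun z _ => (hq trivial).inter (hq' trivial)
        · intro κ k r Q hr hQ
          rw [map_add, h κ k (Prod.fst ∘ r) Q ?_ hQ, h' κ k (Prod.snd ∘ r) Q ?_ hQ]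
          · exact funext fun x => congrArg Prod.snd (congrFun hr x)
          · exact funext fun x => congrArg Prod.fst (congrFun hr x)
      smul_mem' := by
        rintro c a ⟨ι, _, q, hq, h⟩
        refine ⟨ι, inferInstance, q, hq, ?_⟩
        intro κ k r Q hr hQ
        rw [map_smul, h κ k r Q hr hQ] }
  have hsimple : ∀ s : Fin d → Lp.simpleFunc ℝ p μ, tp (fun i => (s i : Lp ℝ p μ)) ∈ S := by
    intro s
    let t : Fin d → SimpleFunc X ℝ := fun i => Lp.simpleFunc.toSimpleFunc (s i)
    refine ⟨∀ i, (t i).range, inferInstance, fun x i => ⟨t i x, (t i).mem_range_self x⟩, ?_, ?_⟩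
    · intro S' _
      have : (fun x i => (⟨t i x, (t i).mem_range_self x⟩ : (t i).range)) ⁻¹' S'
          = ⋃ z ∈ S', ⋂ i, (t i) ⁻¹' {(z i : ℝ)} := by
        ext x
        simp only [Set.mem_preimage, Set.mem_iUnion, Set.mem_iInter, Set.mem_singleton_iff]
        constructor
        · intro hx
          exact ⟨_, hx, fun i => rfl⟩
        · rintro ⟨z, hz, h1⟩
          convert hz using 1
          funext i
          exact Subtype.ext (h1 i)
      rw [this]
      exact MeasurableSet.biUnion S'.to_countable fun z _ =>
        MeasurableSet.iInter fun i => (t i).measurableSet_preimage _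
    · intro κ k r Q hr hQ
      refine hQ.2.2 _ fun i => ⟨fun z => (r z i : ℝ), ?_⟩
      refine (Lp.simpleFunc.toSimpleFunc_eq_toFun (s i)).symm.trans ?_
      refine Eventually.of_forall fun x => ?_
      exact congrArg (fun z => ((z i : (t i).range) : ℝ)) (congrFun hr x)
  have hdense : Dense (S : Set E) := by
    have htop : S.topologicalClosure = ⊤ := by
      rw [eq_top_iff]
      have hspan : (Submodule.span ℝ (Set.range fun f : Fin d → Lp ℝ p μ => tp f)) ≤
          S.topologicalClosure := by
        rw [Submodule.span_le]
        rintro _ ⟨f, rfl⟩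
        have hd1 : DenseRange (fun (s : Fin d → Lp.simpleFunc ℝ p μ) (i : Fin d) =>
            (s i : Lp ℝ p μ)) :=
          DenseRange.piMap (fun _ => Lp.simpleFunc.denseRange hpt)
        have hcl := hd1 f
        have := (map_mem_closure tp.cont hcl
          (t := (S : Set E)) (by rintro _ ⟨s, rfl⟩; exact hsimple s))
        exact this
      intro x _
      have hx := hE.denseSpan x
      exact closure_minimal hspan S.isClosed_topologicalClosure hx
    exact Submodule.dense_iff_topologicalClosure_eq_top.2 htop
  rw [← norm_le_zero_iff]
  refine le_of_forall_pos_le_add fun ε hε => ?_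
  obtain ⟨ψ, hψS, hψ⟩ := Metric.dense_iff.1 hdense φ (ε/2) (half_pos hε)
  obtain ⟨ι, _, q, hq, h⟩ := hψ
  obtain ⟨Q, hQ⟩ := exists_Q μ p E tp J hE hJ q hq
  have h1 : Q ψ = ψ := h ι q id Q rfl hQ
  have h2 : Q φ = 0 := hQ.2.1 φ hφ
  have h3 : ‖ψ‖ ≤ ‖ψ - φ‖ := by
    calc ‖ψ‖ = ‖Q (ψ - φ)‖ := by rw [map_sub, h1, h2, sub_zero]
      _ ≤ _ := hQ.1 _
  rw [Metric.mem_ball, dist_eq_norm] at hψS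
  have h4 : ‖φ‖ ≤ ‖ψ‖ + ‖ψ - φ‖ := by
    calc ‖φ‖ = ‖ψ - (ψ - φ)‖ := by congr 1; abel
      _ ≤ _ := norm_sub_le _ _
  linarith

end inj
end VMAux

namespace VMAux

/-- running maxima of Birkhoff sums -/
def birkMax {X : Type} (T : X → X) (f : X → ℝ) : ℕ → X → ℝ
  | 0 => fun _ => 0
  | (n+1) => fun x => max 0 (f x + birkMax T f n (T x))

section birk
variable {X : Type} [MeasurableSpace X] {μ : Measure X} {T : X → X}

lemma birkMax_nonneg (f : X → ℝ) (n : ℕ) (x : X) : 0 ≤ birkMax T f n x := by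
  cases n with
  | zero => exact le_rfl
  | succ n => exact le_max_left _ _

lemma birkMax_le_succ (f : X → ℝ) (n : ℕ) : ∀ x, birkMax T f n x ≤ birkMax T f (n+1) x := by
  induction n with
  | zero => intro x; exact le_max_left _ _
  | succ n ih =>
    intro x
    exact max_le_max le_rfl (by gcongr; exact ih (T x))

lemma birkMax_mono (f : X → ℝ) (x : X) : Monotone (fun n => birkMax T f n x) :=
  monotone_nat_of_le_succ fun n => birkMax_le_succ f n x

lemma sum_le_birkMax (f : X → ℝ) (n : ℕ) : ∀ x,
    ∑ j ∈ Finset.range n, f (T^[j] x) ≤ birkMax T f n x := by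
  induction n with
  | zero => intro x; simp [birkMax]
  | succ n ih =>
    intro x
    rw [Finset.sum_range_succ']
    have := ih (T x)
    simp only [Function.iterate_succ_apply, Function.iterate_zero, id]
    refine le_trans ?_ (le_max_right _ _)
    linarith

lemma birkMax_measurable (hT : Measurable T) {f : X → ℝ} (hf : Measurable f) (n : ℕ) :
    Measurable (birkMax T f n) := by
  induction n with
  | zero => exact measurable_const
  | succ n ih => exact measurable_const.max (hf.add (ih.comp hT))

lemma birkMax_integrable (hT : MeasurePreserving T μ μ) {f : X → ℝ} (hfi : Integrable f μ) (n : ℕ) :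
    Integrable (birkMax T f n) μ := by
  induction n with
  | zero => exact integrable_zero _ _ _
  | succ n ih =>
    exact (integrable_zero _ _ _).sup (hfi.add (hT.integrable_comp_of_integrable ih))

lemma birkMax_bdd [IsProbabilityMeasure μ] (hT : Ergodic T μ) {f : X → ℝ} (hf : Measurable f)
    (hfi : Integrable f μ) (hneg : ∫ x, f x ∂μ < 0) :
    ∀ᵐ x ∂μ, BddAbove (Set.range fun n => birkMax T f n x) := by
  have hTm := hT.toMeasurePreserving
  set A : Set X := {x | BddAbove (Set.range fun n => birkMax T f n x)} with hA
  have hAm : MeasurableSet A :=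
    measurableSet_bddAbove_range (fun n => birkMax_measurable hTm.measurable hf n)
  have hinv : T ⁻¹' A = A := by
    ext x
    simp only [hA, Set.mem_preimage, Set.mem_ofPred_eq]
    constructor
    · rintro ⟨C, hC⟩
      refine ⟨max 0 (f x + C), ?_⟩
      rintro _ ⟨n, rfl⟩
      cases n with
      | zero => exact le_max_left _ _
      | succ n =>
        exact max_le_max le_rfl (by gcongr; exact hC ⟨n, rfl⟩)
    · rintro ⟨C, hC⟩
      refine ⟨C - f x, ?_⟩
      rintro _ ⟨n, rfl⟩
      have h1 : birkMax T f (n+1) x ≤ C := hC ⟨n+1, rfl⟩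
      have h2 : f x + birkMax T f n (T x) ≤ birkMax T f (n+1) x := le_max_right _ _
      simp only
      linarith
  rcases hT.toPreErgodic.ae_mem_or_ae_notMem hAm hinv with h | h
  · exact h
  · exfalso
    have hlim : Tendsto (fun n => ∫ x, (max (-birkMax T f n (T x)) (f x)) ∂μ) atTop
        (𝓝 (∫ x, f x ∂μ)) := by
      refine tendsto_integral_of_dominated_convergence (fun x => |f x|) ?_ hfi.abs ?_ ?_
      · intro n
        exact (((birkMax_measurable hTm.measurable hf n).comp hTm.measurable).neg.max
          hf).aestronglyMeasurable
      · intro n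
        refine Eventually.of_forall fun x => ?_
        have := birkMax_nonneg (T := T) f n (T x)
        rw [Real.norm_eq_abs, abs_le]
        constructor
        · exact le_trans (neg_abs_le _) (le_max_right _ _)
        · exact max_le (by have := abs_nonneg (f x); linarith) (le_abs_self _)
      · filter_upwards [h] with x hx
        have hx' : ¬ BddAbove (Set.range fun n => birkMax T f n (T x)) := by
          intro hb
          exact hx (hinv ▸ (show x ∈ T ⁻¹' A from hb))
        have ht := tendsto_atTop_atTop_of_monotone' (birkMax_mono f (T x)) hx'
        refine tendsto_const_nhds.congr' ?_
        filter_upwards [ht.eventually_ge_atTop (-f x)] with n hn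
        exact (max_eq_right (by linarith)).symm
    have hnn : ∀ n, 0 ≤ ∫ x, (max (-birkMax T f n (T x)) (f x)) ∂μ := by
      intro n
      have heq : ∀ x, max (-birkMax T f n (T x)) (f x)
          = birkMax T f (n+1) x - birkMax T f n (T x) := by
        intro x
        change _ = max 0 (f x + birkMax T f n (T x)) - _
        rw [← max_sub_sub_right]
        congr 1 <;> ring
      simp_rw [heq]
      have hi := birkMax_integrable hTm hfi n
      rw [integral_sub (birkMax_integrable hTm hfi (n+1))
        (show Integrable (fun x => birkMax T f n (T x)) μ from hTm.integrable_comp_of_integrable hi)]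
      have : ∫ x, birkMax T f n (T x) ∂μ = ∫ x, birkMax T f n x ∂μ := by
        conv_rhs => rw [← hTm.map_eq]
        rw [integral_map hTm.measurable.aemeasurable
          (birkMax_measurable hTm.measurable hf n).aestronglyMeasurable]
      rw [this, sub_nonneg]
      exact integral_mono hi (birkMax_integrable hTm hfi (n+1)) (birkMax_le_succ f n)
    exact absurd (ge_of_tendsto' hlim hnn) (not_le.2 hneg)

lemma birk_upper [IsProbabilityMeasure μ] (hT : Ergodic T μ) {f : X → ℝ} (hf : Measurable f)
    (hfi : Integrable f μ) :
    ∀ᵐ x ∂μ, ∀ ε > 0, ∀ᶠ n : ℕ in atTop,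
      (n : ℝ)⁻¹ * ∑ j ∈ Finset.range n, f (T^[j] x) < ∫ x, f x ∂μ + ε := by
  set c := ∫ x, f x ∂μ with hc
  have key : ∀ m : ℕ, ∀ᵐ x ∂μ,
      BddAbove (Set.range fun n => birkMax T (fun x => f x - (c + 1 / ((m:ℝ)+1))) n x) := by
    intro m
    refine birkMax_bdd hT (hf.sub_const _) (hfi.sub (integrable_const _)) ?_
    rw [integral_sub hfi (integrable_const _)]
    have : (0:ℝ) < 1 / ((m:ℝ)+1) := by positivity
    simp [← hc]
    positivity
  filter_upwards [ae_all_iff.2 key] with x hx ε hε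
  obtain ⟨m, hm⟩ := exists_nat_one_div_lt (half_pos hε)
  obtain ⟨C, hC⟩ := hx m
  have hCn : Tendsto (fun n : ℕ => (n:ℝ)⁻¹ * C) atTop (𝓝 0) := by
    simpa using (tendsto_inv_atTop_nhds_zero_nat (𝕜 := ℝ)).mul_const C
  filter_upwards [hCn.eventually_lt_const (half_pos hε), eventually_gt_atTop 0] with n hn hn0
  have h1 : ∑ j ∈ Finset.range n, (f (T^[j] x) - (c + 1 / ((m:ℝ)+1))) ≤ C :=
    (sum_le_birkMax (T := T) (fun x => f x - (c + 1 / ((m:ℝ)+1))) n x).trans (hC ⟨n, rfl⟩)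
  rw [Finset.sum_sub_distrib, Finset.sum_const, Finset.card_range, nsmul_eq_mul] at h1
  have hnpos : (0:ℝ) < n := by exact_mod_cast hn0
  have h2 : (n:ℝ)⁻¹ * ∑ j ∈ Finset.range n, f (T^[j] x)
      ≤ (n:ℝ)⁻¹ * (C + n * (c + 1 / ((m:ℝ)+1))) := by
    gcongr
    linarith
  have h3 : (n:ℝ)⁻¹ * (C + n * (c + 1 / ((m:ℝ)+1))) = (n:ℝ)⁻¹ * C + (c + 1 / ((m:ℝ)+1)) := by
    field_simp
  linarith

lemma birkhoff [IsProbabilityMeasure μ] (hT : Ergodic T μ) {f : X → ℝ} (hf : Measurable f)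
    (hfi : Integrable f μ) :
    ∀ᵐ x ∂μ, Tendsto (fun n : ℕ => (n : ℝ)⁻¹ * ∑ j ∈ Finset.range n, f (T^[j] x)) atTop
      (𝓝 (∫ x, f x ∂μ)) := by
  filter_upwards [birk_upper hT hf hfi, birk_upper hT hf.neg hfi.neg] with x h1 h2
  rw [tendsto_order]
  constructor
  · intro a ha
    filter_upwards [h2 (∫ x, f x ∂μ - a) (by linarith)] with n hn
    simp only [Pi.neg_apply, Finset.sum_neg_distrib, integral_neg] at hn
    linarith
  · intro a ha
    filter_upwards [h1 (a - ∫ x, f x ∂μ) (by linarith)] with n hn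
    linarith

end birk

lemma integral_comp_mp {X : Type*} [MeasurableSpace X] {μ : Measure X} {S : X → X}
    (hS : MeasurePreserving S μ μ) {g : X → ℝ} (hg : Measurable g) :
    ∫ x, g (S x) ∂μ = ∫ x, g x ∂μ := by
  conv_rhs => rw [← hS.map_eq]
  rw [integral_map hS.measurable.aemeasurable hg.aestronglyMeasurable]

lemma gdct {α : Type} [MeasurableSpace α] {ν : Measure α} {F G : ℕ → α → ℝ} {f g : α → ℝ}
    (hF : ∀ n, AEStronglyMeasurable (F n) ν) (hf : AEStronglyMeasurable f ν)
    (hG : ∀ n, Integrable (G n) ν) (hg : Integrable g ν)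
    (hFG : ∀ n, ∀ᵐ x ∂ν, |F n x| ≤ G n x)
    (hlim : ∀ᵐ x ∂ν, Tendsto (fun n => F n x) atTop (𝓝 (f x)))
    (hGlim : ∀ᵐ x ∂ν, Tendsto (fun n => G n x) atTop (𝓝 (g x)))
    (hGintlim : Tendsto (fun n => ∫ x, G n x ∂ν) atTop (𝓝 (∫ x, g x ∂ν))) :
    Tendsto (fun n => ∫ x, |F n x - f x| ∂ν) atTop (𝓝 0) := by
  have hFG' := ae_all_iff.2 hFG
  have hg0 : ∀ᵐ x ∂ν, |f x| ≤ g x := by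
    filter_upwards [hFG', hlim, hGlim] with x h1 h2 h3
    exact le_of_tendsto_of_tendsto' h2.abs h3 h1
  have s1 : Tendsto (fun n => ∫ x, max (g x - G n x) 0 ∂ν) atTop (𝓝 (∫ x, (0:ℝ) ∂ν)) := by
    refine tendsto_integral_of_dominated_convergence g ?_ hg ?_ ?_
    · intro n
      exact ((hg.sub (hG n)).aestronglyMeasurable.sup aestronglyMeasurable_const)
    · intro n
      filter_upwards [hFG n, hg0] with x h1 h2
      have := abs_nonneg (F n x)
      have := abs_nonneg (f x)
      rw [Real.norm_eq_abs, abs_of_nonneg (le_max_right _ _)]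
      exact max_le (by linarith) (by linarith)
    · filter_upwards [hGlim] with x h
      have := ((tendsto_const_nhds (x := g x)).sub h).max (tendsto_const_nhds (x := (0:ℝ)))
      simpa using this
  have s2 : Tendsto (fun n => ∫ x, min |F n x - f x| (2 * g x) ∂ν) atTop (𝓝 (∫ x, (0:ℝ) ∂ν)) := by
    refine tendsto_integral_of_dominated_convergence (fun x => 2 * g x) ?_ (hg.const_mul 2) ?_ ?_
    · intro n
      exact ((hF n).sub hf).norm.inf (hg.const_mul 2).aestronglyMeasurable
    · intro n
      filter_upwards [hg0] with x h2
      have := abs_nonneg (f x)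
      rw [Real.norm_eq_abs, abs_of_nonneg (le_min (abs_nonneg _) (by linarith))]
      exact min_le_right _ _
    · filter_upwards [hlim, hg0] with x h h2
      have h0 : 0 ≤ 2 * g x := by have := abs_nonneg (f x); linarith
      have := ((h.sub (tendsto_const_nhds (x := f x))).abs).min (tendsto_const_nhds (x := 2 * g x))
      simpa [h0] using this
  have s3 : Tendsto (fun n => ∫ x, min |F n x - f x| (2 * g x) ∂ν +
      ((∫ x, G n x ∂ν - ∫ x, g x ∂ν) + ∫ x, max (g x - G n x) 0 ∂ν)) atTop (𝓝 0) := by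
    have := s2.add ((hGintlim.sub (tendsto_const_nhds (x := ∫ x, g x ∂ν))).add s1)
    simpa using this
  refine squeeze_zero (fun n => integral_nonneg fun x => abs_nonneg _) (fun n => ?_) s3
  have i1 : Integrable (fun x => min |F n x - f x| (2 * g x)) ν := by
    refine Integrable.mono' (hg.const_mul 2)
      (((hF n).sub hf).norm.inf (hg.const_mul 2).aestronglyMeasurable) ?_
    filter_upwards [hg0] with x h2
    have := abs_nonneg (f x)
    rw [Real.norm_eq_abs, abs_of_nonneg (le_min (abs_nonneg _) (by linarith))]
    exact min_le_right _ _
  have i2 : Integrable (fun x => max (g x - G n x) 0) ν := (hg.sub (hG n)).pos_part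
  have i3 : Integrable (fun x => G n x - g x) ν := (hG n).sub hg
  have i4 : Integrable (fun x => G n x - g x + max (g x - G n x) 0) ν := i3.add i2
  rw [← integral_sub (hG n) hg, ← integral_add i3 i2, ← integral_add i1 i4]
  refine integral_mono_of_nonneg (Eventually.of_forall fun x => abs_nonneg _)
    (i1.add i4) ?_
  filter_upwards [hFG n, hg0] with x h1 h2
  have h3 : |F n x - f x| ≤ |F n x| + |f x| := abs_sub _ _
  rcases le_total (|F n x - f x|) (2 * g x) with h | h
  · rw [min_eq_left h]
    have := le_max_left (g x - G n x) 0
    linarith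
  · rw [min_eq_right h]
    have := le_max_right (g x - G n x) 0
    linarith

end VMAux

namespace VMAux

lemma gdct_sum {α : Type} {A B : ℕ → α → ℝ} {a b : α → ℝ} {S β : ℕ → ℝ} {s b0 : ℝ}
    (hAB : ∀ n k, |A n k| ≤ B n k)
    (hA : ∀ k, Tendsto (fun n => A n k) atTop (𝓝 (a k)))
    (hB : ∀ k, Tendsto (fun n => B n k) atTop (𝓝 (b k)))
    (hSA : ∀ n, HasSum (A n) (S n)) (hsa : HasSum a s)
    (hβ : ∀ n, HasSum (B n) (β n)) (hb : HasSum b b0)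
    (hlim : Tendsto β atTop (𝓝 b0)) : Tendsto S atTop (𝓝 s) := by
  have hab : ∀ k, |a k| ≤ b k := fun k =>
    le_of_tendsto_of_tendsto' (hA k).abs (hB k) (fun n => hAB n k)
  have hb0 : ∀ k, 0 ≤ b k := fun k => (abs_nonneg _).trans (hab k)
  have s1 : Tendsto (fun n => ∑' k, max (b k - B n k) 0) atTop (𝓝 (∑' k : α, (0:ℝ))) := by
    refine tendsto_tsum_of_dominated_convergence hb.summable ?_ ?_
    · intro k
      have := ((tendsto_const_nhds (x := b k)).sub (hB k)).max (tendsto_const_nhds (x := (0:ℝ)))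
      simpa using this
    · refine Eventually.of_forall fun n k => ?_
      have := (abs_nonneg _).trans (hAB n k)
      rw [Real.norm_eq_abs, abs_of_nonneg (le_max_right _ _)]
      exact max_le (by linarith) (hb0 k)
  have s2 : Tendsto (fun n => ∑' k, min |A n k - a k| (2 * b k)) atTop (𝓝 (∑' k : α, (0:ℝ))) := by
    refine tendsto_tsum_of_dominated_convergence (hb.summable.mul_left 2) ?_ ?_
    · intro k
      have := (((hA k).sub (tendsto_const_nhds (x := a k))).abs).min
        (tendsto_const_nhds (x := 2 * b k))
      simpa [hb0 k] using this
    · refine Eventually.of_forall fun n k => ?_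
      have := hb0 k
      rw [Real.norm_eq_abs, abs_of_nonneg (le_min (abs_nonneg _) (by linarith))]
      exact min_le_right _ _
  have s3 : Tendsto (fun n => ∑' k, min |A n k - a k| (2 * b k) +
      ((β n - b0) + ∑' k, max (b k - B n k) 0)) atTop (𝓝 0) := by
    have := s2.add ((hlim.sub (tendsto_const_nhds (x := b0))).add s1)
    simpa using this
  rw [tendsto_iff_norm_sub_tendsto_zero]
  refine squeeze_zero (fun n => norm_nonneg _) (fun n => ?_) s3
  have i1 : Summable (fun k => min |A n k - a k| (2 * b k)) := by
    refine Summable.of_nonneg_of_le (fun k => le_min (abs_nonneg _) (by have := hb0 k; linarith))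
      (fun k => min_le_right _ _) (hb.summable.mul_left 2)
  have i2 : Summable (fun k => max (b k - B n k) 0) := by
    refine Summable.of_nonneg_of_le (fun k => le_max_right _ _) (fun k => ?_) hb.summable
    have := (abs_nonneg _).trans (hAB n k)
    exact max_le (by linarith) (hb0 k)
  have h1 := (hSA n).sub hsa
  have h2 := i1.hasSum.add (((hβ n).sub hb).add i2.hasSum)
  have hle : ∀ k, |A n k - a k| ≤ min |A n k - a k| (2 * b k) + (B n k - b k + max (b k - B n k) 0) := by
    intro k
    have h3 : |A n k - a k| ≤ |A n k| + |a k| := abs_sub _ _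
    have := hAB n k
    have := hab k
    rcases le_total (|A n k - a k|) (2 * b k) with h | h
    · rw [min_eq_left h]
      have := le_max_left (b k - B n k) 0
      linarith
    · rw [min_eq_right h]
      have := le_max_right (b k - B n k) 0
      linarith
  rw [Real.norm_eq_abs, abs_le]
  constructor
  · have := hasSum_le (fun k => (neg_le_neg (hle k)).trans (neg_abs_le _)) h2.neg h1
    linarith
  · exact hasSum_le (fun k => (le_abs_self _).trans (hle k)) h1 h2

lemma amgm {d : ℕ} (hd : 1 ≤ d) (a : Fin d → ℝ) :
    |∏ i, a i| ≤ (d:ℝ)⁻¹ * ∑ i, |a i| ^ d := by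
  have h := Real.geom_mean_le_arith_mean_weighted Finset.univ (fun _ : Fin d => (d:ℝ)⁻¹)
    (fun i => |a i| ^ d) (fun _ _ => by positivity)
    (by
      have : (d:ℝ) ≠ 0 := by positivity
      simp [this]) (fun _ _ => by positivity)
  rw [Finset.mul_sum, Finset.abs_prod]
  refine le_trans (le_of_eq ?_) h
  refine Finset.prod_congr rfl fun i _ => ?_
  exact (Real.pow_rpow_inv_natCast (abs_nonneg _) (by omega)).symm

lemma avg_pow_le (d n : ℕ) (u : ℕ → ℝ) :
    |(n:ℝ)⁻¹ * ∑ j ∈ Finset.range n, u j| ^ d ≤ (n:ℝ)⁻¹ * ∑ j ∈ Finset.range n, |u j| ^ d ∨ n = 0 := by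
  rcases Nat.eq_zero_or_pos n with h | h
  · exact Or.inr h
  left
  have h1 : |(n:ℝ)⁻¹ * ∑ j ∈ Finset.range n, u j| ≤ ∑ j ∈ Finset.range n, (n:ℝ)⁻¹ * |u j| := by
    rw [abs_mul, abs_of_nonneg (by positivity : (0:ℝ) ≤ (n:ℝ)⁻¹), ← Finset.mul_sum]
    gcongr
    exact Finset.abs_sum_le_sum_abs _ _
  calc _ ≤ (∑ j ∈ Finset.range n, (n:ℝ)⁻¹ * |u j|) ^ d := by gcongr
    _ ≤ _ := by
      rw [Finset.mul_sum]
      refine Real.pow_arith_mean_le_arith_mean_pow _ (fun _ => (n:ℝ)⁻¹) (fun j => |u j|)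
        (fun _ _ => by positivity) ?_ (fun _ _ => abs_nonneg _) d
      have : (n:ℝ) ≠ 0 := by positivity
      simp [this]

lemma ptwise {d : ℕ} (hd : 1 ≤ d) (lam : (Fin d → ℕ) → ℝ) (u : ℕ → ℕ → ℝ) (m q : ℕ → ℝ)
    (hm : ∀ k, Tendsto (fun n : ℕ => (n:ℝ)⁻¹ * ∑ j ∈ Finset.range n, u k j) atTop (𝓝 (m k)))
    (hq : ∀ k, Tendsto (fun n : ℕ => (n:ℝ)⁻¹ * ∑ j ∈ Finset.range n, |u k j| ^ d) atTop (𝓝 (q k)))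
    (g : (Fin d → ℕ) → ℝ) (hg : ∀ j, HasSum (fun k => lam k * ∏ i, u (k i) (j i)) (g j))
    (G : ℕ → ℝ) (hG : ∀ j, HasSum (fun k => |lam k| * ((d:ℝ)⁻¹ * ∑ i, |u (k i) j| ^ d)) (G j))
    (γ : ℝ) (hGlim : Tendsto (fun n : ℕ => (n:ℝ)⁻¹ * ∑ j ∈ Finset.range n, G j) atTop (𝓝 γ))
    (hγ : HasSum (fun k => |lam k| * ((d:ℝ)⁻¹ * ∑ i, q (k i))) γ)
    (c : ℝ) (hc : HasSum (fun k => lam k * ∏ i, m (k i)) c) :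
    (∀ n : ℕ, |((n:ℝ) ^ d)⁻¹ * ∑ j ∈ Fintype.piFinset (fun _ : Fin d => Finset.range n), g j|
      ≤ (n:ℝ)⁻¹ * ∑ j ∈ Finset.range n, G j) ∧
    Tendsto (fun n : ℕ => ((n:ℝ) ^ d)⁻¹ *
      ∑ j ∈ Fintype.piFinset (fun _ : Fin d => Finset.range n), g j) atTop (𝓝 c) := by
  have hS : ∀ n : ℕ, HasSum (fun k => lam k * ∏ i, ((n:ℝ)⁻¹ * ∑ j ∈ Finset.range n, u (k i) j))
      (((n:ℝ) ^ d)⁻¹ * ∑ j ∈ Fintype.piFinset (fun _ : Fin d => Finset.range n), g j) := by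
    intro n
    have := (hasSum_sum (s := Fintype.piFinset (fun _ : Fin d => Finset.range n))
      (fun j _ => hg j)).mul_left (((n:ℝ) ^ d)⁻¹)
    refine this.congr_fun ?_
    intro k
    rw [Finset.prod_mul_distrib, Finset.prod_univ_sum, Finset.prod_const, Finset.card_univ,
      Fintype.card_fin, ← Finset.mul_sum, inv_pow]
    ring
  have hB : ∀ n : ℕ, HasSum (fun k => |lam k| *
      ((d:ℝ)⁻¹ * ∑ i, ((n:ℝ)⁻¹ * ∑ j ∈ Finset.range n, |u (k i) j| ^ d)))
      ((n:ℝ)⁻¹ * ∑ j ∈ Finset.range n, G j) := by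
    intro n
    have := (hasSum_sum (s := Finset.range n) (fun j _ => hG j)).mul_left ((n:ℝ)⁻¹)
    refine this.congr_fun ?_
    intro k
    simp_rw [← Finset.mul_sum]
    rw [Finset.sum_comm]
    ring
  have hle : ∀ (n : ℕ) (k : Fin d → ℕ),
      |lam k * ∏ i, ((n:ℝ)⁻¹ * ∑ j ∈ Finset.range n, u (k i) j)| ≤ |lam k| *
      ((d:ℝ)⁻¹ * ∑ i, ((n:ℝ)⁻¹ * ∑ j ∈ Finset.range n, |u (k i) j| ^ d)) := by
    intro n k
    rw [abs_mul]
    refine mul_le_mul_of_nonneg_left ?_ (abs_nonneg _)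
    refine (amgm hd _).trans ?_
    refine mul_le_mul_of_nonneg_left ?_ (by positivity)
    refine Finset.sum_le_sum fun i _ => ?_
    rcases avg_pow_le d n (u (k i)) with h | h
    · exact h
    · subst h
      simp [show d ≠ 0 by omega]
  refine ⟨fun n => ?_, gdct_sum hle ?_ ?_ hS hc hB hγ hGlim⟩
  · rw [abs_le]
    constructor
    · exact hasSum_le (fun k => (neg_le_neg (hle n k)).trans (neg_abs_le _)) (hB n).neg (hS n)
    · exact hasSum_le (fun k => (le_abs_self _).trans (hle n k)) (hS n) (hB n)
  · intro k
    exact (tendsto_finsetProd _ (fun i _ => hm (k i))).const_mul _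
  · intro k
    exact ((tendsto_finsetSum _ (fun i _ => hq (k i))).const_mul _).const_mul _

end VMAux

namespace VonMises

/-- Corollary 3: if an ergodic `T` and a kernel
`f = Σ_k λ_k e_{k_1}⊗⋯⊗e_{k_d}` with `Σ|λ_k| < ∞` are given (where `e_0 ≡ 1` and the
`e_k`, `k ≥ 1`, are normalized in `L_d(μ)` with zero mean), then `f ∈ L_{d,π}(μ^d)` and
the normalized `V`-statistics converge a.s. and in `L_1(μ)` to `∫ f dμ^d`. -/
theorem statement8
    {X : Type} [MeasurableSpace X] [StandardBorelSpace X]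
    (μ : Measure X) [IsProbabilityMeasure μ]
    (d : ℕ) (hd : 1 ≤ d) [Fact (1 ≤ (d : ℝ≥0∞))]
    (T : X → X) (hT : MeasurePreserving T μ μ) (herg : Ergodic T μ)
    (E : Type) [NormedAddCommGroup E] [NormedSpace ℝ E] [CompleteSpace E]
    (tp : ContinuousMultilinearMap ℝ (fun _ : Fin d => Lp ℝ (d : ℝ≥0∞) μ) E)
    (hE : IsPTP μ (fun _ : Fin d => (d : ℝ≥0∞)) E tp)
    (J : E →L[ℝ] Lp ℝ (d : ℝ≥0∞) (pm μ d))
    (hJ : IsEmbed μ (fun _ : Fin d => (d : ℝ≥0∞)) (d : ℝ≥0∞) tp J)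
    (D : E →L[ℝ] Lp ℝ 1 μ) (hD : IsDiag μ (fun _ : Fin d => (d : ℝ≥0∞)) 1 tp D)
    (W : (Fin d → ℕ) → E →L[ℝ] E)
    (hW : ∀ k, IsTKoop μ (fun _ : Fin d => (d : ℝ≥0∞)) tp (fun _ => T) k (W k))
    -- the system `(e_k)`
    (e : ℕ → Lp ℝ (d : ℝ≥0∞) μ)
    (he0 : (e 0 : X → ℝ) =ᵐ[μ] fun _ => 1)
    (henorm : ∀ k, 1 ≤ k → ‖e k‖ = 1)
    (hemean : ∀ k, 1 ≤ k → ∫ x, (e k : X → ℝ) x ∂μ = 0)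
    -- the kernel `f` and its absolutely convergent expansion
    (f : Lp ℝ (d : ℝ≥0∞) (pm μ d))
    (P : (Fin d → ℕ) → Lp ℝ (d : ℝ≥0∞) (pm μ d))
    (hP : ∀ k, (P k : (Fin d → X) → ℝ) =ᵐ[pm μ d] fun x => ∏ i, (e (k i) : X → ℝ) (x i))
    (lam : (Fin d → ℕ) → ℝ)
    (habs : Summable fun k => |lam k|)
    (hrep : HasSum (fun k => lam k • P k) f) :
    (∃ φ : E, J φ = f) ∧
    ∀ φ : E, J φ = f →
      (∀ᵐ x ∂μ, Tendsto (fun n : ℕ =>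
          ((n : ℝ) ^ d)⁻¹ *
            ∑ k ∈ Fintype.piFinset (fun _ : Fin d => Finset.range n), (D (W k φ) : X → ℝ) x)
        atTop (𝓝 (∫ y, (f : (Fin d → X) → ℝ) y ∂ pm μ d))) ∧
      Tendsto (fun n : ℕ => eLpNorm (fun x =>
          ((n : ℝ) ^ d)⁻¹ *
            (∑ k ∈ Fintype.piFinset (fun _ : Fin d => Finset.range n), (D (W k φ) : X → ℝ) x) -
            ∫ y, (f : (Fin d → X) → ℝ) y ∂ pm μ d) 1 μ)
        atTop (𝓝 0) := by
  have hdne : (d : ℝ≥0∞) ≠ ∞ := ENNReal.natCast_ne_top d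
  have hd0 : d ≠ 0 := by omega
  have hnorm : ∀ k, ‖e k‖ ≤ 1 := by
    intro k
    rcases Nat.eq_zero_or_pos k with rfl | hk
    · rw [Lp.norm_def, eLpNorm_congr_ae he0, eLpNorm_const _ (by simpa using hd0)
        (IsProbabilityMeasure.ne_zero μ)]
      simp
    · exact (henorm k hk).le
  set τ : (Fin d → ℕ) → E := fun k => tp (fun i => e (k i)) with hτ
  have hτn : ∀ k, ‖τ k‖ ≤ 1 := by
    intro k
    rw [hτ, hE.crossNorm]
    exact Finset.prod_le_one (fun _ _ => norm_nonneg _) (fun i _ => hnorm _)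
  have hJτ : ∀ k, J (τ k) = P k := fun k => Lp.ext ((hJ _).trans (hP k).symm)
  have hnsum : Summable fun k => ‖lam k • τ k‖ := by
    refine Summable.of_nonneg_of_le (fun _ => norm_nonneg _) (fun k => ?_) habs
    rw [norm_smul, Real.norm_eq_abs]
    exact mul_le_of_le_one_right (abs_nonneg _) (hτn k)
  have hsum : HasSum (fun k => lam k • τ k) (∑' k, lam k • τ k) := hnsum.of_norm.hasSum
  have hJφ : J (∑' k, lam k • τ k) = f := by
    refine HasSum.unique ?_ hrep
    have := hsum.mapL J
    simpa only [map_smul, hJτ] using this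
  refine ⟨⟨_, hJφ⟩, ?_⟩
  intro φ hφ
  have hφeq : φ = ∑' k, lam k • τ k := by
    rw [← sub_eq_zero]
    refine VMAux.J_injective μ (d : ℝ≥0∞) E tp J hE hJ hdne _ ?_
    rw [map_sub, hφ, hJφ, sub_self]
  rw [← hφeq] at hsum
  -- the limit
  set m : ℕ → ℝ := fun k => ∫ x, (e k : X → ℝ) x ∂μ with hm
  have hc : HasSum (fun k => lam k * ∏ i, m (k i)) (∫ y, (f : (Fin d → X) → ℝ) y ∂ pm μ d) := by
    obtain ⟨L, hL⟩ := VMAux.exists_intCLM (pm μ d) (d : ℝ≥0∞) Set.univ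
    have h := hrep.mapL L
    simp only [map_smul, smul_eq_mul] at h
    simp only [hL, Measure.restrict_univ] at h
    refine h.congr_fun fun k => ?_
    congr 1
    rw [integral_congr_ae (hP k)]
    exact (integral_fintype_prod_eq_prod (fun i x => (e (k i) : X → ℝ) x)).symm
  -- pointwise expansion of the diagonal restrictions
  have hDW : ∀ j k, (D (W j (τ k)) : X → ℝ) =ᵐ[μ] fun x => ∏ i, (e (k i) : X → ℝ) (T^[j i] x) := by
    intro j k
    have h1 : ∀ i, (Lp.compMeasurePreserving (T^[j i]) (hT.iterate (j i)) (e (k i)) : X → ℝ)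
        =ᵐ[μ] fun x => (e (k i) : X → ℝ) (T^[j i] x) :=
      fun i => Lp.coeFn_compMeasurePreserving _ _
    rw [hτ]
    simp only
    rw [hW j _ _ h1]
    filter_upwards [hD.2 (fun i => Lp.compMeasurePreserving (T^[j i]) (hT.iterate (j i)) (e (k i))),
      ae_all_iff.2 h1] with x hx hx1
    rw [hx]
    exact Finset.prod_congr rfl fun i _ => hx1 i
  have hg : ∀ j, ∀ᵐ x ∂μ, HasSum (fun k => lam k * ∏ i, (e (k i) : X → ℝ) (T^[j i] x))
      ((D (W j φ) : X → ℝ) x) := by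
    intro j
    have hs : HasSum (fun k => lam k • D (W j (τ k))) (D (W j φ)) := by
      have := (hsum.mapL (W j)).mapL D
      simpa only [map_smul] using this
    have hs' : Summable (fun k => ‖lam k • D (W j (τ k))‖) := by
      have := hnsum.mul_left (‖D.comp (W j)‖)
      refine Summable.of_nonneg_of_le (fun _ => norm_nonneg _) (fun k => ?_) this
      have h2 := (D.comp (W j)).le_opNorm (lam k • τ k)
      simpa only [ContinuousLinearMap.comp_apply, map_smul] using h2
    have h1 := Lp.hasSum_coeFn_tsum (tsum_enorm_ne_top_iff_summable_norm.2 hs')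
    rw [hs.tsum_eq] at h1
    filter_upwards [h1, ae_all_iff.2 (hDW j),
      ae_all_iff.2 (fun k => Lp.coeFn_smul (lam k) (D (W j (τ k))))] with x hx hx1 hx2
    refine hx.congr_fun fun k => ?_
    rw [hx2, Pi.smul_apply, hx1, smul_eq_mul]
  -- the dominating function
  set q : ℕ → ℝ := fun k => ∫ x, |(e k : X → ℝ) x| ^ d ∂μ with hq
  have hqi : ∀ k, Integrable (fun x => |(e k : X → ℝ) x| ^ d) μ := by
    intro k
    exact (Lp.memLp (e k)).integrable_norm_pow hd0
  have hq0 : ∀ k, 0 ≤ q k := fun k => integral_nonneg fun x => by positivity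
  have hq1 : ∀ k, q k ≤ 1 := by
    intro k
    have h1 := (Lp.memLp (e k)).eLpNorm_eq_integral_rpow_norm (by simpa using hd0) hdne
    have h2 := hnorm k
    rw [Lp.norm_def, h1, ENNReal.toReal_ofReal (by positivity)] at h2
    simp only [ENNReal.toReal_natCast, Real.rpow_natCast, Real.norm_eq_abs] at h2
    by_contra hlt
    push Not at hlt
    exact absurd h2 (not_le.2 (Real.one_lt_rpow hlt (by positivity)))
  set H : (Fin d → ℕ) → X → ℝ := fun k x => |lam k| * ((d:ℝ)⁻¹ * ∑ i, |(e (k i) : X → ℝ) x| ^ d)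
    with hH
  have hHi : ∀ k, Integrable (H k) μ := fun k =>
    ((integrable_finsetSum _ fun i _ => hqi (k i)).const_mul _).const_mul _
  have hHint : ∀ k, ∫ x, H k x ∂μ = |lam k| * ((d:ℝ)⁻¹ * ∑ i, q (k i)) := by
    intro k
    simp only [hH]
    rw [integral_const_mul, integral_const_mul, integral_finsetSum _ fun i _ => hqi (k i)]
  have hH0 : ∀ k x, 0 ≤ H k x := fun k x => by simp only [hH]; positivity
  set HL : (Fin d → ℕ) → Lp ℝ 1 μ := fun k => (hHi k).toL1 (H k) with hHL
  have hHLc : ∀ k, (HL k : X → ℝ) =ᵐ[μ] H k := fun k => (hHi k).coeFn_toL1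
  have hHLn : Summable fun k => ‖HL k‖ := by
    refine Summable.of_nonneg_of_le (fun _ => norm_nonneg _) (fun k => ?_) habs
    have h0 : ∫ x, ‖(HL k : X → ℝ) x‖ ∂μ = ∫ x, H k x ∂μ := by
      refine integral_congr_ae ?_
      filter_upwards [hHLc k] with x hx
      rw [hx]
      exact Real.norm_of_nonneg (hH0 k x)
    rw [L1.norm_eq_integral_norm, h0, hHint]
    refine mul_le_of_le_one_right (abs_nonneg _) ?_
    have h2 : ∑ i : Fin d, q (k i) ≤ d := by
      calc ∑ i : Fin d, q (k i) ≤ ∑ i : Fin d, (1:ℝ) := Finset.sum_le_sum fun i _ => hq1 _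
        _ = d := by simp
    have h3 : (0:ℝ) < d := by positivity
    rw [inv_mul_le_iff₀ h3]
    linarith
  set G : Lp ℝ 1 μ := ∑' k, HL k with hG
  have hGs : HasSum HL G := hHLn.of_norm.hasSum
  have hGae : ∀ᵐ x ∂μ, HasSum (fun k => H k x) ((G : X → ℝ) x) := by
    filter_upwards [Lp.hasSum_coeFn_tsum (tsum_enorm_ne_top_iff_summable_norm.2 hHLn),
      ae_all_iff.2 hHLc] with x hx hx1
    simpa only [hx1] using hx
  have hGi : Integrable (G : X → ℝ) μ := VMAux.Lp_integrable G
  have hγ : HasSum (fun k => |lam k| * ((d:ℝ)⁻¹ * ∑ i, q (k i))) (∫ x, (G : X → ℝ) x ∂μ) := by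
    obtain ⟨L, hL⟩ := VMAux.exists_intCLM μ 1 Set.univ
    have h := hGs.mapL L
    simp only [hL, Measure.restrict_univ] at h
    convert h using 2 with k
    rw [integral_congr_ae (hHLc k), hHint]
  have hem : ∀ k, Measurable (e k : X → ℝ) := fun k => (Lp.stronglyMeasurable (e k)).measurable
  have hGm : Measurable (G : X → ℝ) := (Lp.stronglyMeasurable G).measurable
  have hGae' : ∀ᵐ x ∂μ, ∀ j : ℕ, HasSum (fun k => H k (T^[j] x)) ((G : X → ℝ) (T^[j] x)) :=
    ae_all_iff.2 fun j => (hT.iterate j).quasiMeasurePreserving.ae hGae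
  have hB := VMAux.birkhoff herg hGm hGi
  have hmain : ∀ᵐ x ∂μ,
      (∀ n : ℕ, |((n:ℝ) ^ d)⁻¹ * ∑ k ∈ Fintype.piFinset (fun _ : Fin d => Finset.range n),
        (D (W k φ) : X → ℝ) x| ≤ (n:ℝ)⁻¹ * ∑ j ∈ Finset.range n, (G : X → ℝ) (T^[j] x)) ∧
      Tendsto (fun n : ℕ => ((n:ℝ) ^ d)⁻¹ *
        ∑ k ∈ Fintype.piFinset (fun _ : Fin d => Finset.range n), (D (W k φ) : X → ℝ) x) atTop
        (𝓝 (∫ y, (f : (Fin d → X) → ℝ) y ∂ pm μ d)) := by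
    filter_upwards [ae_all_iff.2 hg, hGae', hB,
      ae_all_iff.2 fun k => VMAux.birkhoff herg (hem k) (VMAux.Lp_integrable (e k)),
      ae_all_iff.2 fun k => VMAux.birkhoff herg
        (show Measurable (fun x => |(e k : X → ℝ) x| ^ d) from (hem k).abs.pow_const d) (hqi k)]
      with x h1 h2 h3 h4 h5
    exact VMAux.ptwise hd lam (fun k j => (e k : X → ℝ) (T^[j] x)) m q h4 h5 _ h1 _ h2 _ h3 hγ _ hc
  refine ⟨hmain.mono fun x hx => hx.2, ?_⟩
  have hGj : ∀ j : ℕ, Integrable (fun x => (G : X → ℝ) (T^[j] x)) μ := fun j =>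
    (hT.iterate j).integrable_comp_of_integrable hGi
  have hGjint : ∀ j : ℕ, ∫ x, (G : X → ℝ) (T^[j] x) ∂μ = ∫ x, (G : X → ℝ) x ∂μ := by
    intro j
    exact VMAux.integral_comp_mp (hT.iterate j) hGm
  set F : ℕ → X → ℝ := fun n x => ((n:ℝ) ^ d)⁻¹ *
    ∑ k ∈ Fintype.piFinset (fun _ : Fin d => Finset.range n), (D (W k φ) : X → ℝ) x with hF
  have hFi : ∀ n, Integrable (F n) μ := fun n =>
    (integrable_finsetSum _ fun k _ => VMAux.Lp_integrable (D (W k φ))).const_mul _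
  have hlim := VMAux.gdct (ν := μ) (F := F)
    (G := fun n x => (n:ℝ)⁻¹ * ∑ j ∈ Finset.range n, (G : X → ℝ) (T^[j] x))
    (f := fun _ => ∫ y, (f : (Fin d → X) → ℝ) y ∂ pm μ d)
    (g := fun _ => ∫ x, (G : X → ℝ) x ∂μ)
    (fun n => (hFi n).aestronglyMeasurable) aestronglyMeasurable_const
    (fun n => (integrable_finsetSum _ fun j _ => hGj j).const_mul _) (integrable_const _)
    (fun n => hmain.mono fun x hx => hx.1 n) (hmain.mono fun x hx => hx.2) hB ?_
  · have h0 : Tendsto (fun n => ENNReal.ofReal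
        (∫ x, |F n x - ∫ y, (f : (Fin d → X) → ℝ) y ∂ pm μ d| ∂μ)) atTop (𝓝 0) := by
      simpa using (ENNReal.tendsto_ofReal hlim)
    refine h0.congr fun n => ?_
    rw [eLpNorm_one_eq_lintegral_enorm]
    exact ofReal_integral_norm_eq_lintegral_enorm ((hFi n).sub (integrable_const _))
  · refine tendsto_const_nhds.congr' ?_
    filter_upwards [eventually_gt_atTop 0] with n hn
    rw [integral_const_mul, integral_finsetSum _ fun j _ => hGj j]
    simp only [hGjint, Finset.sum_const, Finset.card_range, nsmul_eq_mul, integral_const,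
      probReal_univ, one_smul]
    have : (n:ℝ) ≠ 0 := by positivity
    field_simp

end VonMises
end
end

section
/- Let m ∈ {1,…,d}, p ∈ [2,∞) and s ∈ {1,…,m}. There exists a constant C(p,s) > 0 with the following property: for every subset S ⊂ {1,…,m} of cardinality s and every f ∈ L_{p,π}(μ^m) satisfying V^{*𝐞_l} f = 0 for all l ∈ S, and for every family (n_l)_{l∈S} of natural numbers, one has | Σ_{𝐤 ∈ ℤ_+^{m,S}, 0 ≤ k_l ≤ n_l−1 for l∈S} V^{𝐤} f |_{p,m,π} ≤ C(p,s) (∏_{l∈S} √(n_l)) |f|_{p,m,π}. Moreover, if p ≥ m and r = p/m, then also | Σ_{𝐤 ∈ ℤ_+^{m,S}, 0 ≤ k_l ≤ n_l−1 for l∈S} D_m V^{𝐤} f |_r ≤ C(p,s) (∏_{l∈S} √(n_l)) |f|_{p,m,π}. -/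
open MeasureTheory Filter Topology ENNReal ProbabilityTheory

noncomputable section

theorem exp_le_quad (z : ℝ) : Real.exp z ≤ 1 + z + z ^ 2 * Real.exp |z| := by
  have h := Complex.norm_exp_sub_sum_le_norm_mul_exp (z : ℂ) 2
  have h2 : Complex.exp z - ∑ m ∈ Finset.range 2, (z : ℂ) ^ m / m.factorial
      = ((Real.exp z - (1 + z) : ℝ) : ℂ) := by
    simp [Finset.sum_range_succ]
  rw [h2, Complex.norm_real, Complex.norm_real, Real.norm_eq_abs, Real.norm_eq_abs, sq_abs] at h
  linarith [le_abs_self (Real.exp z - (1 + z))]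

theorem one_add_bound (q : ℝ) (hq : 2 ≤ q) (t : ℝ) :
    |1 + t| ^ q ≤ 1 + q * t + (q ^ 2 * Real.exp q + 2 ^ q + q) * (t ^ 2 + |t| ^ q) := by
  have e0 := Real.exp_pos q
  have p0 : (0:ℝ) < 2 ^ q := by positivity
  have q0 : 0 ≤ |t| ^ q := by positivity
  rcases le_or_gt |t| 1 with h | h
  · have h' := abs_le.1 h
    have h1 : |1 + t| ^ q ≤ Real.exp (q * t) := by
      rw [abs_of_nonneg (by linarith), mul_comm, Real.exp_mul]
      apply Real.rpow_le_rpow (by linarith) _ (by linarith)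
      linarith [Real.add_one_le_exp t]
    have h2 := exp_le_quad (q * t)
    have h3 : Real.exp |q * t| ≤ Real.exp q := by
      apply Real.exp_le_exp.2
      rw [abs_mul, abs_of_nonneg (by linarith : 0 ≤ q)]
      nlinarith
    have h4 : (q * t) ^ 2 * Real.exp |q * t| ≤ (q * t) ^ 2 * Real.exp q := by gcongr
    have h5 : 0 ≤ (2 ^ q + q) * (t ^ 2 + |t| ^ q) := by positivity
    have h6 : 0 ≤ q ^ 2 * Real.exp q * |t| ^ q := by positivity
    nlinarith
  · have h1 : |1 + t| ^ q ≤ 2 ^ q * |t| ^ q := by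
      rw [← Real.mul_rpow (by norm_num) (abs_nonneg _)]
      apply Real.rpow_le_rpow (abs_nonneg _) _ (by linarith)
      have := abs_add_le 1 t
      rw [abs_one] at this
      linarith
    have h2 : |t| ≤ |t| ^ q := by
      simpa using Real.rpow_le_rpow_of_exponent_le h.le (by linarith : (1:ℝ) ≤ q)
    have h3 : -(q * t) ≤ q * |t| ^ q := by
      have := neg_abs_le t
      nlinarith
    have h5 : 0 ≤ (2 ^ q + q) * t ^ 2 := by positivity
    have h6 : 0 ≤ q ^ 2 * Real.exp q * (t ^ 2 + |t| ^ q) := by positivity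
    nlinarith

theorem pointwise_bound (q : ℝ) (hq : 2 ≤ q) : ∃ C : ℝ, 1 ≤ C ∧ ∀ x y : ℝ,
    |x + y| ^ q ≤ |x| ^ q + q * ((|x| ^ (q - 2) * x) * y)
      + C * (|x| ^ (q - 2) * y ^ 2 + |y| ^ q) := by
  have e0 := Real.exp_pos q
  have p0 : (0:ℝ) < 2 ^ q := by positivity
  refine ⟨q ^ 2 * Real.exp q + 2 ^ q + q, by have : 0 ≤ q ^ 2 * Real.exp q := by positivity
                                             linarith, fun x y => ?_⟩
  set C := q ^ 2 * Real.exp q + 2 ^ q + q with hC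
  have hC1 : 1 ≤ C := by
    have : 0 ≤ q ^ 2 * Real.exp q := by positivity
    linarith
  by_cases hx : x = 0
  · subst hx
    have h1 : 0 ≤ |(0:ℝ)| ^ (q - 2) * y ^ 2 := by positivity
    have h2 : 0 ≤ |(0:ℝ)| ^ q := by positivity
    have h3 : 0 ≤ |y| ^ q := by positivity
    simp only [zero_add, mul_zero, zero_mul, add_zero]
    nlinarith
  · obtain ⟨t, rfl⟩ : ∃ t, y = x * t := ⟨y / x, by field_simp⟩
    have hax : 0 < |x| := abs_pos.2 hx
    have hsplit : |x| ^ q = |x| ^ (q - 2) * x ^ 2 := by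
      rw [← sq_abs x, ← Real.rpow_natCast |x| 2, ← Real.rpow_add hax]
      norm_num
    have h := one_add_bound q hq t
    rw [← hC] at h
    have e1 : |x + x * t| ^ q = |x| ^ q * |1 + t| ^ q := by
      rw [← Real.mul_rpow (abs_nonneg _) (abs_nonneg _), ← abs_mul]; ring_nf
    have e2 : |x * t| ^ q = |x| ^ q * |t| ^ q := by
      rw [abs_mul, Real.mul_rpow (abs_nonneg _) (abs_nonneg _)]
    have e3 : |x| ^ (q - 2) * x * (x * t) = |x| ^ q * t := by rw [hsplit]; ring
    have e4 : |x| ^ (q - 2) * (x * t) ^ 2 = |x| ^ q * t ^ 2 := by rw [hsplit]; ring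
    rw [e1, e2, e3, e4]
    have hp : 0 ≤ |x| ^ q := by positivity
    nlinarith [mul_le_mul_of_nonneg_left h hp]

theorem young_lam (q : ℝ) (hq : 2 ≤ q) (x y l : ℝ) (hl : 0 < l) :
    |x| ^ (q - 2) * y ^ 2 ≤ (|x| ^ q + l ^ q * |y| ^ q) / l ^ 2 := by
  rw [le_div_iff₀ (by positivity)]
  have key : ∀ a b : ℝ, 0 ≤ a → 0 ≤ b → a ^ (q - 2) * b ^ 2 ≤ a ^ q + b ^ q := by
    intro a b ha hb
    have hs : ∀ c : ℝ, 0 ≤ c → c ^ (q - 2) * c ^ 2 = c ^ q := by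
      intro c hc
      rcases hc.eq_or_lt with rfl | hc
      · simp [Real.zero_rpow (by linarith : q ≠ 0)]
      · rw [← Real.rpow_natCast c 2, ← Real.rpow_add hc]; norm_num
    rcases le_total a b with h | h
    · calc a ^ (q - 2) * b ^ 2 ≤ b ^ (q - 2) * b ^ 2 := by
            gcongr
        _ = b ^ q := hs b hb
        _ ≤ _ := by have : 0 ≤ a ^ q := by positivity
                    linarith
    · calc a ^ (q - 2) * b ^ 2 ≤ a ^ (q - 2) * a ^ 2 := by gcongr
        _ = a ^ q := hs a ha
        _ ≤ _ := by have : 0 ≤ b ^ q := by positivity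
                    linarith
  have := key |x| (l * |y|) (abs_nonneg _) (by positivity)
  rw [Real.mul_rpow hl.le (abs_nonneg _), mul_pow, sq_abs] at this
  linarith

theorem cross_bound (q : ℝ) (hq : 2 ≤ q) (x y : ℝ) :
    |(|x| ^ (q - 2) * x) * y| ≤ |x| ^ q + |y| ^ q := by
  have hs : ∀ c : ℝ, 0 ≤ c → c ^ (q - 2) * c * c = c ^ q := by
      intro c hc
      rcases hc.eq_or_lt with rfl | hc
      · simp [Real.zero_rpow (by linarith : q ≠ 0)]
      · rw [mul_assoc, ← sq, ← Real.rpow_natCast c 2, ← Real.rpow_add hc]; norm_num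
  rw [abs_mul, abs_mul, abs_of_nonneg (by positivity : 0 ≤ |x| ^ (q - 2))]
  rcases le_total |x| |y| with h | h
  · calc |x| ^ (q - 2) * |x| * |y| ≤ |y| ^ (q - 2) * |y| * |y| := by
            gcongr
        _ = |y| ^ q := hs _ (abs_nonneg _)
        _ ≤ _ := by have : 0 ≤ |x| ^ q := by positivity
                    linarith
  · calc |x| ^ (q - 2) * |x| * |y| ≤ |x| ^ (q - 2) * |x| * |x| := by gcongr
        _ = |x| ^ q := hs _ (abs_nonneg _)
        _ ≤ _ := by have : 0 ≤ |y| ^ q := by positivity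
                    linarith

/-- The real recursion: growth of `p`-th moments. -/
theorem moment_recursion (q : ℝ) (hq : 2 ≤ q) (C : ℝ) (hC : 1 ≤ C) (B : ℝ) (hB : 0 ≤ B)
    (I : ℕ → ℝ) (h0 : I 0 = 0) (h1 : I 1 ≤ B)
    (hrec : ∀ n, ∀ l : ℝ, 0 < l → I (n + 1) ≤ I n + C * ((I n + l ^ q * B) / l ^ 2 + B)) :
    ∀ n : ℕ, I n ≤ (3 * C * Real.sqrt n) ^ q * B := by
  intro n
  set K := 3 * C with hK
  have hK1 : 3 ≤ K := by linarith
  have hK0 : 0 < K := by linarith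
  induction n with
  | zero => simp [h0, Real.zero_rpow (by linarith : q ≠ 0)]
  | succ n ih =>
    rcases Nat.eq_zero_or_pos n with rfl | hn
    · refine h1.trans ?_
      simp only [zero_add, Nat.cast_one, Real.sqrt_one, mul_one]
      have : 1 ≤ K ^ q := Real.one_le_rpow (by linarith) (by linarith)
      nlinarith
    · have hn' : (1:ℝ) ≤ n := by exact_mod_cast hn
      have hn0 : (0:ℝ) < n := by linarith
      have hsq : 0 < Real.sqrt n := Real.sqrt_pos.2 hn0
      have hr := hrec n (K * Real.sqrt n) (by positivity)
      set A := (K * Real.sqrt n) ^ q with hA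
      have hA0 : 0 < A := by positivity
      have hl2 : (K * Real.sqrt n) ^ 2 = K ^ 2 * n := by
        rw [mul_pow, Real.sq_sqrt hn0.le]
      rw [hl2] at hr
      have hAge : K ^ 2 * n ≤ A := by
        rw [← hl2, hA, ← Real.rpow_natCast]
        apply Real.rpow_le_rpow_of_exponent_le _ (by exact_mod_cast hq)
        have : 1 ≤ Real.sqrt n := Real.one_le_sqrt.2 hn'
        nlinarith
      have hbern : A * (1 + 1 / n) ≤ (K * Real.sqrt ((n + 1 : ℕ) : ℝ)) ^ q := by
        have e : ((n + 1 : ℕ) : ℝ) = n * (1 + 1 / n) := by push_cast; field_simp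
        rw [e, Real.sqrt_mul hn0.le, ← mul_assoc, Real.mul_rpow (by positivity) (by positivity),
          ← hA]
        gcongr
        rw [Real.sqrt_eq_rpow, ← Real.rpow_mul (by positivity)]
        have := Real.self_le_rpow_of_one_le (x := 1 + 1 / (n:ℝ)) (y := 1 / 2 * q)
          (by have : 0 < 1 / (n:ℝ) := by positivity
              linarith) (by linarith)
        exact this
      have hd : (I n + A * B) / (K ^ 2 * n) ≤ (2 * A * B) / (K ^ 2 * n) := by
        gcongr; linarith
      have hBd : B ≤ A * B / (K ^ 2 * n) := by
        rw [le_div_iff₀ (by positivity)]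
        nlinarith
      have htot : C * ((I n + A * B) / (K ^ 2 * n) + B) ≤ A * B * (1 / n) := by
        calc C * ((I n + A * B) / (K ^ 2 * n) + B)
            ≤ C * ((2 * A * B) / (K ^ 2 * n) + A * B / (K ^ 2 * n)) := by gcongr
          _ = (A * B * (1 / n)) * (1 / K) := by rw [hK]; field_simp; ring
          _ ≤ (A * B * (1 / n)) * 1 := by
            gcongr
            rw [div_le_one hK0]; linarith
          _ = _ := by ring
      calc I (n + 1) ≤ A * B + A * B * (1 / n) := by linarith
        _ = A * (1 + 1 / n) * B := by ring
        _ ≤ _ := by gcongr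

section LpPart

variable {X : Type} [MeasurableSpace X] {μ : Measure X} [IsProbabilityMeasure μ]
  {p : ℝ≥0∞} [Fact (1 ≤ p)]

theorem Lp_norm_rpow (hp' : p ≠ ∞) (g : Lp ℝ p μ) :
    ‖g‖ ^ p.toReal = ∫ x, |g x| ^ p.toReal ∂μ := by
  have hp1 : 1 ≤ p := Fact.out
  have hp0 : p ≠ 0 := (zero_lt_one.trans_le hp1).ne'
  have hpr : 0 < p.toReal := ENNReal.toReal_pos hp0 hp'
  have hnn : 0 ≤ ∫ x, |g x| ^ p.toReal ∂μ := integral_nonneg fun x => by positivity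
  rw [Lp.norm_def, (Lp.memLp g).eLpNorm_eq_integral_rpow_norm hp0 hp']
  simp only [Real.norm_eq_abs]
  rw [ENNReal.toReal_ofReal (by positivity), Real.rpow_inv_rpow hnn hpr.ne']

theorem Lp_integrable_rpow (hp' : p ≠ ∞) (g : Lp ℝ p μ) :
    Integrable (fun x => |g x| ^ p.toReal) μ := by
  have hp1 : 1 ≤ p := Fact.out
  have hp0 : p ≠ 0 := (zero_lt_one.trans_le hp1).ne'
  have key := (Lp.memLp g).integrable_norm_rpow hp0 hp'
  simpa using key

/-- One step of the moment recursion. -/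
theorem one_step (hp2 : 2 ≤ p) (hp' : p ≠ ∞) {T : X → X} (hT : MeasurePreserving T μ μ)
    (C : ℝ) (hC1 : 1 ≤ C)
    (hC : ∀ x y : ℝ, |x + y| ^ p.toReal ≤ |x| ^ p.toReal
      + p.toReal * ((|x| ^ (p.toReal - 2) * x) * y)
      + C * (|x| ^ (p.toReal - 2) * y ^ 2 + |y| ^ p.toReal))
    (h g : Lp ℝ p μ)
    (hh : μ[(h : X → ℝ) | MeasurableSpace.comap T inferInstance] =ᵐ[μ] 0)
    (l : ℝ) (hl : 0 < l) :
    ‖Lp.compMeasurePreserving T hT g + h‖ ^ p.toReal ≤ ‖g‖ ^ p.toReal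
      + C * ((‖g‖ ^ p.toReal + l ^ p.toReal * ‖h‖ ^ p.toReal) / l ^ 2 + ‖h‖ ^ p.toReal) := by
  have hp1 : 1 ≤ p := Fact.out
  have hq : 2 ≤ p.toReal := by
    have := ENNReal.toReal_mono hp' hp2
    simpa using this
  set q := p.toReal with hqdef
  have hng : ‖g‖ = ‖Lp.compMeasurePreserving T hT g‖ := by simp
  rw [hng]
  set G := Lp.compMeasurePreserving T hT g with hG
  rw [Lp_norm_rpow hp', Lp_norm_rpow hp', Lp_norm_rpow hp', ← hqdef]
  have hhint : Integrable (h : X → ℝ) μ := (Lp.memLp h).integrable hp1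
  have hGi := Lp_integrable_rpow hp' G
  have hhi := Lp_integrable_rpow hp' h
  rw [← hqdef] at hGi hhi
  -- the strongly measurable version of the cross factor
  have hm : MeasurableSpace.comap T inferInstance ≤ (inferInstance : MeasurableSpace X) :=
    hT.measurable.comap_le
  have hGT : (G : X → ℝ) =ᵐ[μ] (g : X → ℝ) ∘ T := Lp.coeFn_compMeasurePreserving g hT
  set w : X → ℝ := fun x => |(g : X → ℝ) (T x)| ^ (q - 2) * (g : X → ℝ) (T x) with hw
  have hwm : StronglyMeasurable[MeasurableSpace.comap T inferInstance] w := by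
    have hgm : Measurable (g : X → ℝ) := (Lp.stronglyMeasurable g).measurable
    have hψ : Measurable (fun y => |(g : X → ℝ) y| ^ (q - 2) * (g : X → ℝ) y) := by fun_prop
    exact (hψ.comp (comap_measurable T)).stronglyMeasurable
  have hwG : w =ᵐ[μ] fun x => |G x| ^ (q - 2) * G x := by
    filter_upwards [hGT] with x hx
    simp [hw, hx]
  have hwh : Integrable (w * (h : X → ℝ)) μ := by
    refine Integrable.mono' (hGi.add hhi)
      (((hwm.mono hm).aestronglyMeasurable).mul hhint.aestronglyMeasurable) ?_
    filter_upwards [hwG] with x hx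
    simp only [Pi.mul_apply, Pi.add_apply, hx, Real.norm_eq_abs]
    exact cross_bound q hq _ _
  have hwh0 : ∫ x, (w * (h : X → ℝ)) x ∂μ = 0 := by
    rw [← integral_condExp hm]
    have := condExp_mul_of_stronglyMeasurable_left hwm hwh hhint
    rw [integral_congr_ae (g := fun _ => (0:ℝ))]
    · simp
    · filter_upwards [this, hh] with x h1 h2
      rw [h1]; simp [h2]
  have hbound : ∀ᵐ x ∂μ, |(G + h : Lp ℝ p μ) x| ^ q ≤ |G x| ^ q + q * (w * (h : X → ℝ)) x
      + C * ((|G x| ^ q + l ^ q * |h x| ^ q) / l ^ 2 + |h x| ^ q) := by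
    filter_upwards [Lp.coeFn_add G h, hwG] with x h1 h2
    rw [h1, Pi.add_apply, Pi.mul_apply, h2]
    refine (hC _ _).trans ?_
    have := young_lam q hq (G x) (h x) l hl
    gcongr
  have hI4 : Integrable (fun x => (|G x| ^ q + l ^ q * |h x| ^ q) / l ^ 2) μ :=
    (hGi.add (hhi.const_mul _)).div_const _
  have hI3 : Integrable (fun x => (|G x| ^ q + l ^ q * |h x| ^ q) / l ^ 2 + |h x| ^ q) μ :=
    hI4.add hhi
  have hI2 : Integrable (fun x => |G x| ^ q + q * (w * (h : X → ℝ)) x) μ :=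
    hGi.add (hwh.const_mul q)
  have := integral_mono_ae (by simpa [hqdef] using Lp_integrable_rpow hp' (G + h))
    (hI2.add (hI3.const_mul C)) hbound
  refine this.trans (le_of_eq ?_)
  simp only [Pi.add_apply]
  rw [integral_add hI2 (hI3.const_mul C), integral_add hGi (hwh.const_mul q),
    integral_const_mul, integral_const_mul, hwh0,
    integral_add hI4 hhi, integral_div, integral_add hGi (hhi.const_mul _), integral_const_mul]
  ring

/-- Koopman operator as a continuous linear map. -/
noncomputable def koop {T : X → X} (hT : MeasurePreserving T μ μ) : Lp ℝ p μ →L[ℝ] Lp ℝ p μ :=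
  (Lp.compMeasurePreservingₗᵢ ℝ T hT).toContinuousLinearMap

theorem koop_apply {T : X → X} (hT : MeasurePreserving T μ μ) (g : Lp ℝ p μ) :
    koop hT g = Lp.compMeasurePreserving T hT g := rfl

theorem koop_pow {T : X → X} (hT : MeasurePreserving T μ μ) (k : ℕ) (g : Lp ℝ p μ) :
    ((koop hT ^ k) g : X → ℝ) =ᵐ[μ] fun x => g (T^[k] x) := by
  have : (koop hT ^ k) g = Lp.compMeasurePreserving T^[k] (hT.iterate k) g := by
    rw [← Lp.compMeasurePreserving_iterate hT]
    induction k with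
    | zero => simp
    | succ k ih => rw [pow_succ', Function.iterate_succ_apply', ← ih]; rfl
  rw [this]
  exact Lp.coeFn_compMeasurePreserving g (hT.iterate k)

theorem sum_bound (hp2 : 2 ≤ p) (hp' : p ≠ ∞) {T : X → X} (hT : MeasurePreserving T μ μ) :
    ∃ K : ℝ, 0 < K ∧ ∀ h : Lp ℝ p μ,
      μ[(h : X → ℝ) | MeasurableSpace.comap T inferInstance] =ᵐ[μ] 0 →
      ∀ n : ℕ, ‖∑ k ∈ Finset.range n, (koop hT ^ k) h‖ ≤ K * Real.sqrt n * ‖h‖ := by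
  have hq : 2 ≤ p.toReal := by
    have := ENNReal.toReal_mono hp' hp2
    simpa using this
  obtain ⟨C, hC1, hC⟩ := pointwise_bound p.toReal hq
  refine ⟨3 * C, by linarith, fun h hh n => ?_⟩
  have := moment_recursion p.toReal hq C hC1 (‖h‖ ^ p.toReal) (by positivity)
    (fun n => ‖∑ k ∈ Finset.range n, (koop hT ^ k) h‖ ^ p.toReal)
    (by simp [Real.zero_rpow (by linarith : p.toReal ≠ 0)]) (by simp) (fun n l hl => by
      have e : ∑ k ∈ Finset.range (n + 1), (koop hT ^ k) h
          = Lp.compMeasurePreserving T hT (∑ k ∈ Finset.range n, (koop hT ^ k) h) + h := by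
        rw [Finset.sum_range_succ', ← koop_apply, map_sum]
        simp only [pow_succ', pow_zero]
        rfl
      simp only [e]
      exact one_step hp2 hp' hT C hC1 hC h _ hh l hl) n
  rw [← Real.mul_rpow (by positivity) (norm_nonneg _)] at this
  exact (Real.rpow_le_rpow_iff (norm_nonneg _) (by positivity) (by linarith)).1 this

/-- Conditional expectation on `Lp` given `T⁻¹ 𝓕`. -/
noncomputable def cexp (μ : Measure X) [IsProbabilityMeasure μ] (p : ℝ≥0∞) [Fact (1 ≤ p)]
    (T : X → X) : Lp ℝ p μ →L[ℝ] Lp ℝ p μ :=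
  LinearMap.mkContinuous
    { toFun := fun g => ((Lp.memLp g).condExp (m := MeasurableSpace.comap T inferInstance)
        Fact.out).toLp _
      map_add' := fun f g => by
        have hp1 : 1 ≤ p := Fact.out
        ext1
        refine (MemLp.coeFn_toLp _).trans ?_
        refine ((condExp_congr_ae (Lp.coeFn_add f g)).trans (condExp_add
          ((Lp.memLp f).integrable hp1) ((Lp.memLp g).integrable hp1) _)).trans ?_
        refine Filter.EventuallyEq.symm ((Lp.coeFn_add _ _).trans ?_)
        exact (MemLp.coeFn_toLp _).add (MemLp.coeFn_toLp _)
      map_smul' := fun c f => by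
        ext1
        refine (MemLp.coeFn_toLp _).trans ?_
        refine ((condExp_congr_ae (Lp.coeFn_smul c f)).trans (condExp_smul c _ _)).trans ?_
        refine Filter.EventuallyEq.symm ((Lp.coeFn_smul _ _).trans ?_)
        exact (MemLp.coeFn_toLp _).const_smul c } 1 (fun g => by
    have hp1 : 1 ≤ p := Fact.out
    rw [one_mul]
    simp only [LinearMap.coe_mk, AddHom.coe_mk]
    rw [Lp.norm_toLp, Lp.norm_def]
    exact ENNReal.toReal_mono (Lp.eLpNorm_ne_top g) (eLpNorm_condExp_le_eLpNorm _ hp1))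

theorem cexp_coe (T : X → X) (g : Lp ℝ p μ) :
    (cexp μ p T g : X → ℝ) =ᵐ[μ] μ[(g : X → ℝ) | MeasurableSpace.comap T inferInstance] :=
  MemLp.coeFn_toLp ((Lp.memLp g).condExp Fact.out)

theorem cexp_norm (T : X → X) : ‖cexp μ p T‖ ≤ 1 :=
  LinearMap.mkContinuous_norm_le _ zero_le_one _

theorem condExp_sub_cexp {T : X → X} (hT : Measurable T) (g : Lp ℝ p μ) :
    μ[((g - cexp μ p T g : Lp ℝ p μ) : X → ℝ) | MeasurableSpace.comap T inferInstance]
      =ᵐ[μ] 0 := by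
  have hp1 : 1 ≤ p := Fact.out
  have hm : MeasurableSpace.comap T inferInstance ≤ (inferInstance : MeasurableSpace X) :=
    hT.comap_le
  refine (condExp_congr_ae (Lp.coeFn_sub _ _)).trans ?_
  refine (condExp_sub ((Lp.memLp g).integrable hp1)
    ((Lp.memLp (cexp μ p T g)).integrable hp1) _).trans ?_
  have h1 : μ[(cexp μ p T g : X → ℝ) | MeasurableSpace.comap T inferInstance] =ᵐ[μ]
      μ[(g : X → ℝ) | MeasurableSpace.comap T inferInstance] := by
    refine (condExp_congr_ae (cexp_coe T g)).trans ?_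
    rw [condExp_of_stronglyMeasurable hm stronglyMeasurable_condExp integrable_condExp]
  filter_upwards [h1] with x hx
  simp [hx]

theorem exists_transfer {T : X → X} (hT : MeasurePreserving T μ μ) (g : Lp ℝ p μ) :
    ∃ w : Lp ℝ p μ, VonMises.IsTransfer μ T 1 g w ∧ koop hT w = cexp μ p T g := by
  have hp1 : 1 ≤ p := Fact.out
  have hm : MeasurableSpace.comap T inferInstance ≤ (inferInstance : MeasurableSpace X) :=
    hT.measurable.comap_le
  obtain ⟨w, hw, hwT⟩ := StronglyMeasurable.exists_eq_measurable_comp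
    (stronglyMeasurable_condExp (μ := μ) (f := (g : X → ℝ))
      (m := MeasurableSpace.comap T inferInstance))
  have hmem : MemLp (w ∘ T) p μ := hwT ▸ (Lp.memLp g).condExp hp1
  have hwmem : MemLp w p μ := by
    refine ⟨hw.aestronglyMeasurable, ?_⟩
    rw [← eLpNorm_comp_measurePreserving hw.aestronglyMeasurable hT]
    exact hmem.2
  refine ⟨hwmem.toLp w, ?_, ?_⟩
  · intro s hs
    rw [Function.iterate_one, integral_congr_ae (ae_restrict_of_ae hwmem.coeFn_toLp)]
    rw [← setIntegral_condExp hm ((Lp.memLp g).integrable hp1) ⟨s, hs, rfl⟩, hwT]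
    have := setIntegral_map hs (f := w) (μ := μ) (g := T)
      (by rw [hT.map_eq]; exact hw.aestronglyMeasurable) hT.measurable.aemeasurable
    rw [hT.map_eq] at this
    exact this
  · ext1
    rw [koop_apply]
    refine (Lp.coeFn_compMeasurePreserving _ hT).trans ?_
    refine Filter.EventuallyEq.trans ?_ (cexp_coe T g).symm
    rw [hwT]
    exact hT.quasiMeasurePreserving.ae_eq_comp hwmem.coeFn_toLp

end LpPart

theorem tensor_bound
    {X : Type} [MeasurableSpace X]
    (μ : Measure X) [IsProbabilityMeasure μ]
    (m : ℕ) (p : ℝ≥0∞) [Fact (1 ≤ p)]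
    (T : X → X) (hT : MeasurePreserving T μ μ)
    (E : Type) [NormedAddCommGroup E] [NormedSpace ℝ E] [CompleteSpace E]
    (tp : ContinuousMultilinearMap ℝ (fun _ : Fin m => Lp ℝ p μ) E)
    (hE : VonMises.IsPTP μ (fun _ : Fin m => p) E tp)
    (WK : (Fin m → ℕ) → E →L[ℝ] E)
    (hWK : ∀ k, VonMises.IsTKoop μ (fun _ : Fin m => p) tp (fun _ => T) k (WK k))
    (WT : (Fin m → ℕ) → E →L[ℝ] E)
    (hWT : ∀ k, VonMises.IsTTrans μ (fun _ : Fin m => p) tp (fun _ => T) k (WT k))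
    (K : ℝ) (hK0 : 0 < K) (hK : ∀ h : Lp ℝ p μ,
      μ[(h : X → ℝ) | MeasurableSpace.comap T inferInstance] =ᵐ[μ] 0 →
      ∀ n : ℕ, ‖∑ k ∈ Finset.range n, (koop hT ^ k) h‖ ≤ K * Real.sqrt n * ‖h‖)
    (S : Finset (Fin m)) (f : E) (hf : ∀ l ∈ S, WT (Pi.single l 1) f = 0) (n : Fin m → ℕ) :
    ‖∑ k ∈ Fintype.piFinset (fun l => if l ∈ S then Finset.range (n l) else {0}),
      WK k f‖ ≤ (2 * K) ^ S.card * (∏ l ∈ S, Real.sqrt (n l)) * ‖f‖ := by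
  -- Koopman operators on elementary tensors
  have hKoop : ∀ (k : Fin m → ℕ) (g : Fin m → Lp ℝ p μ),
      WK k (tp g) = tp fun i => (koop hT ^ k i) (g i) :=
    fun k g => hWK k g _ fun i => koop_pow hT (k i) (g i)
  -- the projections in one direction
  have hProj : ∀ (l : Fin m) (g : Fin m → Lp ℝ p μ),
      WK (Pi.single l 1) (WT (Pi.single l 1) (tp g))
        = tp (Function.update g l (cexp μ p T (g l))) := by
    intro l g
    obtain ⟨w, hw, hw2⟩ := exists_transfer hT (g l)
    have h1 : WT (Pi.single l 1) (tp g) = tp (Function.update g l w) := by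
      apply hWT
      intro i
      by_cases hi : i = l
      · subst hi
        simpa using hw
      · intro s hs
        simp [hi]
    rw [h1, hKoop]
    congr 1
    funext i
    by_cases hi : i = l
    · subst hi
      simp [hw2]
    · simp [hi]
  -- the operator R_S
  have hR : ∀ S : Finset (Fin m), ∃ R : E →L[ℝ] E,
      (∀ g : Fin m → Lp ℝ p μ,
        R (tp g) = tp fun i => if i ∈ S then g i - cexp μ p T (g i) else g i) ∧
      ∀ f : E, (∀ l ∈ S, WT (Pi.single l 1) f = 0) → R f = f := by
    intro S
    induction S using Finset.induction_on with
    | empty => exact ⟨ContinuousLinearMap.id ℝ E, by simp, by simp⟩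
    | insert l S hl ih =>
      obtain ⟨R, hR1, hR2⟩ := ih
      refine ⟨R.comp (ContinuousLinearMap.id ℝ E
        - (WK (Pi.single l 1)).comp (WT (Pi.single l 1))), fun g => ?_, fun f hf => ?_⟩
      · simp only [ContinuousLinearMap.comp_apply, ContinuousLinearMap.sub_apply,
          ContinuousLinearMap.id_apply, hProj]
        have e : tp g - tp (Function.update g l (cexp μ p T (g l)))
            = tp (Function.update g l (g l - cexp μ p T (g l))) := by
          have := tp.map_update_sub g l (g l) (cexp μ p T (g l))
          rw [this, Function.update_eq_self]
        rw [e, hR1]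
        congr 1
        funext i
        by_cases hi : i = l
        · subst hi
          simp [hl]
        · simp [hi]
      · have h0 := hf l (Finset.mem_insert_self _ _)
        simp only [ContinuousLinearMap.comp_apply, ContinuousLinearMap.sub_apply,
          ContinuousLinearMap.id_apply, h0, map_zero, sub_zero]
        exact hR2 f fun j hj => hf j (Finset.mem_insert_of_mem hj)
  obtain ⟨R, hR1, hR2⟩ := hR S
  let J : Fin m → Finset ℕ := fun l => if l ∈ S then Finset.range (n l) else {0}
  let Q : Fin m → (Lp ℝ p μ →L[ℝ] Lp ℝ p μ) := fun i =>
    if i ∈ S then ContinuousLinearMap.id ℝ _ - cexp μ p T else ContinuousLinearMap.id ℝ _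
  let A : Fin m → (Lp ℝ p μ →L[ℝ] Lp ℝ p μ) := fun i => (∑ k ∈ J i, koop hT ^ k).comp (Q i)
  have hQ : ∀ (g : Fin m → Lp ℝ p μ) i,
      Q i (g i) = if i ∈ S then g i - cexp μ p T (g i) else g i := by
    intro g i
    by_cases hi : i ∈ S <;> simp [Q, hi]
  obtain ⟨L, hL1, hL2⟩ := hE.lift E (tp.compContinuousLinearMap A)
  have hLsum : L = (∑ k ∈ Fintype.piFinset J, WK k).comp R := by
    refine ContinuousLinearMap.ext_on hE.denseSpan ?_
    rintro _ ⟨g, rfl⟩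
    simp only [hL1, ContinuousLinearMap.comp_apply, hR1]
    simp only [ContinuousLinearMap.sum_apply, hKoop,
      ContinuousMultilinearMap.compContinuousLinearMap_apply]
    rw [← tp.map_sum_finset (fun i k => (koop hT ^ k)
      (if i ∈ S then g i - cexp μ p T (g i) else g i)) J]
    congr 1
    funext i
    simp only [A, ContinuousLinearMap.comp_apply, hQ, ContinuousLinearMap.sum_apply]
  have htp : ‖tp‖ ≤ 1 := by
    refine ContinuousMultilinearMap.opNorm_le_bound zero_le_one fun g => ?_
    rw [one_mul]
    exact (hE.crossNorm g).le
  have hA : ∀ i, ‖A i‖ ≤ if i ∈ S then 2 * K * Real.sqrt (n i) else 1 := by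
    intro i
    by_cases hi : i ∈ S
    · simp only [hi, if_true]
      refine ContinuousLinearMap.opNorm_le_bound _ (by positivity) fun g => ?_
      have e : A i g = ∑ k ∈ Finset.range (n i), (koop hT ^ k) (g - cexp μ p T g) := by
        simp [A, Q, J, hi, ContinuousLinearMap.sum_apply]
      rw [e]
      refine (hK _ (condExp_sub_cexp hT.measurable g) (n i)).trans ?_
      have h2 : ‖g - cexp μ p T g‖ ≤ 2 * ‖g‖ := by
        have h3 := (cexp μ p T).le_of_opNorm_le (cexp_norm T) g
        have h4 := norm_sub_le g (cexp μ p T g)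
        linarith
      calc K * Real.sqrt (n i) * ‖g - cexp μ p T g‖ ≤ K * Real.sqrt (n i) * (2 * ‖g‖) := by
            gcongr
        _ = _ := by ring
    · simp only [hi, if_false]
      refine ContinuousLinearMap.opNorm_le_bound _ zero_le_one fun g => ?_
      simp [A, Q, J, hi]
  have hLn : ‖L‖ ≤ (2 * K) ^ S.card * ∏ l ∈ S, Real.sqrt (n l) := by
    calc ‖L‖ = ‖tp.compContinuousLinearMap A‖ := hL2
      _ ≤ ‖tp‖ * ∏ i, ‖A i‖ := ContinuousMultilinearMap.norm_compContinuousLinearMap_le _ _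
      _ ≤ 1 * ∏ i, (if i ∈ S then 2 * K * Real.sqrt (n i) else 1) := by
        gcongr with i
        exact hA i
      _ = _ := by
        rw [one_mul, Finset.prod_ite_mem, Finset.univ_inter, Finset.prod_mul_distrib,
          Finset.prod_const]
  have hfin : ∑ k ∈ Fintype.piFinset J, WK k f = L f := by
    rw [hLsum, ContinuousLinearMap.comp_apply, hR2 f hf, ContinuousLinearMap.sum_apply]
  change ‖∑ k ∈ Fintype.piFinset J, WK k f‖ ≤ _
  rw [hfin]
  exact L.le_of_opNorm_le hLn f

namespace VonMises

/-- Lemma 4: growth bounds for multiparameter sums of Koopman images of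
kernels killed by the transfer operators in the directions of `S`. -/
theorem statement10
    {X : Type} [MeasurableSpace X] [StandardBorelSpace X]
    (μ : Measure X) [IsProbabilityMeasure μ]
    (d m : ℕ) (hm1 : 1 ≤ m) (hmd : m ≤ d)
    (p : ℝ≥0∞) [Fact (1 ≤ p)] (hp2 : 2 ≤ p) (hp' : p ≠ ∞)
    (s : ℕ) (hs1 : 1 ≤ s) (hsm : s ≤ m)
    (T : X → X) (hT : MeasurePreserving T μ μ)
    (E : Type) [NormedAddCommGroup E] [NormedSpace ℝ E] [CompleteSpace E]
    (tp : ContinuousMultilinearMap ℝ (fun _ : Fin m => Lp ℝ p μ) E)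
    (hE : IsPTP μ (fun _ : Fin m => p) E tp)
    (WK : (Fin m → ℕ) → E →L[ℝ] E)
    (hWK : ∀ k, IsTKoop μ (fun _ : Fin m => p) tp (fun _ => T) k (WK k))
    (WT : (Fin m → ℕ) → E →L[ℝ] E)
    (hWT : ∀ k, IsTTrans μ (fun _ : Fin m => p) tp (fun _ => T) k (WT k)) :
    ∃ C : ℝ, 0 < C ∧
      (∀ S : Finset (Fin m), S.card = s → ∀ f : E,
        (∀ l ∈ S, WT (Pi.single l 1) f = 0) → ∀ n : Fin m → ℕ,
          ‖∑ k ∈ Fintype.piFinset (fun l => if l ∈ S then Finset.range (n l) else {0}),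
              WK k f‖ ≤ C * (∏ l ∈ S, Real.sqrt (n l)) * ‖f‖) ∧
      (∀ (r : ℝ≥0∞) [Fact (1 ≤ r)], r = p / m → (m : ℝ≥0∞) ≤ p →
        ∀ D : E →L[ℝ] Lp ℝ r μ, IsDiag μ (fun _ : Fin m => p) r tp D →
        ∀ S : Finset (Fin m), S.card = s → ∀ f : E,
          (∀ l ∈ S, WT (Pi.single l 1) f = 0) → ∀ n : Fin m → ℕ,
            ‖∑ k ∈ Fintype.piFinset (fun l => if l ∈ S then Finset.range (n l) else {0}),
                D (WK k f)‖ ≤ C * (∏ l ∈ S, Real.sqrt (n l)) * ‖f‖) := by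
  obtain ⟨K, hK0, hK⟩ := sum_bound hp2 hp' hT
  have main := tensor_bound μ m p T hT E tp hE WK hWK WT hWT K hK0 hK
  refine ⟨(2 * K) ^ s, by positivity, fun S hS f hf n => ?_,
    fun r _ hr hmp D hD S hS f hf n => ?_⟩
  · have := main S f hf n
    rwa [hS] at this
  · have := main S f hf n
    rw [hS] at this
    rw [← map_sum]
    refine (D.le_of_opNorm_le hD.1.le _).trans ?_
    rwa [one_mul]

end VonMises
end
end

section
/- Let p ∈ [1,∞] and let f ∈ L_{p,π}(μ^m) be a canonical kernel such that the series g = Σ_{𝐤 ∈ ℤ_+^m} V^{*𝐤} f converges in L_{p,π}(μ^m) (as a limit of rectangular partial sums Σ_{𝟎 ≤ 𝐤 < 𝐧} V^{*𝐤} f as n_1,…,n_m → ∞). Then f can be represented as f = Σ_{S ⊆ {1,…,m}} A^S f, where for every S, A^S f = (∏_{l∉S}(I − V^{𝐞_l}V^{*𝐞_l}) ∏_{l∈S}(V^{𝐞_l} − I)) h^S with h^S = (∏_{l∈S} V^{*𝐞_l}) g ∈ L_{p,π}(μ^m). The functions g and all h^S are canonical, and the summands A^S f in this representation are uniquely determined.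 -/
open MeasureTheory Filter Topology ENNReal ProbabilityTheory

noncomputable section

namespace VonMises

/-- The operator `∏_{l∉S}(I − V^{𝐞_l}V^{*𝐞_l}) ∏_{l∈S}(V^{𝐞_l} − I)` (the factors pairwise
commute, so the order of the product is immaterial). -/
def coboundaryProd {E : Type} [NormedAddCommGroup E] [NormedSpace ℝ E]
    (m : ℕ) (WK WT : (Fin m → ℕ) → E →L[ℝ] E) (S : Finset (Fin m)) : E →L[ℝ] E :=
  ((List.finRange m).map fun l =>
    if l ∈ S then WK (Pi.single l 1) - 1
    else 1 - WK (Pi.single l 1) * WT (Pi.single l 1)).prod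

/-- The operator `∏_{l∈S} V^{*𝐞_l}`. -/
def transferProd {E : Type} [NormedAddCommGroup E] [NormedSpace ℝ E]
    (m : ℕ) (WT : (Fin m → ℕ) → E →L[ℝ] E) (S : Finset (Fin m)) : E →L[ℝ] E :=
  ((List.finRange m).map fun l => if l ∈ S then WT (Pi.single l 1) else 1).prod

section Analytic

variable {X : Type} [MeasurableSpace X]

lemma integrable_Lp {Y : Type} [MeasurableSpace Y] {ν : Measure Y} [IsProbabilityMeasure ν]
    {p : ℝ≥0∞} [hp : Fact (1 ≤ p)] (F : Lp ℝ p ν) : Integrable (F : Y → ℝ) ν :=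
  (Lp.memLp F).integrable hp.out

/-- Integration over a set as a continuous functional on `L_p`. -/
def setInt {Y : Type} [MeasurableSpace Y] (ν : Measure Y) [IsProbabilityMeasure ν]
    (p : ℝ≥0∞) [hp : Fact (1 ≤ p)] (s : Set Y) : Lp ℝ p ν →L[ℝ] ℝ :=
  LinearMap.mkContinuous
    { toFun := fun F => ∫ x in s, F x ∂ν
      map_add' := fun F G => by
        rw [← integral_add (integrable_Lp F).integrableOn (integrable_Lp G).integrableOn]
        exact integral_congr_ae (ae_restrict_of_ae (Lp.coeFn_add F G))
      map_smul' := fun c F => by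
        rw [RingHom.id_apply, ← integral_smul]
        exact integral_congr_ae (ae_restrict_of_ae (Lp.coeFn_smul c F)) } 1
    (fun F => by
      rw [one_mul]
      have h1 : ‖∫ x in s, F x ∂ν‖ ≤ ∫ x, ‖F x‖ ∂ν :=
        (norm_integral_le_integral_norm _).trans
          (setIntegral_le_integral (integrable_Lp F).norm (ae_of_all _ fun _ => norm_nonneg _))
      refine h1.trans ?_
      rw [integral_norm_eq_lintegral_enorm (integrable_Lp F).1, ← eLpNorm_one_eq_lintegral_enorm,
        Lp.norm_def]
      exact ENNReal.toReal_mono (Lp.eLpNorm_ne_top F)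
        (eLpNorm_le_eLpNorm_of_exponent_le hp.out (Lp.aestronglyMeasurable F)))

lemma setInt_apply {Y : Type} [MeasurableSpace Y] (ν : Measure Y) [IsProbabilityMeasure ν]
    (p : ℝ≥0∞) [hp : Fact (1 ≤ p)] (s : Set Y) (F : Lp ℝ p ν) :
    setInt ν p s F = ∫ x in s, F x ∂ν := rfl

/-- Existence of the transfer operator on `L_p`. -/
lemma exists_transfer (μ : Measure X) [IsProbabilityMeasure μ] {T : X → X}
    (hT : MeasurePreserving T μ μ) (k : ℕ) {p : ℝ≥0∞} [hp : Fact (1 ≤ p)] (f : Lp ℝ p μ) :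
    ∃ g : Lp ℝ p μ, IsTransfer μ T k f g := by
  have hS := hT.iterate k
  set S := T^[k] with hSdef
  have hle := hS.measurable.comap_le
  have hsm : StronglyMeasurable[MeasurableSpace.comap S inferInstance]
    (μ[(f : X → ℝ) | MeasurableSpace.comap S inferInstance]) := stronglyMeasurable_condExp
  obtain ⟨h, hh, hhe⟩ := hsm.exists_eq_measurable_comp
  have hmem : MemLp (μ[(f : X → ℝ) | MeasurableSpace.comap S inferInstance]) p μ :=
    (Lp.memLp f).condExp hp.out
  have hhS : MemLp (h ∘ S) p μ := by rw [← hhe]; exact hmem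
  have hh' : MemLp h p μ := by
    have := (memLp_map_measure_iff (p := p) (μ := μ) (f := S) (g := h)
      (by rw [hS.map_eq]; exact hh.aestronglyMeasurable) hS.measurable.aemeasurable).2 hhS
    rwa [hS.map_eq] at this
  refine ⟨hh'.toLp h, fun s hs => ?_⟩
  rw [integral_congr_ae (ae_restrict_of_ae hh'.coeFn_toLp)]
  rw [← setIntegral_condExp hle (integrable_Lp f) ⟨s, hs, rfl⟩, hhe]
  conv_lhs => rw [← hS.map_eq]
  rw [setIntegral_map hs]
  · rfl
  · rw [hS.map_eq]; exact hh.aestronglyMeasurable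
  · exact hS.measurable.aemeasurable

/-- A function with the transfer-invariance property is invariant. -/
lemma invariant_of_transfer {Y : Type} [MeasurableSpace Y] (ν : Measure Y)
    [IsProbabilityMeasure ν] {S : Y → Y} (hS : MeasurePreserving S ν ν) {F : Y → ℝ}
    (hFm : Measurable F)
    (hF : Integrable F ν)
    (h : ∀ s, MeasurableSet s → ∫ x in s, F x ∂ν = ∫ x in S ⁻¹' s, F x ∂ν) :
    ∀ᵐ x ∂ν, F (S x) = F x := by
  -- level sets
  have key : ∀ c : ℚ, ∀ᵐ x ∂ν, ((c : ℝ) < F x ↔ (c : ℝ) < F (S x)) := by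
    intro c
    set A : Set Y := {x | (c : ℝ) < F x} with hA
    have hAm : MeasurableSet A := measurableSet_lt measurable_const hFm
    have hBm : MeasurableSet (S ⁻¹' A) := hS.measurable hAm
    set G : Y → ℝ := fun x => F x - c with hG
    have hGi : Integrable G ν := hF.sub (integrable_const _)
    have hmeas : ν.real (S ⁻¹' A) = ν.real A := by
      simp only [measureReal_def]; rw [hS.measure_preimage hAm.nullMeasurableSet]
    have heq : ∫ x in A, G x ∂ν = ∫ x in S ⁻¹' A, G x ∂ν := by
      rw [hG, integral_sub hF.integrableOn (integrable_const _).integrableOn,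
        integral_sub hF.integrableOn (integrable_const _).integrableOn, h A hAm]
      simp [hmeas]
    -- split
    have e1 : ∫ x in A, G x ∂ν = ∫ x in A ∩ S ⁻¹' A, G x ∂ν + ∫ x in A \ S ⁻¹' A, G x ∂ν :=
      (integral_inter_add_sdiff hBm hGi.integrableOn).symm
    have e2 : ∫ x in S ⁻¹' A, G x ∂ν
        = ∫ x in S ⁻¹' A ∩ A, G x ∂ν + ∫ x in S ⁻¹' A \ A, G x ∂ν :=
      (integral_inter_add_sdiff hAm hGi.integrableOn).symm
    rw [Set.inter_comm] at e2
    have e3 : ∫ x in S ⁻¹' A \ A, G x ∂ν ≤ 0 := by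
      refine setIntegral_nonpos (hBm.diff hAm) fun x hx => ?_
      have : ¬ ((c : ℝ) < F x) := hx.2
      simp only [hG]; linarith
    have e4 : 0 ≤ ∫ x in A \ S ⁻¹' A, G x ∂ν := by
      refine setIntegral_nonneg (hAm.diff hBm) fun x hx => ?_
      have : (c : ℝ) < F x := hx.1
      simp only [hG]; linarith
    have e5 : ∫ x in A \ S ⁻¹' A, G x ∂ν = 0 := by linarith
    have z1 : ν (A \ S ⁻¹' A) = 0 := by
      rw [setIntegral_eq_zero_iff_of_nonneg_ae ?_ hGi.integrableOn] at e5
      · by_contra hne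
        have hfr := (ae_restrict_iff' (hAm.diff hBm)).1 e5
        refine hne (measure_mono_null ?_ hfr)
        intro x hx
        simp only [Set.mem_compl_iff, Set.mem_ofPred_eq, not_forall]
        refine ⟨hx, ?_⟩
        have : (c : ℝ) < F x := hx.1
        simp only [hG, Pi.zero_apply]; linarith
      · refine (ae_restrict_iff' (hAm.diff hBm)).2 (ae_of_all _ fun x hx => ?_)
        have : (c : ℝ) < F x := hx.1
        simp only [hG, Pi.zero_apply]; linarith
    have z2 : ν (S ⁻¹' A \ A) = 0 := by
      have a1 := measure_inter_add_sdiff (μ := ν) A hBm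
      have a2 := measure_inter_add_sdiff (μ := ν) (S ⁻¹' A) hAm
      rw [z1, add_zero] at a1
      rw [Set.inter_comm, a1, hS.measure_preimage hAm.nullMeasurableSet] at a2
      have : ν A ≠ ⊤ := measure_ne_top _ _
      exact (ENNReal.add_right_inj this).1 (by rw [a2, add_zero])
    have z1' : ∀ᵐ x ∂ν, x ∉ A \ S ⁻¹' A := measure_eq_zero_iff_ae_notMem.1 z1
    have z2' : ∀ᵐ x ∂ν, x ∉ S ⁻¹' A \ A := measure_eq_zero_iff_ae_notMem.1 z2
    filter_upwards [z1', z2'] with x h1 h2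
    have h1' : ¬ ((c : ℝ) < F x ∧ ¬ (c : ℝ) < F (S x)) := h1
    have h2' : ¬ ((c : ℝ) < F (S x) ∧ ¬ (c : ℝ) < F x) := h2
    tauto
  filter_upwards [ae_all_iff.2 key] with x hx
  rcases lt_trichotomy (F (S x)) (F x) with h1 | h1 | h1
  · obtain ⟨q, hq1, hq2⟩ := exists_rat_btwn h1
    exact absurd ((hx q).1 hq2) (not_lt.2 hq1.le)
  · exact h1
  · obtain ⟨q, hq1, hq2⟩ := exists_rat_btwn h1
    exact absurd ((hx q).2 hq2) (not_lt.2 hq1.le)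

/-- Equality of set integrals extends from boxes to all measurable sets. -/
lemma box_ext {Y : Type} [MeasurableSpace Y] (μ : Measure X) [IsProbabilityMeasure μ] {m : ℕ}
    (ν : Measure Y) {S : Y → Fin m → X} (hS : Measurable S)
    {F : (Fin m → X) → ℝ} {G : Y → ℝ} (hF : Integrable F (pm μ m)) (hG : Integrable G ν)
    (h : ∀ s : Fin m → Set X, (∀ i, MeasurableSet (s i)) →
      ∫ x in Set.pi Set.univ s, F x ∂(pm μ m) = ∫ y in S ⁻¹' (Set.pi Set.univ s), G y ∂ν) :
    ∀ s, MeasurableSet s → ∫ x in s, F x ∂(pm μ m) = ∫ y in S ⁻¹' s, G y ∂ν := by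
  have huniv : ∫ x, F x ∂(pm μ m) = ∫ y, G y ∂ν := by
    have := h (fun _ => Set.univ) (fun _ => MeasurableSet.univ)
    simpa using this
  intro s hs
  induction s, hs using MeasurableSpace.induction_on_inter (generateFrom_pi (α := fun _ : Fin m => X)).symm
    (isPiSystem_pi (α := fun _ : Fin m => X)) with
  | empty => simp
  | basic t ht =>
    obtain ⟨u, hu, rfl⟩ := ht
    exact h u (fun i => hu i (Set.mem_univ i))
  | compl t ht ih =>
    have e1 := integral_add_compl ht hF
    have e2 := integral_add_compl (hS ht) hG
    rw [Set.preimage_compl]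
    linarith
  | iUnion t hd ht ih =>
    rw [Set.preimage_iUnion, integral_iUnion ht hd hF.integrableOn,
      integral_iUnion (fun i => hS (ht i)) (fun i j hij => (hd hij).preimage S) hG.integrableOn]
    exact tsum_congr ih

lemma measurePreserving_update (μ : Measure X) [IsProbabilityMeasure μ] {m : ℕ} (l : Fin m) :
    MeasurePreserving (fun z : (Fin m → X) × X => Function.update z.1 l z.2)
      ((pm μ m).prod μ) (pm μ m) := by
  have hmeas : Measurable (fun z : (Fin m → X) × X => Function.update z.1 l z.2) := by
    refine measurable_pi_lambda _ fun i => ?_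
    by_cases hi : i = l
    · subst hi; simpa using measurable_snd
    · simp only [Function.update_of_ne hi]
      exact (measurable_pi_apply i).comp measurable_fst
  refine ⟨hmeas, ?_⟩
  refine (Measure.pi_eq fun s hs => ?_).symm
  rw [Measure.map_apply hmeas (MeasurableSet.univ_pi hs)]
  have : (fun z : (Fin m → X) × X => Function.update z.1 l z.2) ⁻¹' (Set.univ.pi s)
      = (Set.univ.pi (Function.update s l Set.univ)) ×ˢ (s l) := by
    ext ⟨x, y⟩
    simp only [Set.mem_preimage, Set.mem_univ_pi, Set.mem_prod]
    constructor
    · intro h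
      refine ⟨fun i => ?_, by simpa using h l⟩
      by_cases hi : i = l
      · subst hi; simp
      · simpa [Function.update_of_ne hi] using h i
    · rintro ⟨h1, h2⟩ i
      by_cases hi : i = l
      · subst hi; simpa using h2
      · simpa [Function.update_of_ne hi] using h1 i
  rw [this, Measure.prod_prod, Measure.pi_pi, ← Finset.mul_prod_erase _ _ (Finset.mem_univ l),
    ← Finset.mul_prod_erase _ (fun i => μ (s i)) (Finset.mem_univ l)]
  rw [Finset.prod_congr rfl (g := fun i => μ (s i)) (fun i hi => by
    rw [Function.update_of_ne (Finset.ne_of_mem_erase hi)])]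
  simp [mul_comm]

/-- Canonicity in terms of integrals over boxes. -/
lemma canonical_iff (μ : Measure X) [IsProbabilityMeasure μ] {m : ℕ}
    {F : (Fin m → X) → ℝ} (hF : Integrable F (pm μ m)) :
    Canonical μ m F ↔ ∀ (l : Fin m) (s : Fin m → Set X), (∀ i, MeasurableSet (s i)) →
      s l = Set.univ → ∫ x in Set.pi Set.univ s, F x ∂(pm μ m) = 0 := by
  have hIntU : ∀ l : Fin m, Integrable (fun z : (Fin m → X) × X => F (Function.update z.1 l z.2))
      ((pm μ m).prod μ) := fun l =>
    ((measurePreserving_update μ l).integrable_comp hF.1).2 hF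
  -- integral over a box of a function, disintegrated
  have dis : ∀ (G : (Fin m → X) → ℝ) (_ : Integrable G (pm μ m)) (l : Fin m)
      (s : Fin m → Set X) (_ : ∀ i, MeasurableSet (s i)),
      ∫ x in Set.pi Set.univ s, G x ∂(pm μ m) =
        ∫ x in Set.pi Set.univ (Function.update s l Set.univ),
          ∫ y in s l, G (Function.update x l y) ∂μ ∂(pm μ m) := by
    intro G hG l s hs
    have hmp := measurePreserving_update μ l
    have hb := MeasurableSet.univ_pi hs
    conv_lhs => rw [← hmp.map_eq]
    rw [setIntegral_map hb (by rw [hmp.map_eq]; exact hG.1) hmp.measurable.aemeasurable]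
    have : (fun z : (Fin m → X) × X => Function.update z.1 l z.2) ⁻¹' (Set.univ.pi s)
        = (Set.univ.pi (Function.update s l Set.univ)) ×ˢ (s l) := by
      ext ⟨x, y⟩
      simp only [Set.mem_preimage, Set.mem_univ_pi, Set.mem_prod]
      constructor
      · intro h
        refine ⟨fun i => ?_, by simpa using h l⟩
        by_cases hi : i = l
        · subst hi; simp
        · simpa [Function.update_of_ne hi] using h i
      · rintro ⟨h1, h2⟩ i
        by_cases hi : i = l
        · subst hi; simpa using h2
        · simpa [Function.update_of_ne hi] using h1 i
    rw [this, setIntegral_prod]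
    exact ((hmp.integrable_comp hG.1).2 hG).integrableOn
  constructor
  · intro hc l s hs hl
    rw [dis F hF l s hs, hl]
    simp only [Measure.restrict_univ]
    rw [integral_congr_ae (ae_restrict_of_ae (hc l))]
    simp
  · intro h l
    set Φ : (Fin m → X) → ℝ := fun x => ∫ y, F (Function.update x l y) ∂μ with hΦ
    have hΦi : Integrable Φ (pm μ m) := (hIntU l).integral_prod_left
    have hbox : ∀ s : Fin m → Set X, (∀ i, MeasurableSet (s i)) →
        ∫ x in Set.pi Set.univ s, Φ x ∂(pm μ m) = 0 := by
      intro s hs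
      rw [dis Φ hΦi l s hs]
      have e : ∀ x, ∫ y in s l, Φ (Function.update x l y) ∂μ = μ.real (s l) * Φ x := by
        intro x
        simp [hΦ, Function.update_idem]
      simp_rw [e]
      rw [integral_const_mul]
      have hs' : ∀ i, MeasurableSet (Function.update s l Set.univ i) := by
        intro i
        by_cases hi : i = l
        · subst hi; simp
        · simpa [Function.update_of_ne hi] using hs i
      have h2 := h l (Function.update s l Set.univ) hs' (by simp)
      rw [dis F hF l _ hs'] at h2
      simp only [Function.update_self, Function.update_idem, Measure.restrict_univ] at h2
      rw [h2, mul_zero]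
    have hall := box_ext μ (pm μ m) measurable_id hΦi (integrable_zero (Fin m → X) ℝ _)
      (fun s hs => by simpa using hbox s hs)
    exact hΦi.ae_eq_zero_of_forall_setIntegral_eq_zero (fun s hs _ => by simpa using hall s hs)

end Analytic

section Tensor

set_option linter.unusedSectionVars false

variable {X : Type} [MeasurableSpace X]
    {μ : Measure X} [IsProbabilityMeasure μ]
    {m : ℕ} {p : ℝ≥0∞} [Fact (1 ≤ p)]
    {T : X → X}
    {E : Type} [NormedAddCommGroup E] [NormedSpace ℝ E] [CompleteSpace E]
    {tp : ContinuousMultilinearMap ℝ (fun _ : Fin m => Lp ℝ p μ) E}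
    {J : E →L[ℝ] Lp ℝ p (pm μ m)}
    {WK WT : (Fin m → ℕ) → E →L[ℝ] E}

lemma mul_app {E : Type} [NormedAddCommGroup E] [NormedSpace ℝ E] (A B : E →L[ℝ] E) (x : E) :
    (A * B) x = A (B x) := rfl

lemma ext_tp (hE : IsPTP μ (fun _ : Fin m => p) E tp)
    {F : Type} [NormedAddCommGroup F] [NormedSpace ℝ F] {A B : E →L[ℝ] F}
    (h : ∀ f, A (tp f) = B (tp f)) : A = B := by
  refine ContinuousLinearMap.ext_on hE.denseSpan ?_
  rintro _ ⟨f, rfl⟩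
  exact h f

/-- Integration of `J h` over a box. -/
def boxInt (J : E →L[ℝ] Lp ℝ p (pm μ m)) (s : Fin m → Set X) : E →L[ℝ] ℝ :=
  (setInt (pm μ m) p (Set.pi Set.univ s)).comp J

lemma boxInt_apply (s : Fin m → Set X) (h : E) :
    boxInt J s h = ∫ x in Set.pi Set.univ s, (J h : (Fin m → X) → ℝ) x ∂(pm μ m) := rfl

lemma boxInt_tp (hJ : IsEmbed μ (fun _ : Fin m => p) p tp J) (s : Fin m → Set X)
    (f : Fin m → Lp ℝ p μ) :
    boxInt J s (tp f) = ∏ i, ∫ x in s i, (f i : X → ℝ) x ∂μ := by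
  rw [boxInt_apply, integral_congr_ae (ae_restrict_of_ae (hJ f)), pm, Measure.restrict_pi_pi]
  exact integral_fintype_prod_eq_prod (fun i => (f i : X → ℝ))

lemma boxInt_WT (hT : MeasurePreserving T μ μ)
    (hE : IsPTP μ (fun _ : Fin m => p) E tp)
    (hJ : IsEmbed μ (fun _ : Fin m => p) p tp J)
    (hWT : ∀ k, IsTTrans μ (fun _ : Fin m => p) tp (fun _ => T) k (WT k))
    (k : Fin m → ℕ) (s : Fin m → Set X) (hs : ∀ i, MeasurableSet (s i)) (h : E) :
    boxInt J s (WT k h) = boxInt J (fun i => T^[k i] ⁻¹' (s i)) h := by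
  have : (boxInt J s).comp (WT k) = boxInt J (fun i => T^[k i] ⁻¹' (s i)) := by
    refine ext_tp hE fun f => ?_
    choose g hg using fun i => exists_transfer μ hT (k i) (f i)
    rw [ContinuousLinearMap.comp_apply, hWT k f g hg, boxInt_tp hJ, boxInt_tp hJ]
    exact Finset.prod_congr rfl fun i _ => hg i (s i) (hs i)
  rw [← this]; rfl

lemma canonical_iff_boxInt (h : E) : Canonical μ m (J h : (Fin m → X) → ℝ) ↔
    ∀ (l : Fin m) (s : Fin m → Set X), (∀ i, MeasurableSet (s i)) →
      s l = Set.univ → boxInt J s h = 0 :=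
  canonical_iff μ (integrable_Lp (J h))

lemma canonical_WT (hT : MeasurePreserving T μ μ)
    (hE : IsPTP μ (fun _ : Fin m => p) E tp)
    (hJ : IsEmbed μ (fun _ : Fin m => p) p tp J)
    (hWT : ∀ k, IsTTrans μ (fun _ : Fin m => p) tp (fun _ => T) k (WT k))
    (k : Fin m → ℕ) {h : E} (hh : Canonical μ m (J h : (Fin m → X) → ℝ)) :
    Canonical μ m (J (WT k h) : (Fin m → X) → ℝ) := by
  rw [canonical_iff_boxInt] at hh ⊢
  intro l s hs hl
  rw [boxInt_WT hT hE hJ hWT k s hs]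
  refine hh l _ (fun i => (hT.iterate (k i)).measurable (hs i)) ?_
  simp [hl]

lemma WT_zero (hE : IsPTP μ (fun _ : Fin m => p) E tp)
    (hWT : ∀ k, IsTTrans μ (fun _ : Fin m => p) tp (fun _ => T) k (WT k)) : WT 0 = 1 := by
  refine ext_tp hE fun f => ?_
  rw [hWT 0 f f fun i s hs => by simp]; rfl

lemma WT_mul (hT : MeasurePreserving T μ μ) (hE : IsPTP μ (fun _ : Fin m => p) E tp)
    (hWT : ∀ k, IsTTrans μ (fun _ : Fin m => p) tp (fun _ => T) k (WT k)) (k j : Fin m → ℕ) :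
    WT k * WT j = WT (k + j) := by
  refine ext_tp hE fun f => ?_
  choose g hg using fun i => exists_transfer μ hT (j i) (f i)
  choose h hh using fun i => exists_transfer μ hT (k i) (g i)
  rw [mul_app, hWT j f g hg, hWT k g h hh, hWT (k + j) f h]
  intro i s hs
  rw [hh i s hs, hg i _ ((hT.iterate (k i)).measurable hs), ← Set.preimage_comp,
    ← Function.iterate_add]
  rfl

lemma exists_koop (hT : MeasurePreserving T μ μ) (k : ℕ) (f : Lp ℝ p μ) :
    ∃ g : Lp ℝ p μ, (g : X → ℝ) =ᵐ[μ] fun x => (f : X → ℝ) (T^[k] x) :=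
  ⟨Lp.compMeasurePreserving _ (hT.iterate k) f, Lp.coeFn_compMeasurePreserving f (hT.iterate k)⟩

lemma WK_mul (hT : MeasurePreserving T μ μ) (hE : IsPTP μ (fun _ : Fin m => p) E tp)
    (hWK : ∀ k, IsTKoop μ (fun _ : Fin m => p) tp (fun _ => T) k (WK k)) (k j : Fin m → ℕ) :
    WK k * WK j = WK (k + j) := by
  refine ext_tp hE fun f => ?_
  choose g hg using fun i => exists_koop hT (j i) (f i)
  choose h hh using fun i => exists_koop hT (k i) (g i)
  rw [mul_app, hWK j f g hg, hWK k g h hh, hWK (k + j) f h]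
  intro i
  have h1 := (hT.iterate (k i)).quasiMeasurePreserving.ae_eq_comp (hg i)
  refine (hh i).trans (h1.trans (ae_of_all _ fun x => ?_))
  simp only [Function.comp, Pi.add_apply]
  rw [add_comm (k i), Function.iterate_add_apply]

lemma transfer_koop (hT : MeasurePreserving T μ μ) (k : ℕ) {f g : Lp ℝ p μ}
    (h : (g : X → ℝ) =ᵐ[μ] fun x => (f : X → ℝ) (T^[k] x)) : IsTransfer μ T k g f := by
  intro s hs
  have hS := hT.iterate k
  rw [integral_congr_ae (ae_restrict_of_ae h)]
  have hf := Lp.aestronglyMeasurable f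
  generalize (f : X → ℝ) = F at hf ⊢
  conv_lhs => rw [← hS.map_eq]
  rw [setIntegral_map hs _ hS.measurable.aemeasurable]
  rw [hS.map_eq]; exact hf

lemma WT_WK (hT : MeasurePreserving T μ μ) (hE : IsPTP μ (fun _ : Fin m => p) E tp)
    (hWK : ∀ k, IsTKoop μ (fun _ : Fin m => p) tp (fun _ => T) k (WK k))
    (hWT : ∀ k, IsTTrans μ (fun _ : Fin m => p) tp (fun _ => T) k (WT k)) (k : Fin m → ℕ) :
    WT k * WK k = 1 := by
  refine ext_tp hE fun f => ?_
  choose g hg using fun i => exists_koop hT (k i) (f i)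
  rw [mul_app, hWK k f g hg, hWT k g f fun i => transfer_koop hT (k i) (hg i)]
  rfl

lemma WT_WK_comm (hT : MeasurePreserving T μ μ) (hE : IsPTP μ (fun _ : Fin m => p) E tp)
    (hWK : ∀ k, IsTKoop μ (fun _ : Fin m => p) tp (fun _ => T) k (WK k))
    (hWT : ∀ k, IsTTrans μ (fun _ : Fin m => p) tp (fun _ => T) k (WT k)) {k j : Fin m → ℕ}
    (hkj : ∀ i, k i = 0 ∨ j i = 0) :
    WT k * WK j = WK j * WT k := by
  refine ext_tp hE fun f => ?_
  choose g hg using fun i => exists_koop hT (j i) (f i)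
  choose h hh using fun i => exists_transfer μ hT (k i) (f i)
  have key : ∀ i, ∃ u : Lp ℝ p μ, IsTransfer μ T (k i) (g i) u ∧
      ((u : X → ℝ) =ᵐ[μ] fun x => (h i : X → ℝ) (T^[j i] x)) := by
    intro i
    rcases hkj i with h0 | h0
    · have e : h i = f i := by
        refine Lp.ext ((integrable_Lp (h i)).ae_eq_of_forall_setIntegral_eq _ _ (integrable_Lp (f i))
          fun s hs _ => ?_)
        have := hh i s hs
        rw [h0] at this
        simpa using this
      refine ⟨g i, fun s hs => by rw [h0]; simp, ?_⟩
      rw [e]; exact hg i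
    · have e : g i = f i := by
        refine Lp.ext ((hg i).trans ?_)
        rw [h0]; rfl
      refine ⟨h i, by rw [e]; exact hh i, ?_⟩
      rw [h0]; rfl
  choose u hu1 hu2 using key
  rw [mul_app, mul_app, hWK j f g hg,
    hWT k f h hh, hWT k g u hu1, hWK j h u hu2]

lemma measurePreserving_coord (hT : MeasurePreserving T μ μ) (k : Fin m → ℕ) :
    MeasurePreserving (fun (x : Fin m → X) i => T^[k i] (x i)) (pm μ m) (pm μ m) :=
  measurePreserving_pi (fun _ => μ) (fun _ => μ) fun i => hT.iterate (k i)

lemma J_WK (hT : MeasurePreserving T μ μ) (hE : IsPTP μ (fun _ : Fin m => p) E tp)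
    (hJ : IsEmbed μ (fun _ : Fin m => p) p tp J)
    (hWK : ∀ k, IsTKoop μ (fun _ : Fin m => p) tp (fun _ => T) k (WK k)) (k : Fin m → ℕ) (h : E) :
    J (WK k h) = Lp.compMeasurePreserving _ (measurePreserving_coord hT k) (J h) := by
  have : J.comp (WK k) = (Lp.compMeasurePreservingₗᵢ ℝ _
      (measurePreserving_coord hT k)).toContinuousLinearMap.comp J := by
    refine ext_tp hE fun f => ?_
    choose g hg using fun i => exists_koop hT (k i) (f i)
    rw [ContinuousLinearMap.comp_apply, hWK k f g hg]
    refine Lp.ext ((hJ g).trans ?_)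
    refine EventuallyEq.trans ?_ (Lp.coeFn_compMeasurePreserving (J (tp f))
      (measurePreserving_coord hT k)).symm
    refine EventuallyEq.trans ?_ ((measurePreserving_coord hT k).quasiMeasurePreserving.ae_eq_comp
      (hJ f)).symm
    have : ∀ᵐ x ∂(pm μ m), ∀ i, (g i : X → ℝ) (x i) = (f i : X → ℝ) (T^[k i] (x i)) :=
      ae_all_iff.2 fun i => (Measure.tendsto_eval_ae_ae (μ := fun _ : Fin m => μ) (i := i)).eventually (hg i)
    filter_upwards [this] with x hx
    exact Finset.prod_congr rfl fun i _ => hx i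
  exact congrArg (fun A : E →L[ℝ] Lp ℝ p (pm μ m) => A h) this

end Tensor

section Averaging

set_option linter.unusedSectionVars false

variable {X : Type} [MeasurableSpace X]
    {μ : Measure X} [IsProbabilityMeasure μ]
    {m : ℕ} {p : ℝ≥0∞} [Fact (1 ≤ p)]
    {T : X → X}
    {E : Type} [NormedAddCommGroup E] [NormedSpace ℝ E] [CompleteSpace E]
    {tp : ContinuousMultilinearMap ℝ (fun _ : Fin m => Lp ℝ p μ) E}
    {J : E →L[ℝ] Lp ℝ p (pm μ m)}
    {WK WT : (Fin m → ℕ) → E →L[ℝ] E}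

/-- The indicator of a cell of the partition defined by `q`. -/
def cellInd (μ : Measure X) [IsProbabilityMeasure μ] (p : ℝ≥0∞) {β : Type} (q : SimpleFunc X β)
    (c : β) : Lp ℝ p μ :=
  indicatorConstLp p (q.measurableSet_fiber c) (measure_ne_top μ _) (1 : ℝ)

/-- The averaging operator over the cells of the partition defined by `q`. -/
def avg (μ : Measure X) [IsProbabilityMeasure μ] (p : ℝ≥0∞) [Fact (1 ≤ p)] {β : Type}
    (q : SimpleFunc X β) : Lp ℝ p μ →L[ℝ] Lp ℝ p μ :=
  ∑ c ∈ q.range, ((μ.real (q ⁻¹' {c}))⁻¹ • setInt μ p (q ⁻¹' {c})).smulRight (cellInd μ p q c)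

lemma avg_apply {β : Type} (q : SimpleFunc X β) (f : Lp ℝ p μ) :
    avg μ p q f = ∑ c ∈ q.range,
      ((μ.real (q ⁻¹' {c}))⁻¹ * ∫ x in q ⁻¹' {c}, f x ∂μ) • cellInd μ p q c := by
  simp only [avg, sum_apply, ContinuousLinearMap.smulRight_apply,
    smul_apply, setInt_apply, smul_eq_mul]

lemma avg_coe {β : Type} (q : SimpleFunc X β) (f : Lp ℝ p μ) :
    (avg μ p q f : X → ℝ) =ᵐ[μ] fun x =>
      (μ.real (q ⁻¹' {q x}))⁻¹ * ∫ y in q ⁻¹' {q x}, f y ∂μ := by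
  rw [avg_apply]
  refine (Lp.coeFn_finsetSum _ _).trans ?_
  have h1 : ∀ᵐ x ∂μ, ∀ c : q.range,
      ((((μ.real (q ⁻¹' {c.1}))⁻¹ * ∫ x in q ⁻¹' {c.1}, f x ∂μ) • cellInd μ p q c.1 : Lp ℝ p μ)
        : X → ℝ) x = ((μ.real (q ⁻¹' {c.1}))⁻¹ * ∫ x in q ⁻¹' {c.1}, f x ∂μ) *
          (q ⁻¹' {c.1}).indicator (fun _ => (1 : ℝ)) x := by
    refine ae_all_iff.2 fun c => ?_
    filter_upwards [Lp.coeFn_smul ((μ.real (q ⁻¹' {c.1}))⁻¹ * ∫ x in q ⁻¹' {c.1}, f x ∂μ)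
      (cellInd μ p q c.1), indicatorConstLp_coeFn (p := p) (hs := q.measurableSet_fiber c.1)
        (hμs := measure_ne_top μ _) (c := (1 : ℝ))] with x hx1 hx2
    rw [hx1, Pi.smul_apply, smul_eq_mul, cellInd, hx2]
  filter_upwards [h1] with x hx
  rw [Finset.sum_apply, Finset.sum_congr (g := fun c => ((μ.real (q ⁻¹' {c}))⁻¹ * ∫ x in q ⁻¹' {c}, f x ∂μ) *
    (q ⁻¹' {c}).indicator (fun _ => (1 : ℝ)) x) rfl (fun c hc => hx ⟨c, hc⟩)]
  rw [Finset.sum_eq_single (q x)]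
  · simp
  · intro c _ hne
    have : x ∉ q ⁻¹' {c} := fun h => hne (by simpa using h.symm)
    simp [this]
  · intro h
    exact absurd (q.mem_range_self x) h

lemma comap_simple_le {β : Type} (q : SimpleFunc X β) :
    MeasurableSpace.comap q ⊤ ≤ (inferInstance : MeasurableSpace X) := by
  rintro s ⟨t, _, rfl⟩
  exact q.measurableSet_preimage t

lemma avg_condExp {β : Type} (q : SimpleFunc X β) (f : Lp ℝ p μ) :
    (avg μ p q f : X → ℝ) =ᵐ[μ] μ[(f : X → ℝ) | MeasurableSpace.comap q ⊤] := by
  classical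
  refine ae_eq_condExp_of_forall_setIntegral_eq (comap_simple_le q) (integrable_Lp f)
    (fun s _ _ => (integrable_Lp _).integrableOn) ?_ ?_
  · rintro s ⟨t, _, rfl⟩ _
    have hset : q ⁻¹' t = ⋃ c ∈ q.range.filter (· ∈ t), q ⁻¹' {c} := by
      ext x
      simp
    have hd : Set.Pairwise (↑(q.range.filter (· ∈ t))) (Function.onFun Disjoint fun c => q ⁻¹' {c}) := by
      intro a _ b _ hab
      exact (Set.disjoint_singleton.2 hab).preimage q
    rw [hset, integral_biUnion_finset _ (fun c _ => q.measurableSet_fiber c) hd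
        (fun c _ => (integrable_Lp _).integrableOn),
      integral_biUnion_finset _ (fun c _ => q.measurableSet_fiber c) hd
        (fun c _ => (integrable_Lp _).integrableOn)]
    refine Finset.sum_congr rfl fun c _ => ?_
    rw [integral_congr_ae (ae_restrict_of_ae (avg_coe q f))]
    rw [setIntegral_congr_fun (g := fun _ => (μ.real (q ⁻¹' {c}))⁻¹ * ∫ y in q ⁻¹' {c}, f y ∂μ)
      (q.measurableSet_fiber c)]
    · by_cases h0 : μ (q ⁻¹' {c}) = 0
      · rw [Measure.restrict_eq_zero.2 h0]; simp
      · have h1 : μ.real (q ⁻¹' {c}) ≠ 0 := by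
          simp [measureReal_def, ENNReal.toReal_eq_zero_iff, h0]
        simp [h1]
    · intro x hx
      have : q x = c := hx
      simp only [this]
  · have hm : StronglyMeasurable[MeasurableSpace.comap q ⊤] (fun x =>
      (μ.real (q ⁻¹' {q x}))⁻¹ * ∫ y in q ⁻¹' {q x}, f y ∂μ) := by
      refine @Measurable.stronglyMeasurable _ _ _ (MeasurableSpace.comap q ⊤) _ _ _ _ _ ?_
      intro s _
      exact ⟨(fun c => (μ.real (q ⁻¹' {c}))⁻¹ * ∫ y in q ⁻¹' {c}, f y ∂μ) ⁻¹' s, trivial, rfl⟩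
    exact ⟨_, hm, avg_coe q f⟩

lemma norm_avg_le {β : Type} (q : SimpleFunc X β) (f : Lp ℝ p μ) : ‖avg μ p q f‖ ≤ ‖f‖ := by
  rw [Lp.norm_def, Lp.norm_def]
  refine ENNReal.toReal_mono (Lp.eLpNorm_ne_top f) ?_
  rw [eLpNorm_congr_ae (avg_condExp q f)]
  exact eLpNorm_condExp_le_eLpNorm _ Fact.out

lemma avg_eq_self {β : Type} (q : SimpleFunc X β) (f : Lp ℝ p μ) (u : β → ℝ)
    (hu : (f : X → ℝ) =ᵐ[μ] fun x => u (q x)) : avg μ p q f = f := by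
  refine Lp.ext ((avg_condExp q f).trans ?_)
  refine condExp_of_aestronglyMeasurable' (comap_simple_le q) ⟨fun x => u (q x), ?_, hu⟩
    (integrable_Lp f)
  refine @Measurable.stronglyMeasurable _ _ _ (MeasurableSpace.comap q ⊤) _ _ _ _ _ ?_
  intro s _
  exact ⟨u ⁻¹' s, trivial, rfl⟩

/-- The tensor power of the averaging operator, expressed through box integrals. -/
def tavg (tp : ContinuousMultilinearMap ℝ (fun _ : Fin m => Lp ℝ p μ) E)
    (J : E →L[ℝ] Lp ℝ p (pm μ m)) {β : Type} (q : SimpleFunc X β) : E →L[ℝ] E :=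
  ∑ c ∈ Fintype.piFinset (fun _ : Fin m => q.range),
    ((∏ i, (μ.real (q ⁻¹' {c i}))⁻¹) • boxInt J (fun i => q ⁻¹' {c i})).smulRight
      (tp fun i => cellInd μ p q (c i))

lemma tavg_tp (hJ : IsEmbed μ (fun _ : Fin m => p) p tp J) {β : Type} (q : SimpleFunc X β)
    (f : Fin m → Lp ℝ p μ) : tavg tp J q (tp f) = tp (fun i => avg μ p q (f i)) := by
  classical
  simp_rw [avg_apply]
  rw [ContinuousMultilinearMap.map_sum_finset tp
    (fun i c => ((μ.real (q ⁻¹' {c}))⁻¹ * ∫ x in q ⁻¹' {c}, f i x ∂μ) • cellInd μ p q c)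
    (fun _ => q.range)]
  rw [tavg, sum_apply]
  refine Finset.sum_congr (by congr!) fun c _ => ?_
  rw [ContinuousMultilinearMap.map_smul_univ tp
    (fun i => ((μ.real (q ⁻¹' {c i}))⁻¹ * ∫ x in q ⁻¹' {c i}, f i x ∂μ))
    (fun i => cellInd μ p q (c i))]
  rw [ContinuousLinearMap.smulRight_apply, smul_apply, boxInt_tp hJ,
    smul_eq_mul, Finset.prod_mul_distrib]

lemma norm_tavg_le (hE : IsPTP μ (fun _ : Fin m => p) E tp)
    (hJ : IsEmbed μ (fun _ : Fin m => p) p tp J) {β : Type} (q : SimpleFunc X β) (h : E) :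
    ‖tavg tp J q h‖ ≤ ‖h‖ := by
  obtain ⟨L, hL, hn⟩ := hE.lift E (tp.compContinuousLinearMap fun _ => avg μ p q)
  have : tavg tp J q = L := by
    refine ext_tp hE fun f => ?_
    rw [tavg_tp hJ, hL]; rfl
  rw [this]
  have hb : ‖tp.compContinuousLinearMap fun _ => avg μ p q‖ ≤ 1 := by
    refine ContinuousMultilinearMap.opNorm_le_bound zero_le_one fun f => ?_
    rw [one_mul]
    refine (hE.crossNorm _).le.trans ?_
    exact Finset.prod_le_prod (fun _ _ => norm_nonneg _) fun i _ => norm_avg_le q (f i)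
  refine (L.le_opNorm h).trans ?_
  rw [hn]
  calc _ ≤ 1 * ‖h‖ := by gcongr
    _ = ‖h‖ := one_mul _

lemma dense_simple (μ : Measure X) [IsProbabilityMeasure μ] (p : ℝ≥0∞) [Fact (1 ≤ p)] :
    Dense {g : Lp ℝ p μ | ∃ φ : SimpleFunc X ℝ, (g : X → ℝ) =ᵐ[μ] φ} := by
  by_cases hp : p = ⊤
  · subst hp
    rw [Metric.dense_iff]
    intro f ε hε
    set δ := ε / 2 with hδ
    have hδ0 : 0 < δ := by positivity
    set C := ‖f‖ with hC
    have hC0 : 0 ≤ C := norm_nonneg _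
    have hfm : Measurable (f : X → ℝ) := (Lp.stronglyMeasurable f).measurable
    have hn : Measurable fun x => ⌊max (-C) (min C (f x)) / δ⌋ :=
      Int.measurable_floor.comp ((measurable_const.max (measurable_const.min hfm)).div_const δ)
    let n : SimpleFunc X ℤ :=
      { toFun := fun x => ⌊max (-C) (min C (f x)) / δ⌋
        measurableSet_fiber' := fun c => hn (measurableSet_singleton c)
        finite_range' := by
          refine (Set.finite_Icc ⌊-C / δ⌋ ⌊C / δ⌋).subset ?_
          rintro _ ⟨x, rfl⟩
          constructor
          · exact Int.floor_mono (by gcongr; exact le_max_left _ _)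
          · exact Int.floor_mono (by gcongr; exact max_le (by linarith) (min_le_left _ _)) }
    let φ : SimpleFunc X ℝ := n.map fun k : ℤ => (k : ℝ) * δ
    have hφ : MemLp φ ⊤ μ := φ.memLp_top μ
    refine ⟨hφ.toLp φ, ?_, φ, hφ.coeFn_toLp⟩
    rw [Metric.mem_ball, dist_comm, dist_eq_norm]
    refine lt_of_le_of_lt (b := δ) ?_ (by rw [hδ]; linarith)
    refine Lp.norm_le_of_ae_bound hδ0.le ?_ |>.trans ?_
    · have hb : ∀ᵐ x ∂μ, ‖f x‖ ≤ C := by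
        have := ae_le_eLpNormEssSup (f := (f : X → ℝ)) (μ := μ)
        filter_upwards [this] with x hx
        rw [hC, Lp.norm_def, eLpNorm_exponent_top, ← toReal_enorm]
        refine ENNReal.toReal_mono ?_ hx
        have := Lp.eLpNorm_ne_top f
        rwa [eLpNorm_exponent_top] at this
      filter_upwards [hb, hφ.coeFn_toLp, Lp.coeFn_sub f (hφ.toLp φ)] with x h1 h2 h3
      rw [h3, Pi.sub_apply, h2]
      rw [Real.norm_eq_abs, abs_le] at h1
      have e : φ x = (⌊f x / δ⌋ : ℝ) * δ := by
        change (⌊max (-C) (min C (f x)) / δ⌋ : ℝ) * δ = _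
        rw [min_eq_right h1.2, max_eq_right h1.1]
      rw [e, Real.norm_eq_abs, abs_le]
      have a1 := Int.floor_le (f x / δ)
      have a2 := Int.lt_floor_add_one (f x / δ)
      rw [le_div_iff₀ hδ0] at a1
      rw [div_lt_iff₀ hδ0] at a2
      constructor <;> nlinarith
    · simp
  · refine (Lp.simpleFunc.dense (E := ℝ) (μ := μ) hp).mono ?_
    intro g hg
    exact ⟨Lp.simpleFunc.toSimpleFunc ⟨g, hg⟩, (Lp.simpleFunc.toSimpleFunc_eq_toFun ⟨g, hg⟩).symm⟩

/-- The canonical map `J` is injective (approximation property of `L_p`). -/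
lemma eq_zero_of_boxInt (hE : IsPTP μ (fun _ : Fin m => p) E tp)
    (hJ : IsEmbed μ (fun _ : Fin m => p) p tp J) {h : E} (hh : ∀ s, boxInt J s h = 0) :
    h = 0 := by
  classical
  let N : Submodule ℝ E :=
    { carrier := {x | ∃ (β : Type) (q : SimpleFunc X β), ∀ (γ : Type) (q' : SimpleFunc X γ)
        (u : γ → β), (∀ x, q x = u (q' x)) → tavg tp J q' x = x}
      zero_mem' := ⟨Unit, SimpleFunc.const X (), fun γ q' u _ => map_zero _⟩
      add_mem' := by
        rintro a b ⟨β, q, hq⟩ ⟨β', r, hr⟩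
        refine ⟨β × β', q.pair r, fun γ q' u hu => ?_⟩
        rw [map_add, hq γ q' (fun c => (u c).1) (fun x => by rw [← hu x]; rfl),
          hr γ q' (fun c => (u c).2) (fun x => by rw [← hu x]; rfl)]
      smul_mem' := by
        rintro c a ⟨β, q, hq⟩
        refine ⟨β, q, fun γ q' u hu => ?_⟩
        rw [map_smul, hq γ q' u hu] }
  have hNtp : ∀ f : Fin m → Lp ℝ p μ, (∀ i, ∃ φ : SimpleFunc X ℝ, (f i : X → ℝ) =ᵐ[μ] φ) →
      tp f ∈ N := by
    intro f hf
    choose φ hφ using hf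
    let q : SimpleFunc X (Fin m → ℝ) :=
      { toFun := fun x i => φ i x
        measurableSet_fiber' := fun c =>
          (measurable_pi_lambda _ fun i => (φ i).measurable) (measurableSet_singleton c)
        finite_range' := by
          refine (Set.Finite.pi' (t := fun i => Set.range (φ i)) fun i => (φ i).finite_range).subset ?_
          rintro _ ⟨x, rfl⟩ i
          exact ⟨x, rfl⟩ }
    refine ⟨_, q, fun γ q' u hu => ?_⟩
    rw [tavg_tp hJ]
    congr 1
    funext i
    refine avg_eq_self q' (f i) (fun c => u c i) ((hφ i).trans (ae_of_all _ fun x => ?_))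
    exact congrFun (hu x) i
  have hN : ∀ x : E, x ∈ closure (N : Set E) := by
    have h1 : ∀ f : Fin m → Lp ℝ p μ, tp f ∈ closure (N : Set E) := by
      intro f
      have hd := dense_pi (Set.univ : Set (Fin m)) (fun i _ => dense_simple μ p)
      exact map_mem_closure tp.cont (hd f) fun g hg => hNtp g fun i => hg i (Set.mem_univ i)
    have h2 : Submodule.span ℝ (Set.range fun f : Fin m → Lp ℝ p μ => tp f)
        ≤ N.topologicalClosure := by
      rw [Submodule.span_le]
      rintro _ ⟨f, rfl⟩
      exact h1 f
    intro x
    have := closure_minimal (t := (N.topologicalClosure : Set E)) h2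
      N.isClosed_topologicalClosure (hE.denseSpan x)
    exact this
  by_contra hne
  have hpos : 0 < ‖h‖ := norm_pos_iff.2 hne
  obtain ⟨h', ⟨β, q, hq⟩, hd⟩ := Metric.mem_closure_iff.1 (hN h) (‖h‖ / 2) (by positivity)
  have e1 : tavg tp J q h' = h' := hq β q id (fun _ => rfl)
  have e2 : tavg tp J q h = 0 := by
    rw [tavg, sum_apply]
    refine Finset.sum_eq_zero fun c _ => ?_
    rw [ContinuousLinearMap.smulRight_apply, smul_apply, hh]
    simp
  have e3 := norm_tavg_le hE hJ q (h - h')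
  rw [map_sub, e1, e2, zero_sub, norm_neg] at e3
  rw [dist_eq_norm] at hd
  have e4 : ‖h‖ ≤ ‖h - h'‖ + ‖h'‖ := by simpa using norm_add_le (h - h') h'
  linarith

/-- Fixed vectors of the transfer operator are fixed by the Koopman operator. -/
lemma fix_step (hT : MeasurePreserving T μ μ) (hE : IsPTP μ (fun _ : Fin m => p) E tp)
    (hJ : IsEmbed μ (fun _ : Fin m => p) p tp J)
    (hWK : ∀ k, IsTKoop μ (fun _ : Fin m => p) tp (fun _ => T) k (WK k))
    (hWT : ∀ k, IsTTrans μ (fun _ : Fin m => p) tp (fun _ => T) k (WT k)) (k : Fin m → ℕ) {y : E}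
    (hy : WT k y = y) : WK k y = y := by
  have hS := measurePreserving_coord (m := m) hT k
  have hb := box_ext μ (pm μ m) hS.measurable (integrable_Lp (J y)) (integrable_Lp (J y))
    (fun s hs => by
      have := boxInt_WT hT hE hJ hWT k s hs y
      rw [hy] at this
      exact this)
  have hi := invariant_of_transfer (pm μ m) hS (Lp.stronglyMeasurable (J y)).measurable
    (integrable_Lp (J y)) hb
  have hJe : J (WK k y) = J y := by
    rw [J_WK hT hE hJ hWK]
    exact Lp.ext ((Lp.coeFn_compMeasurePreserving _ hS).trans hi)
  refine sub_eq_zero.1 (eq_zero_of_boxInt hE hJ fun s => ?_)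
  rw [boxInt, ContinuousLinearMap.comp_apply, map_sub, hJe, sub_self, map_zero]

end Averaging

section ListAlgebra

variable {A : Type} [Ring A] {ι : Type}

lemma list_prod_mul (L : List ι) (hL : L.Nodup) (a b : ι → A)
    (h : ∀ i j, i ≠ j → Commute (b i) (a j)) :
    (L.map a).prod * (L.map b).prod = (L.map fun i => a i * b i).prod := by
  induction L with
  | nil => simp
  | cons x L ih =>
    rw [List.nodup_cons] at hL
    simp only [List.map_cons, List.prod_cons]
    rw [← ih hL.2]
    have hc : Commute (b x) (L.map a).prod := by
      refine Commute.list_prod_right _ _ fun y hy => ?_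
      obtain ⟨j, hj, rfl⟩ := List.mem_map.1 hy
      exact h x j fun e => hL.1 (e ▸ hj)
    rw [mul_assoc, ← mul_assoc _ (b x), ← hc.eq]
    simp only [mul_assoc]

lemma sum_list_prod (m : ℕ) (a b : Fin m → A) :
    ∑ S : Finset (Fin m), ((List.finRange m).map fun l => if l ∈ S then a l else b l).prod
      = ((List.finRange m).map fun l => a l + b l).prod := by
  have := MultilinearMap.map_add_univ (MultilinearMap.mkPiAlgebraFin ℤ m A) a b
  simp only [MultilinearMap.mkPiAlgebraFin_apply, List.ofFn_eq_map] at this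
  rw [show (fun l => a l + b l) = a + b from rfl, this]
  refine Finset.sum_congr rfl fun S _ => ?_
  congr 2

end ListAlgebra

section Series

variable {m : ℕ} {E : Type} [NormedAddCommGroup E] [NormedSpace ℝ E]
    {WT : (Fin m → ℕ) → E →L[ℝ] E}

lemma series_step (hmul : ∀ k j, WT k * WT j = WT (k + j)) (f : E) (n : Fin m → ℕ) (a : Fin m) :
    ∑ k ∈ Fintype.piFinset (fun i => Finset.range ((n + Pi.single a 1 : Fin m → ℕ) i)), WT k f =
    (∑ k ∈ Fintype.piFinset (fun i => Finset.range (Function.update n a 1 i)), WT k f) +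
      WT (Pi.single a 1) (∑ k ∈ Fintype.piFinset (fun i => Finset.range (n i)), WT k f) := by
  classical
  rw [← Finset.sum_filter_add_sum_filter_not _ (fun k => k a = 0)]
  congr 1
  · refine Finset.sum_congr ?_ fun _ _ => rfl
    ext k
    simp only [Finset.mem_filter, Fintype.mem_piFinset, Finset.mem_range, Pi.add_apply]
    constructor
    · rintro ⟨h, h0⟩ i
      rcases eq_or_ne i a with rfl | hi
      · simp [h0]
      · have := h i
        simpa [hi] using this
    · intro h
      have ha := h a
      simp only [Function.update_self] at ha
      refine ⟨fun i => ?_, by omega⟩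
      rcases eq_or_ne i a with rfl | hi
      · simp; omega
      · have := h i
        simpa [hi] using this
  · rw [map_sum]
    symm
    refine Finset.sum_bij (fun k _ => Pi.single a 1 + k) ?_ ?_ ?_ ?_
    · intro k hk
      simp only [Finset.mem_filter, Fintype.mem_piFinset, Finset.mem_range, Pi.add_apply] at hk ⊢
      refine ⟨fun i => by have := hk i; omega, by simp⟩
    · intro k _ j _ h
      exact add_left_cancel h
    · intro k hk
      simp only [Finset.mem_filter, Fintype.mem_piFinset, Finset.mem_range, Pi.add_apply] at hk
      have h1 : Pi.single a 1 ≤ k := by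
        intro i
        rcases eq_or_ne i a with rfl | hi
        · have := hk.2
          simp; omega
        · simp [hi]
      refine ⟨k - Pi.single a 1, ?_, add_tsub_cancel_of_le h1⟩
      simp only [Fintype.mem_piFinset, Finset.mem_range, Pi.sub_apply]
      intro i
      have h2 := hk.1 i
      have h3 : (Pi.single a 1 : Fin m → ℕ) i ≤ k i := h1 i
      omega
    · intro k _
      rw [← hmul, mul_app]

lemma series_limit (hmul : ∀ k j, WT k * WT j = WT (k + j)) (f g : E)
    (hg : Tendsto (fun n : Fin m → ℕ =>
        ∑ k ∈ Fintype.piFinset (fun i => Finset.range (n i)), WT k f) atTop (𝓝 g))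
    (L : List (Fin m)) (hL : L.Nodup) :
    Tendsto (fun n : Fin m → ℕ =>
        ∑ k ∈ Fintype.piFinset (fun i => Finset.range (if i ∈ L then 1 else n i)), WT k f) atTop
      (𝓝 ((L.map fun l => 1 - WT (Pi.single l 1)).prod g)) := by
  classical
  induction L with
  | nil => simpa using hg
  | cons a L ih =>
    rw [List.nodup_cons] at hL
    have h0 := ih hL.2
    have hshift : Tendsto (fun n : Fin m → ℕ => n + Pi.single a 1) atTop atTop :=
      tendsto_atTop_mono (fun n => le_self_add) tendsto_id
    have h1 := h0.comp hshift
    have h2 := ((WT (Pi.single a 1)).continuous.tendsto _).comp h0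
    have h3 := h1.sub h2
    rw [List.map_cons, List.prod_cons, mul_app]
    refine (h3.congr fun n => ?_)
    simp only [Function.comp_apply]
    have hs := series_step hmul f (fun i => if i ∈ L then 1 else n i) a
    rw [sub_eq_iff_eq_add]
    convert hs using 2
    · ext k
      simp only [Fintype.mem_piFinset, Finset.mem_range, Pi.add_apply]
      refine forall_congr' fun i => ?_
      rcases eq_or_ne i a with rfl | hi
      · simp [hL.1]
      · simp [hi]
    · congr 1
      ext k
      simp only [Fintype.mem_piFinset, Finset.mem_range, List.mem_cons]
      refine forall_congr' fun i => ?_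
      rcases eq_or_ne i a with rfl | hi
      · simp
      · simp [hi]

lemma series_eq (hmul : ∀ k j, WT k * WT j = WT (k + j)) (h0 : WT 0 = 1) (f g : E)
    (hg : Tendsto (fun n : Fin m → ℕ =>
        ∑ k ∈ Fintype.piFinset (fun i => Finset.range (n i)), WT k f) atTop (𝓝 g)) :
    f = ((List.finRange m).map fun l => 1 - WT (Pi.single l 1)).prod g := by
  have := series_limit hmul f g hg (List.finRange m) (List.nodup_finRange m)
  refine tendsto_nhds_unique ?_ this
  refine tendsto_const_nhds.congr fun n => ?_
  simp only [List.mem_finRange, if_true, Finset.range_one]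
  rw [Fintype.piFinset_singleton (fun _ => 0), Finset.sum_singleton]
  change f = WT 0 f
  rw [h0]; rfl

/-- Replacing the factors `u` by the factors `c` in a product annihilating a vector. -/
lemma kill_step {ι : Type} (u c : ι → E →L[ℝ] E)
    (hk : ∀ i y, u i y = 0 → c i y = 0) (hc : ∀ i j, i ≠ j → Commute (c i) (u j))
    (hcc : ∀ i j, i ≠ j → Commute (c i) (c j)) (L : List ι) (hL : L.Nodup) (d : E)
    (hd : (L.map u).prod d = 0) : (L.map c).prod d = 0 := by
  induction L generalizing d with
  | nil => exact hd
  | cons a L ih =>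
    rw [List.nodup_cons] at hL
    rw [List.map_cons, List.prod_cons, mul_app] at hd ⊢
    have h1 := hk _ _ hd
    have hu : Commute (c a) (L.map u).prod := by
      refine Commute.list_prod_right _ _ fun y hy => ?_
      obtain ⟨j, hj, rfl⟩ := List.mem_map.1 hy
      exact hc a j fun e => hL.1 (e ▸ hj)
    have hu' : Commute (c a) (L.map c).prod := by
      refine Commute.list_prod_right _ _ fun y hy => ?_
      obtain ⟨j, hj, rfl⟩ := List.mem_map.1 hy
      exact hcc a j fun e => hL.1 (e ▸ hj)
    rw [← mul_app, hu.eq, mul_app] at h1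
    have h2 := ih hL.2 _ h1
    rwa [← mul_app, ← hu'.eq, mul_app] at h2

/-- Abstract form of the decomposition and of its uniqueness. -/
lemma unique_abs (WK : (Fin m → ℕ) → E →L[ℝ] E)
    (hTT : ∀ l j : Fin m, Commute (WT (Pi.single l 1)) (WT (Pi.single j 1)))
    (hKK : ∀ l j : Fin m, Commute (WK (Pi.single l 1)) (WK (Pi.single j 1)))
    (hTK : ∀ l j : Fin m, l ≠ j → Commute (WT (Pi.single l 1)) (WK (Pi.single j 1)))
    (hone : ∀ l : Fin m, WT (Pi.single l 1) * WK (Pi.single l 1) = 1)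
    (hfix : ∀ (l : Fin m) y, WT (Pi.single l 1) y = y → WK (Pi.single l 1) y = y)
    (d : Finset (Fin m) → E) (hd : ∑ S, coboundaryProd m WK WT S (d S) = 0)
    (A : Finset (Fin m)) : coboundaryProd m WK WT A (d A) = 0 := by
  classical
  have hKT : ∀ l j : Fin m, l ≠ j → Commute (WK (Pi.single l 1)) (WT (Pi.single j 1)) :=
    fun l j h => (hTK j l h.symm).symm
  induction hn : m - A.card using Nat.strong_induction_on generalizing A with
  | _ n ih =>
  have hlt : ∀ S, A ⊂ S → coboundaryProd m WK WT S (d S) = 0 := by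
    intro S hS
    have h1 := Finset.card_lt_card hS
    have h2 : S.card ≤ m := by simpa using Finset.card_le_univ S
    exact ih (m - S.card) (by omega) S rfl
  have hprod : ∀ S, transferProd m WT A * coboundaryProd m WK WT S =
      ((List.finRange m).map fun l => (if l ∈ A then WT (Pi.single l 1) else 1) *
        (if l ∈ S then WK (Pi.single l 1) - 1
          else 1 - WK (Pi.single l 1) * WT (Pi.single l 1))).prod := by
    intro S
    refine list_prod_mul _ (List.nodup_finRange m) _ _ fun i j hij => ?_
    by_cases hj : j ∈ A
    · rw [if_pos hj]
      split_ifs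
      · exact (hKT i j hij).sub_left (Commute.one_left _)
      · exact (Commute.one_left _).sub_left ((hKT i j hij).mul_left (hTT i j))
    · rw [if_neg hj]; exact Commute.one_right _
  have hA : transferProd m WT A (coboundaryProd m WK WT A (d A)) = 0 := by
    have h1 := congrArg (transferProd m WT A) hd
    rw [map_sum, map_zero, Finset.sum_eq_single A] at h1
    · exact h1
    · intro S _ hne
      by_cases hAS : A ⊆ S
      · rw [hlt S (lt_of_le_of_ne hAS hne.symm), map_zero]
      · obtain ⟨l, hlA, hlS⟩ := Finset.not_subset.1 hAS
        rw [← mul_app, hprod S, List.prod_eq_zero]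
        · rfl
        · refine List.mem_map.2 ⟨l, List.mem_finRange l, ?_⟩
          rw [if_pos hlA, if_neg hlS, mul_sub, mul_one, ← mul_assoc, hone, one_mul, sub_self]
    · intro h; exact absurd (Finset.mem_univ A) h
  rw [← mul_app, hprod A] at hA
  refine kill_step _ _ ?_ ?_ ?_ _ (List.nodup_finRange m) (d A) hA
  · intro l y hy
    by_cases hl : l ∈ A
    · simp only [if_pos hl, mul_sub, mul_one, hone] at hy ⊢
      have h1 : WT (Pi.single l 1) y = y := (sub_eq_zero.1 hy).symm
      exact sub_eq_zero.2 (hfix l y h1)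
    · simpa only [if_neg hl, one_mul] using hy
  · intro i j hij
    have e1 : Commute (if i ∈ A then WK (Pi.single i 1) - 1
          else 1 - WK (Pi.single i 1) * WT (Pi.single i 1)) (WT (Pi.single j 1)) := by
      split_ifs
      · exact (hKT i j hij).sub_left (Commute.one_left _)
      · exact (Commute.one_left _).sub_left ((hKT i j hij).mul_left (hTT i j))
    have e2 : Commute (if i ∈ A then WK (Pi.single i 1) - 1
          else 1 - WK (Pi.single i 1) * WT (Pi.single i 1)) (WK (Pi.single j 1)) := by
      split_ifs
      · exact (hKK i j).sub_left (Commute.one_left _)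
      · exact (Commute.one_left _).sub_left ((hKK i j).mul_left (hTK i j hij))
    refine Commute.mul_right ?_ ?_
    · by_cases hj : j ∈ A
      · rw [if_pos hj]; exact e1
      · rw [if_neg hj]; exact Commute.one_right _
    · by_cases hj : j ∈ A
      · rw [if_pos hj]; exact e2.sub_right (Commute.one_right _)
      · rw [if_neg hj]; exact (Commute.one_right _).sub_right (e2.mul_right e1)
  · intro i j hij
    have e1 : Commute (if i ∈ A then WK (Pi.single i 1) - 1
          else 1 - WK (Pi.single i 1) * WT (Pi.single i 1)) (WT (Pi.single j 1)) := by
      split_ifs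
      · exact (hKT i j hij).sub_left (Commute.one_left _)
      · exact (Commute.one_left _).sub_left ((hKT i j hij).mul_left (hTT i j))
    have e2 : Commute (if i ∈ A then WK (Pi.single i 1) - 1
          else 1 - WK (Pi.single i 1) * WT (Pi.single i 1)) (WK (Pi.single j 1)) := by
      split_ifs
      · exact (hKK i j).sub_left (Commute.one_left _)
      · exact (Commute.one_left _).sub_left ((hKK i j).mul_left (hTK i j hij))
    by_cases hj : j ∈ A
    · rw [if_pos hj]; exact e2.sub_right (Commute.one_right _)
    · rw [if_neg hj]; exact (Commute.one_right _).sub_right (e2.mul_right e1)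

end Series

/-- Lemma 5, martingale–coboundary decomposition: a canonical kernel
`f ∈ L_{p,π}(μ^m)` whose transfer series `g = Σ_𝐤 V^{*𝐤}f` converges decomposes as
`f = Σ_{S⊆{1,…,m}} A^S f` with `A^S f = ∏_{l∉S}(I−V^{𝐞_l}V^{*𝐞_l})∏_{l∈S}(V^{𝐞_l}−I) h^S`,
`h^S = ∏_{l∈S}V^{*𝐞_l} g`; `g` and the `h^S` are canonical and the summands are unique. -/
theorem statement11
    {X : Type} [MeasurableSpace X] [StandardBorelSpace X]
    (μ : Measure X) [IsProbabilityMeasure μ]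
    (m : ℕ) (hm : 1 ≤ m) (p : ℝ≥0∞) [Fact (1 ≤ p)]
    (T : X → X) (hT : MeasurePreserving T μ μ)
    (E : Type) [NormedAddCommGroup E] [NormedSpace ℝ E] [CompleteSpace E]
    (tp : ContinuousMultilinearMap ℝ (fun _ : Fin m => Lp ℝ p μ) E)
    (hE : IsPTP μ (fun _ : Fin m => p) E tp)
    (J : E →L[ℝ] Lp ℝ p (pm μ m)) (hJ : IsEmbed μ (fun _ : Fin m => p) p tp J)
    (WK : (Fin m → ℕ) → E →L[ℝ] E)
    (hWK : ∀ k, IsTKoop μ (fun _ : Fin m => p) tp (fun _ => T) k (WK k))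
    (WT : (Fin m → ℕ) → E →L[ℝ] E)
    (hWT : ∀ k, IsTTrans μ (fun _ : Fin m => p) tp (fun _ => T) k (WT k))
    (f : E) (hf : Canonical μ m (J f : (Fin m → X) → ℝ))
    (g : E)
    (hg : Tendsto (fun n : Fin m → ℕ =>
        ∑ k ∈ Fintype.piFinset (fun i => Finset.range (n i)), WT k f) atTop (𝓝 g)) :
    f = (∑ S : Finset (Fin m), coboundaryProd m WK WT S (transferProd m WT S g)) ∧
    Canonical μ m (J g : (Fin m → X) → ℝ) ∧
    (∀ S : Finset (Fin m),
      Canonical μ m (J (transferProd m WT S g) : (Fin m → X) → ℝ)) ∧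
    (∀ b : Finset (Fin m) → E, (∀ S, Canonical μ m (J (b S) : (Fin m → X) → ℝ)) →
      f = (∑ S : Finset (Fin m), coboundaryProd m WK WT S (b S)) →
      ∀ S, coboundaryProd m WK WT S (b S) =
        coboundaryProd m WK WT S (transferProd m WT S g)) := by
  have hmul := WT_mul hT hE hWT
  have hKmul := WK_mul hT hE hWK
  have hTT : ∀ l j : Fin m, Commute (WT (Pi.single l 1)) (WT (Pi.single j 1)) := by
    intro l j
    rw [Commute, SemiconjBy, hmul, hmul, add_comm]
  have hKK : ∀ l j : Fin m, Commute (WK (Pi.single l 1)) (WK (Pi.single j 1)) := by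
    intro l j
    rw [Commute, SemiconjBy, hKmul, hKmul, add_comm]
  have hTK : ∀ l j : Fin m, l ≠ j → Commute (WT (Pi.single l 1)) (WK (Pi.single j 1)) := by
    intro l j hlj
    refine WT_WK_comm hT hE hWK hWT fun i => ?_
    rcases eq_or_ne i l with rfl | hi
    · right; simp [hlj]
    · left; simp [hi]
  have hone : ∀ l : Fin m, WT (Pi.single l 1) * WK (Pi.single l 1) = 1 :=
    fun l => WT_WK hT hE hWK hWT _
  have hdec : f = ∑ S : Finset (Fin m), coboundaryProd m WK WT S (transferProd m WT S g) := by
    have h1 : ∀ S : Finset (Fin m), coboundaryProd m WK WT S * transferProd m WT S =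
        ((List.finRange m).map fun l =>
          if l ∈ S then (WK (Pi.single l 1) - 1) * WT (Pi.single l 1)
          else 1 - WK (Pi.single l 1) * WT (Pi.single l 1)).prod := by
      intro S
      refine (list_prod_mul _ (List.nodup_finRange m) _ _ fun i j hij => ?_).trans ?_
      · by_cases hi : i ∈ S
        · rw [if_pos hi]
          split_ifs
          · exact (hTK i j hij).sub_right (Commute.one_right _)
          · exact (Commute.one_right _).sub_right ((hTK i j hij).mul_right (hTT i j))
        · rw [if_neg hi]; exact Commute.one_left _
      · congr 2
        funext l
        by_cases hl : l ∈ S <;> simp [hl]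
    have h2 := sum_list_prod m
      (fun l : Fin m => (WK (Pi.single l 1) - 1) * WT (Pi.single l 1))
      (fun l : Fin m => 1 - WK (Pi.single l 1) * WT (Pi.single l 1))
    have h3 := congrArg (fun A : E →L[ℝ] E => A g) h2
    simp only [sum_apply] at h3
    simp only [← mul_app, h1]
    rw [h3]
    refine (series_eq hmul (WT_zero hE hWT) f g hg).trans ?_
    congr 3
    funext l
    rw [sub_mul, one_mul]
    abel
  have hcg : Canonical μ m (J g : (Fin m → X) → ℝ) := by
    rw [canonical_iff_boxInt]
    intro l s hs hl
    have h1 := ((boxInt J s).continuous.tendsto g).comp hg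
    refine tendsto_nhds_unique h1 (tendsto_const_nhds.congr fun n => ?_)
    simp only [Function.comp_apply]
    rw [map_sum]
    refine (Finset.sum_eq_zero fun k _ => ?_).symm
    exact (canonical_iff_boxInt _).1 (canonical_WT hT hE hJ hWT k hf) l s hs hl
  refine ⟨hdec, hcg, ?_, ?_⟩
  · intro S
    rw [transferProd]
    generalize List.finRange m = L
    induction L with
    | nil => exact hcg
    | cons a L ih =>
      rw [List.map_cons, List.prod_cons, mul_app]
      by_cases ha : a ∈ S
      · rw [if_pos ha]
        exact canonical_WT hT hE hJ hWT _ ih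
      · rw [if_neg ha]
        exact ih
  · intro b _ hb S
    have h := unique_abs WK hTT hKK hTK hone
      (fun l y hy => fix_step hT hE hJ hWK hWT (Pi.single l 1) hy)
      (fun S => b S - transferProd m WT S g)
      (by simp only [map_sub, Finset.sum_sub_distrib]; rw [← hb, ← hdec, sub_self]) S
    rw [map_sub] at h
    exact sub_eq_zero.1 h

end VonMises
end
end

section
/- Let p ∈ [1,∞] and let (e_k)_{k≥0} be functions with e_0 ≡ 1 and, for every k ≥ 1, e_k ∈ L_p(μ) with ∫_X e_k dμ = 0 and C_{p,k} := Σ_{n ≥ 0} |V^{*n} e_k|_p < ∞. Suppose f ∈ L_p(μ^m) admits a representation f(x_1,…,x_m) = Σ_{𝐤 : k_1,…,k_m ≥ 1} λ_𝐤(f) e_{k_1}(x_1)⋯e_{k_m}(x_m) with coefficients satisfying C_p(f) := Σ_{𝐤 : k_1,…,k_m ≥ 1} |λ_𝐤(f)| C_{p,k_1}⋯C_{p,k_m} < ∞. Then f is a canonical kernel of degree m, f ∈ L_{p,π}(μ^m), the series g = Σ_{𝐤 ∈ ℤ_+^m} V^{*𝐤} f converges in L_{p,π}(μ^m), and |g|_{p,m,π}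 ≤ C_p(f). -/
open MeasureTheory Filter Topology ENNReal ProbabilityTheory

noncomputable section

namespace VonMises

section Helpers

variable {X : Type} [MeasurableSpace X]

/-- The map replacing the `l`-th coordinate by an independent copy preserves the measure. -/
lemma mp_update (μ : Measure X) [IsProbabilityMeasure μ] (m : ℕ) (l : Fin m) :
    MeasurePreserving (fun z : (Fin m → X) × X => Function.update z.1 l z.2)
      ((pm μ m).prod μ) (pm μ m) := by
  have hmeas : Measurable (fun z : (Fin m → X) × X => Function.update z.1 l z.2) := by
    refine measurable_pi_lambda _ fun i => ?_
    by_cases h : i = l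
    · subst h
      simpa using measurable_snd
    · simp only [Function.update_of_ne h]
      exact (measurable_pi_apply i).comp measurable_fst
  refine ⟨hmeas, ?_⟩
  symm
  refine Measure.pi_eq fun s hs => ?_
  rw [Measure.map_apply hmeas (MeasurableSet.univ_pi hs)]
  have : (fun z : (Fin m → X) × X => Function.update z.1 l z.2) ⁻¹' (Set.univ.pi s)
      = (Set.univ.pi (Function.update s l Set.univ)) ×ˢ (s l) := by
    ext z
    simp only [Set.mem_preimage, Set.mem_pi, Set.mem_univ, true_imp_iff, Set.mem_prod]
    constructor
    · intro h
      refine ⟨fun i => ?_, by simpa using h l⟩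
      by_cases hi : i = l
      · subst hi; simp
      · simpa [hi] using h i
    · rintro ⟨h1, h2⟩ i
      by_cases hi : i = l
      · subst hi; simpa using h2
      · simpa [hi] using h1 i
  rw [this, Measure.prod_prod, Measure.pi_pi,
    ← Finset.mul_prod_erase Finset.univ _ (Finset.mem_univ l),
    ← Finset.mul_prod_erase Finset.univ (fun i => μ (s i)) (Finset.mem_univ l)]
  simp only [Function.update_self, measure_univ, one_mul]
  rw [mul_comm]
  congr 1
  refine Finset.prod_congr rfl fun i hi => ?_
  rw [Function.update_of_ne (Finset.ne_of_mem_erase hi)]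

lemma canonical_of_hasSum (μ : Measure X) [IsProbabilityMeasure μ] (m : ℕ)
    (p : ℝ≥0∞) [Fact (1 ≤ p)] (e : ℕ → Lp ℝ p μ)
    (hemean : ∀ k, 1 ≤ k → ∫ x, (e k : X → ℝ) x ∂μ = 0)
    (f : Lp ℝ p (pm μ m))
    (P : (Fin m → ℕ) → Lp ℝ p (pm μ m))
    (hP : ∀ k : Fin m → ℕ,
      (P k : (Fin m → X) → ℝ) =ᵐ[pm μ m] fun x => ∏ i, (e (k i + 1) : X → ℝ) (x i))
    (lam : (Fin m → ℕ) → ℝ)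
    (hrep : HasSum (fun k => lam k • P k) f) :
    Canonical μ m (f : (Fin m → X) → ℝ) := by
  intro l
  have hp : (1 : ℝ≥0∞) ≤ p := Fact.out
  have hu := mp_update μ m l
  have hint : ∀ F : Lp ℝ p (pm μ m), Integrable F (pm μ m) :=
    fun F => (Lp.memLp F).integrable hp
  have hintu : ∀ F : Lp ℝ p (pm μ m), Integrable
      (fun z : (Fin m → X) × X => F (Function.update z.1 l z.2)) ((pm μ m).prod μ) :=
    fun F => hu.integrable_comp_of_integrable (hint F)
  have hae : ∀ F : Lp ℝ p (pm μ m), ∀ᵐ x ∂(pm μ m),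
      Integrable (fun y => F (Function.update x l y)) μ := fun F => (hintu F).prod_right_ae
  have htr : ∀ F G : (Fin m → X) → ℝ, F =ᵐ[pm μ m] G → ∀ᵐ x ∂(pm μ m), ∀ᵐ y ∂μ,
      F (Function.update x l y) = G (Function.update x l y) := fun F G h =>
    Measure.ae_ae_of_ae_prod (hu.quasiMeasurePreserving.ae h)
  -- each product term is canonical
  have hPk : ∀ k, ∀ᵐ x ∂(pm μ m), ∫ y, (P k) (Function.update x l y) ∂μ = 0 := by
    intro k
    filter_upwards [htr _ _ (hP k)] with x hx
    rw [integral_congr_ae hx]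
    have : ∀ y, ∏ i, (e (k i + 1) : X → ℝ) (Function.update x l y i)
        = (e (k l + 1) : X → ℝ) y * ∏ i ∈ Finset.univ.erase l, (e (k i + 1) : X → ℝ) (x i) := by
      intro y
      rw [← Finset.mul_prod_erase Finset.univ _ (Finset.mem_univ l), Function.update_self]
      congr 1
      refine Finset.prod_congr rfl fun i hi => ?_
      rw [Function.update_of_ne (Finset.ne_of_mem_erase hi)]
    simp only [this]
    rw [integral_mul_const, hemean _ (by omega), zero_mul]
  have hS : ∀ s : Finset (Fin m → ℕ), ∀ᵐ x ∂(pm μ m),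
      ∫ y, (∑ k ∈ s, lam k • P k : Lp ℝ p (pm μ m)) (Function.update x l y) ∂μ = 0 := by
    classical
    intro s
    induction s using Finset.induction_on with
    | empty =>
      filter_upwards [htr _ _ (Lp.coeFn_zero ℝ p (pm μ m))] with x hx
      rw [Finset.sum_empty, integral_congr_ae hx]
      simp
    | insert a s ha ih =>
      filter_upwards [htr _ _ (Lp.coeFn_add (lam a • P a) (∑ k ∈ s, lam k • P k)),
        htr _ _ (Lp.coeFn_smul (lam a) (P a)), ih, hPk a, hae (P a),
        hae (∑ k ∈ s, lam k • P k)] with x h1 h2 h3 h4 h5 h6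
      rw [Finset.sum_insert ha]
      have : ∀ᵐ y ∂μ, (lam a • P a + ∑ k ∈ s, lam k • P k : Lp ℝ p (pm μ m))
          (Function.update x l y) = lam a * P a (Function.update x l y)
          + (∑ k ∈ s, lam k • P k : Lp ℝ p (pm μ m)) (Function.update x l y) := by
        filter_upwards [h1, h2] with y h1 h2
        rw [h1, Pi.add_apply, h2, Pi.smul_apply, smul_eq_mul]
      rw [integral_congr_ae this, integral_add (h5.const_mul _) h6, integral_const_mul, h3, h4]
      simp
  -- the L¹ bound
  have hbound : ∀ s : Finset (Fin m → ℕ),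
      ∫⁻ x, ‖∫ y, f (Function.update x l y) ∂μ‖ₑ ∂(pm μ m)
        ≤ eLpNorm (⇑(∑ k ∈ s, lam k • P k : Lp ℝ p (pm μ m)) - ⇑f) p (pm μ m) := by
    intro s
    set S : Lp ℝ p (pm μ m) := ∑ k ∈ s, lam k • P k with hSdef
    calc ∫⁻ x, ‖∫ y, f (Function.update x l y) ∂μ‖ₑ ∂(pm μ m)
        ≤ ∫⁻ x, ∫⁻ y, ‖(⇑S - ⇑f) (Function.update x l y)‖ₑ ∂μ ∂(pm μ m) := by
          refine lintegral_mono_ae ?_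
          filter_upwards [hS s, hae f, hae S] with x h1 h2 h3
          have : ∫ y, (⇑S - ⇑f) (Function.update x l y) ∂μ
              = - ∫ y, f (Function.update x l y) ∂μ := by
            simp only [Pi.sub_apply]
            rw [integral_sub h3 h2, h1, zero_sub]
          rw [← enorm_neg, ← this]
          exact enorm_integral_le_lintegral_enorm _
      _ = ∫⁻ z, ‖(⇑S - ⇑f) (Function.update z.1 l z.2)‖ₑ ∂((pm μ m).prod μ) := by
          rw [lintegral_prod]
          exact ((hintu S).sub (hintu f)).aestronglyMeasurable.enorm
      _ = ∫⁻ x, ‖(⇑S - ⇑f) x‖ₑ ∂(pm μ m) := by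
          have hgen : ∀ G : (Fin m → X) → ℝ≥0∞, AEMeasurable G (pm μ m) →
              ∫⁻ z, G (Function.update z.1 l z.2) ∂((pm μ m).prod μ) = ∫⁻ x, G x ∂(pm μ m) := by
            intro G hG
            conv_rhs => rw [← hu.map_eq]
            rw [lintegral_map' (by rwa [hu.map_eq]) hu.measurable.aemeasurable]
          exact hgen (fun x => ‖(⇑S - ⇑f) x‖ₑ)
            ((hint S).sub (hint f)).aestronglyMeasurable.enorm
      _ = eLpNorm (⇑S - ⇑f) 1 (pm μ m) := (eLpNorm_one_eq_lintegral_enorm).symm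
      _ ≤ eLpNorm (⇑S - ⇑f) p (pm μ m) :=
          eLpNorm_le_eLpNorm_of_exponent_le hp
            ((hint S).sub (hint f)).aestronglyMeasurable
  have hlim := (Lp.tendsto_Lp_iff_tendsto_eLpNorm' _ f).1 hrep
  have h0 : ∫⁻ x, ‖∫ y, f (Function.update x l y) ∂μ‖ₑ ∂(pm μ m) = 0 :=
    le_antisymm (ge_of_tendsto' hlim fun s => hbound s) bot_le
  rw [lintegral_eq_zero_iff' (hintu f).aestronglyMeasurable.integral_prod_right'.enorm] at h0
  filter_upwards [h0] with x hx
  simpa using hx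

lemma transfer_pow (μ : Measure X) (p : ℝ≥0∞) [Fact (1 ≤ p)]
    (T : X → X) (hT : MeasurePreserving T μ μ)
    (Vs : Lp ℝ p μ →L[ℝ] Lp ℝ p μ) (hVs : ∀ h, IsTransfer μ T 1 h (Vs h)) (n : ℕ)
    (h : Lp ℝ p μ) : IsTransfer μ T n h ((Vs ^ n) h) := by
  induction n with
  | zero => intro s hs; simp
  | succ n ih =>
    intro s hs
    rw [pow_succ', ContinuousLinearMap.mul_apply, hVs _ s hs,
      ih _ (by simpa using hT.measurable hs), ← Set.preimage_comp, ← Function.iterate_add,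
      add_comm 1 n]

lemma sum_prod_le {m : ℕ} (a : Fin m → ℕ → ℝ) (ha : ∀ i n, 0 ≤ a i n)
    (hs : ∀ i, Summable (a i)) (s : Finset (Fin m → ℕ)) :
    ∑ j ∈ s, ∏ i, a i (j i) ≤ ∏ i, ∑' n, a i n := by
  classical
  calc ∑ j ∈ s, ∏ i, a i (j i)
      ≤ ∑ j ∈ Fintype.piFinset (fun i => s.image fun j => j i), ∏ i, a i (j i) := by
        refine Finset.sum_le_sum_of_subset_of_nonneg ?_
          fun j _ _ => Finset.prod_nonneg fun i _ => ha i _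
        intro j hj
        rw [Fintype.mem_piFinset]
        exact fun i => Finset.mem_image_of_mem _ hj
    _ = ∏ i, ∑ n ∈ s.image (fun j => j i), a i n := by rw [Finset.prod_univ_sum]
    _ ≤ ∏ i, ∑' n, a i n :=
        Finset.prod_le_prod (fun i _ => Finset.sum_nonneg fun n _ => ha i n)
          fun i _ => (hs i).sum_le_tsum _ fun n _ => ha i n

lemma tendsto_boxes (m : ℕ) : Tendsto (fun n : Fin m → ℕ =>
    Fintype.piFinset (fun i => Finset.range (n i))) atTop atTop := by
  classical
  refine tendsto_atTop_finset_of_monotone ?_ ?_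
  · intro a b hab
    exact Fintype.piFinset_subset _ _ fun i => Finset.range_mono (hab i)
  · intro x
    exact ⟨fun i => x i + 1, by simp [Fintype.mem_piFinset]⟩

end Helpers

/-- Proposition 6: a sufficient condition, in terms of an absolutely
convergent product expansion `f = Σ_𝐤 λ_𝐤 e_{k_1} ⊗ ⋯ ⊗ e_{k_m}` with
`Σ_𝐤 |λ_𝐤| C_{p,k_1}⋯C_{p,k_m} < ∞`, `C_{p,k} = Σ_n |V^{*n}e_k|_p`, for `f` to be a
canonical kernel of `L_{p,π}(μ^m)` with convergent transfer series `g`, and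
`|g|_{p,m,π} ≤ C_p(f)`. -/
theorem statement14
    {X : Type} [MeasurableSpace X] [StandardBorelSpace X]
    (μ : Measure X) [IsProbabilityMeasure μ]
    (m : ℕ) (hm : 1 ≤ m) (p : ℝ≥0∞) [Fact (1 ≤ p)]
    (T : X → X) (hT : MeasurePreserving T μ μ)
    (E : Type) [NormedAddCommGroup E] [NormedSpace ℝ E] [CompleteSpace E]
    (tp : ContinuousMultilinearMap ℝ (fun _ : Fin m => Lp ℝ p μ) E)
    (hE : IsPTP μ (fun _ : Fin m => p) E tp)
    (J : E →L[ℝ] Lp ℝ p (pm μ m)) (hJ : IsEmbed μ (fun _ : Fin m => p) p tp J)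
    (WT : (Fin m → ℕ) → E →L[ℝ] E)
    (hWT : ∀ k, IsTTrans μ (fun _ : Fin m => p) tp (fun _ => T) k (WT k))
    -- the one-dimensional transfer operator `V^*` on `L_p(μ)`
    (Vs : Lp ℝ p μ →L[ℝ] Lp ℝ p μ) (hVs : ∀ h, IsTransfer μ T 1 h (Vs h))
    -- the system `(e_k)` and the constants `C_{p,k}`
    (e : ℕ → Lp ℝ p μ)
    (he0 : (e 0 : X → ℝ) =ᵐ[μ] fun _ => 1)
    (hemean : ∀ k, 1 ≤ k → ∫ x, (e k : X → ℝ) x ∂μ = 0)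
    (hCp : ∀ k, 1 ≤ k → Summable fun n : ℕ => ‖(Vs ^ n) (e k)‖)
    -- the kernel `f` and its expansion with indices `𝐤 ≥ 𝟏` (coded by `k i + 1`)
    (f : Lp ℝ p (pm μ m))
    (P : (Fin m → ℕ) → Lp ℝ p (pm μ m))
    (hP : ∀ k : Fin m → ℕ,
      (P k : (Fin m → X) → ℝ) =ᵐ[pm μ m] fun x => ∏ i, (e (k i + 1) : X → ℝ) (x i))
    (lam : (Fin m → ℕ) → ℝ)
    (hrep : HasSum (fun k => lam k • P k) f)
    (hCf : Summable fun k : Fin m → ℕ =>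
      |lam k| * ∏ i, ∑' n : ℕ, ‖(Vs ^ n) (e (k i + 1))‖) :
    Canonical μ m (f : (Fin m → X) → ℝ) ∧
    ∃ φ g : E, J φ = f ∧
      Tendsto (fun n : Fin m → ℕ =>
          ∑ k ∈ Fintype.piFinset (fun i => Finset.range (n i)), WT k φ) atTop (𝓝 g) ∧
      ‖g‖ ≤ ∑' k : Fin m → ℕ, |lam k| * ∏ i, ∑' n : ℕ, ‖(Vs ^ n) (e (k i + 1))‖ := by
  refine ⟨canonical_of_hasSum μ m p e hemean f P hP lam hrep, ?_⟩
  set a : (Fin m → ℕ) → Fin m → ℕ → ℝ := fun k i n => ‖(Vs ^ n) (e (k i + 1))‖ with ha_def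
  have ha : ∀ k i n, 0 ≤ a k i n := fun k i n => norm_nonneg _
  have hs : ∀ k i, Summable (a k i) := fun k i => hCp _ (by omega)
  set t : (Fin m → ℕ) → (Fin m → ℕ) → E :=
    fun k j => lam k • tp (fun i => (Vs ^ (j i)) (e (k i + 1))) with ht_def
  have hnt : ∀ k j, ‖t k j‖ = |lam k| * ∏ i, a k i (j i) := by
    intro k j
    rw [ht_def, norm_smul, hE.crossNorm, Real.norm_eq_abs]
  have hsum1 : ∀ k, Summable fun j => ‖t k j‖ := by
    intro k
    simp only [hnt]
    exact (summable_of_sum_le (fun j => Finset.prod_nonneg fun i _ => ha k i _)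
      (sum_prod_le (a k) (ha k) (hs k))).mul_left _
  have hle1 : ∀ k, ∑' j, ‖t k j‖ ≤ |lam k| * ∏ i, ∑' n, a k i n := by
    intro k
    simp only [hnt]
    rw [tsum_mul_left]
    refine mul_le_mul_of_nonneg_left ?_ (abs_nonneg _)
    exact Real.tsum_le_of_sum_le (fun j => Finset.prod_nonneg fun i _ => ha k i _)
      (sum_prod_le (a k) (ha k) (hs k))
  have hsum2 : Summable fun k => ∑' j, ‖t k j‖ :=
    Summable.of_nonneg_of_le (fun k => tsum_nonneg fun j => norm_nonneg _) hle1 hCf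
  have hdouble : Summable fun q : (Fin m → ℕ) × (Fin m → ℕ) => ‖t q.1 q.2‖ :=
    (summable_prod_of_nonneg fun q => norm_nonneg _).2 ⟨hsum1, hsum2⟩
  have hd : Summable fun q : (Fin m → ℕ) × (Fin m → ℕ) => t q.1 q.2 := hdouble.of_norm
  have hcol : ∀ j, Summable fun k => t k j := fun j => hd.prod_symm.prod_factor j
  have ht0 : ∀ k, t k 0 = lam k • tp (fun i => e (k i + 1)) := by
    intro k; simp [ht_def]
  have hJt : ∀ k, J (tp (fun i => e (k i + 1))) = P k := fun k =>
    Lp.ext ((hJ _).trans (hP k).symm)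
  have hW : ∀ j k, WT j (t k 0) = t k j := by
    intro j k
    rw [ht0, map_smul, hWT j _ _ fun i => transfer_pow μ p T hT Vs hVs (j i) (e (k i + 1))]
  have hφ := (hcol 0).hasSum
  have hWφ : ∀ j, HasSum (fun k => t k j) (WT j (∑' k, t k 0)) := by
    intro j
    have := (WT j).hasSum hφ
    simpa only [hW] using this
  have hg : HasSum (fun j => WT j (∑' k, t k 0)) (∑' q : (Fin m → ℕ) × (Fin m → ℕ), t q.1 q.2) := by
    have h1 := (Equiv.prodComm (Fin m → ℕ) (Fin m → ℕ)).hasSum_iff.2 hd.hasSum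
    exact h1.prod_fiberwise fun j => hWφ j
  refine ⟨∑' k, t k 0, ∑' q : (Fin m → ℕ) × (Fin m → ℕ), t q.1 q.2, ?_, ?_, ?_⟩
  · have h := J.hasSum hφ
    simp only [ht0, map_smul, hJt] at h
    simp only [ht0]
    exact h.unique hrep
  · have hg' : Tendsto (fun s : Finset (Fin m → ℕ) => ∑ j ∈ s, WT j (∑' k, t k 0)) atTop
        (𝓝 (∑' q : (Fin m → ℕ) × (Fin m → ℕ), t q.1 q.2)) := hg
    exact hg'.comp (tendsto_boxes m)
  · calc ‖∑' q : (Fin m → ℕ) × (Fin m → ℕ), t q.1 q.2‖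
        ≤ ∑' q : (Fin m → ℕ) × (Fin m → ℕ), ‖t q.1 q.2‖ := norm_tsum_le_tsum_norm hdouble
      _ = ∑' k, ∑' j, ‖t k j‖ := hdouble.tsum_prod
      _ ≤ _ := hsum2.tsum_le_tsum hle1 hCf

end VonMises
end
end
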